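/- arXiv:2502.07745 — 4 statements merged into one kernel-verified Lean document; each statement's English description precedes it below -/
import Mathlib

section
/- For positive semidefinite ρ, σ on a finite-dimensional Hilbert space, the measured relative entropy satisfies D_M(ρ‖σ) = sup_{ω ≻ 0} tr[ρ log ω] + tr[ρ] − tr[σω], where the supremum is over positive definite ω. -/
open Matrix
open scoped ComplexOrder

noncomputable section

/-- Apply a real function to a Hermitian matrix via the functional calculus. -/
def matFun (g : ℝ → ℝ) {ι : Type*} [Fintype ι] [DecidableEq ι]
    (A : Matrix ι ι ℂ) : Matrix ι ι ℂ :=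
  if h : A.IsHermitian then
    (h.eigenvectorUnitary : Matrix ι ι ℂ) *
      Matrix.diagonal (fun i => (g (h.eigenvalues i) : ℂ)) *
      star (h.eigenvectorUnitary : Matrix ι ι ℂ)
  else 0

/-- Single term `p log(p/q)` of the classical Kullback-Leibler divergence,
with the conventions `0 log(0/q) = 0` and `p log(p/0) = +∞` for `p ≠ 0`. -/
def klQ (p q : ℝ) : EReal :=
  if p = 0 then 0 else if q = 0 then ⊤ else ((p * Real.log (p / q) : ℝ) : EReal)

/-- The measured relative entropy: supremum over POVMs of the classical
Kullback-Leibler divergence of the induced distributions. -/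
def measKL {ι : Type*} [Fintype ι] [DecidableEq ι] (ρ σ : Matrix ι ι ℂ) : EReal :=
  ⨆ (m : ℕ) (M : Fin m → Matrix ι ι ℂ)
    (_ : (∀ x, (M x).PosSemidef) ∧ ∑ x, M x = 1),
      ∑ x, klQ ((ρ * M x).trace.re) ((σ * M x).trace.re)

open scoped MatrixOrder in
/-- The trace of a product of two positive semidefinite matrices is nonnegative. -/
lemma trace_mul_re_nonneg {ι : Type*} [Fintype ι] [DecidableEq ι] {A B : Matrix ι ι ℂ}
    (hA : A.PosSemidef) (hB : B.PosSemidef) : 0 ≤ (A * B).trace.re := by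
  obtain ⟨C, rfl⟩ := CStarAlgebra.nonneg_iff_eq_star_mul_self.1 hA.nonneg
  rw [star_eq_conjTranspose, Matrix.mul_assoc, trace_mul_comm]
  exact (Complex.nonneg_iff.1 (hB.mul_mul_conjTranspose_same C).trace_nonneg).1

lemma trace_mul_conj_diagonal_re {ι : Type*} [Fintype ι] [DecidableEq ι]
    (ρ U : Matrix ι ι ℂ) (d : ι → ℝ) :
    (ρ * (U * diagonal (fun i => (d i : ℂ)) * star U)).trace.re =
      ∑ i, ((star U * ρ * U) i i).re * d i := by
  have h : (ρ * (U * diagonal (fun i => (d i : ℂ)) * star U)).trace =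
      (star U * ρ * U * diagonal (fun i => (d i : ℂ))).trace := by
    rw [← Matrix.mul_assoc, trace_mul_comm]
    simp only [Matrix.mul_assoc]
  rw [h]
  simp [trace, mul_diagonal]

lemma Matrix.IsHermitian.eq_conj_diagonal {ι : Type*} [Fintype ι] [DecidableEq ι]
    {A : Matrix ι ι ℂ} (hA : A.IsHermitian) :
    A = (hA.eigenvectorUnitary : Matrix ι ι ℂ) *
      diagonal (fun i => (hA.eigenvalues i : ℂ)) *
      star (hA.eigenvectorUnitary : Matrix ι ι ℂ) := by
  conv_lhs => rw [hA.spectral_theorem, Unitary.conjStarAlgAut_apply]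
  rfl

/-- A comparison of resolvent sums integrates to a comparison of logarithmic sums. -/
lemma sum_mul_log_le_of_resolvent {α β : Type*} [Fintype α] [Fintype β]
    {a t : α → ℝ} {m l : β → ℝ} (ht : ∀ i, 0 < t i) (hl : ∀ x, 0 < l x)
    (hsum : ∑ i, a i = ∑ x, m x)
    (hres : ∀ s : ℝ, 0 ≤ s → ∑ i, a i * (t i + s)⁻¹ ≤ ∑ x, m x * (l x + s)⁻¹) :
    ∑ x, m x * Real.log (l x) ≤ ∑ i, a i * Real.log (t i) := by
  set H : ℝ → ℝ := fun s =>
    ∑ i, a i * Real.log (t i + s) - ∑ x, m x * Real.log (l x + s) with hH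
  have hder : ∀ s : ℝ, 0 ≤ s → HasDerivAt H
      (∑ i, a i * (t i + s)⁻¹ - ∑ x, m x * (l x + s)⁻¹) s := by
    intro s hs
    refine HasDerivAt.sub (HasDerivAt.fun_sum fun i _ => ?_) (HasDerivAt.fun_sum fun x _ => ?_)
    · have h := ((hasDerivAt_id s).const_add (t i)).log (by have := ht i; simp; positivity)
      simpa using h.const_mul (a i)
    · have h := ((hasDerivAt_id s).const_add (l x)).log (by have := hl x; simp; positivity)
      simpa using h.const_mul (m x)
  have hanti : AntitoneOn H (Set.Ici 0) := by
    refine antitoneOn_of_deriv_nonpos (convex_Ici 0)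
      (fun s hs => (hder s hs).continuousAt.continuousWithinAt) ?_ ?_
    · intro s hs
      rw [interior_Ici] at hs
      exact (hder s (le_of_lt hs)).differentiableAt.differentiableWithinAt
    · intro s hs
      rw [interior_Ici] at hs
      rw [(hder s (le_of_lt hs)).deriv]
      linarith [hres s (le_of_lt hs)]
  have hlim : Filter.Tendsto H Filter.atTop (nhds 0) := by
    have hH' : H = fun s => ∑ i, a i * (Real.log (s + t i) - Real.log s) -
        ∑ x, m x * (Real.log (s + l x) - Real.log s) := by
      funext s
      simp only [hH, mul_sub, Finset.sum_sub_distrib, ← Finset.sum_mul, hsum, add_comm s]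
      ring
    rw [hH']
    have h1 : Filter.Tendsto (fun s => ∑ i, a i * (Real.log (s + t i) - Real.log s))
        Filter.atTop (nhds (∑ i, a i * 0)) :=
      tendsto_finsetSum _ fun i _ => (Real.tendsto_log_comp_add_sub_log (t i)).const_mul (a i)
    have h2 : Filter.Tendsto (fun s => ∑ x, m x * (Real.log (s + l x) - Real.log s))
        Filter.atTop (nhds (∑ x, m x * 0)) :=
      tendsto_finsetSum _ fun x _ => (Real.tendsto_log_comp_add_sub_log (l x)).const_mul (m x)
    simpa using h1.sub h2
  have h0 : 0 ≤ H 0 := by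
    refine le_of_tendsto hlim ?_
    filter_upwards [Filter.eventually_ge_atTop (0 : ℝ)] with s hs
    exact hanti (Set.mem_Ici.2 le_rfl) hs hs
  simpa [hH] using h0

lemma posDef_sum_smul {ι κ : Type*} [Fintype ι] [DecidableEq ι] [Fintype κ]
    {M : κ → Matrix ι ι ℂ} (hM : ∀ x, (M x).PosSemidef) (hM1 : ∑ x, M x = 1)
    {l : κ → ℝ} (hl : ∀ x, 0 < l x) : (∑ x, (l x : ℂ) • M x).PosDef := by
  obtain ⟨c, hc, hcl⟩ : ∃ c : ℝ, 0 < c ∧ ∀ x, c ≤ l x := by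
    rcases isEmpty_or_nonempty κ with h | h
    · exact ⟨1, one_pos, fun x => h.elim x⟩
    · obtain ⟨y, hy⟩ := Finite.exists_min l
      exact ⟨l y, hl y, hy⟩
  have h : ∑ x, (l x : ℂ) • M x = (c : ℂ) • (1 : Matrix ι ι ℂ) +
      ∑ x, ((l x - c : ℝ) : ℂ) • M x := by
    rw [← hM1, Finset.smul_sum, ← Finset.sum_add_distrib]
    refine Finset.sum_congr rfl fun x _ => ?_
    rw [← add_smul]
    push_cast
    ring_nf
  rw [h]
  refine PosDef.add_posSemidef (PosDef.one.smul (by exact_mod_cast hc)) ?_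
  refine posSemidef_sum _ fun x _ => (hM x).smul ?_
  exact_mod_cast sub_nonneg.2 (hcl x)

/-- Operator convexity of the inverse, for an average weighted by a POVM. -/
lemma posSemidef_sum_inv_smul_sub {ι κ : Type*} [Fintype ι] [DecidableEq ι] [Fintype κ]
    {M : κ → Matrix ι ι ℂ} (hM : ∀ x, (M x).PosSemidef) (hM1 : ∑ x, M x = 1)
    {l : κ → ℝ} (hl : ∀ x, 0 < l x) {B : Matrix ι ι ℂ} (hB : B.IsHermitian)
    (hinv : B * ∑ x, (l x : ℂ) • M x = 1) :
    (∑ x, ((l x)⁻¹ : ℂ) • M x - B).PosSemidef := by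
  have h : ∑ x, ((l x)⁻¹ : ℂ) • M x - B = ∑ x, (l x : ℂ) •
      ((((l x)⁻¹ : ℂ) • 1 - B) * M x * (((l x)⁻¹ : ℂ) • 1 - B)ᴴ) := by
    have hterm : ∀ x, (l x : ℂ) •
        ((((l x)⁻¹ : ℂ) • 1 - B) * M x * (((l x)⁻¹ : ℂ) • 1 - B)ᴴ) =
        ((l x)⁻¹ : ℂ) • M x - M x * B - B * M x + B * ((l x : ℂ) • M x) * B := by
      intro x
      have hx : (l x : ℂ) ≠ 0 := by exact_mod_cast (hl x).ne'
      have hs : (((l x)⁻¹ : ℂ) • (1 : Matrix ι ι ℂ) - B)ᴴ = ((l x)⁻¹ : ℂ) • 1 - B := by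
        rw [conjTranspose_sub, hB.eq, conjTranspose_smul]
        simp
      rw [hs]
      simp only [sub_mul, mul_sub, smul_mul_assoc, mul_smul_comm, one_mul, mul_one, smul_sub,
        smul_smul, mul_inv_cancel₀ hx, mul_inv_cancel_left₀ hx, one_smul]
      abel
    simp only [hterm, Finset.sum_add_distrib, Finset.sum_sub_distrib]
    rw [← Finset.sum_mul, ← Finset.mul_sum, ← Finset.sum_mul, ← Finset.mul_sum, hinv, hM1]
    simp
  rw [h]
  refine posSemidef_sum _ fun x _ => ((hM x).mul_mul_conjTranspose_same _).smul ?_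
  exact_mod_cast (hl x).le

/-- Operator concavity of the logarithm, for an average weighted by a POVM and tested
against a positive semidefinite matrix. -/
lemma sum_trace_mul_log_le {ι κ : Type*} [Fintype ι] [DecidableEq ι] [Fintype κ]
    {ρ : Matrix ι ι ℂ} (hρ : ρ.PosSemidef)
    {M : κ → Matrix ι ι ℂ} (hM : ∀ x, (M x).PosSemidef) (hM1 : ∑ x, M x = 1)
    {l : κ → ℝ} (hl : ∀ x, 0 < l x) :
    ∑ x, (ρ * M x).trace.re * Real.log (l x) ≤
      (ρ * matFun Real.log (∑ x, (l x : ℂ) • M x)).trace.re := by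
  have hω := posDef_sum_smul hM hM1 hl
  have hpos := hω.eigenvalues_pos
  have hspec := hω.1.eq_conj_diagonal
  rw [matFun, dif_pos hω.1, trace_mul_conj_diagonal_re]
  have hUU : star (hω.1.eigenvectorUnitary : Matrix ι ι ℂ) * hω.1.eigenvectorUnitary = 1 :=
    Unitary.coe_star_mul_self _
  have hUU' : (hω.1.eigenvectorUnitary : Matrix ι ι ℂ) * star hω.1.eigenvectorUnitary.1 = 1 :=
    Unitary.coe_mul_star_self _
  generalize (hω.1.eigenvectorUnitary : Matrix ι ι ℂ) = U at *
  generalize hω.1.eigenvalues = t at *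
  refine sum_mul_log_le_of_resolvent hpos hl ?_ fun s hs => ?_
  · have h := trace_mul_conj_diagonal_re ρ U fun _ => 1
    simp only [Complex.ofReal_one, mul_one, diagonal_one, hUU'] at h
    rw [← h, ← Complex.re_sum, ← trace_sum, ← Matrix.mul_sum, hM1, mul_one]
  · have hls : ∀ x, 0 < l x + s := fun x => by have := hl x; positivity
    have hts : ∀ i, ((t i + s : ℝ) : ℂ) ≠ 0 := fun i => by
      have := hpos i
      exact_mod_cast (by positivity : t i + s ≠ 0)
    have hshift : ∑ x, ((l x + s : ℝ) : ℂ) • M x =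
        U * diagonal (fun i => ((t i + s : ℝ) : ℂ)) * star U := by
      have hd : diagonal (fun i => ((t i + s : ℝ) : ℂ)) =
          diagonal (fun i => (t i : ℂ)) + (s : ℂ) • (1 : Matrix ι ι ℂ) := by
        rw [smul_one_eq_diagonal, diagonal_add]
        simp
      rw [hd, mul_add, add_mul, ← hspec, mul_smul_comm, smul_mul_assoc, mul_one, hUU', ← hM1,
        Finset.smul_sum, ← Finset.sum_add_distrib]
      simp [add_smul]
    have hB : (U * diagonal (fun i => (((t i + s)⁻¹ : ℝ) : ℂ)) * star U).IsHermitian := by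
      refine isHermitian_mul_mul_conjTranspose U (isHermitian_diagonal_of_self_adjoint _ ?_)
      ext i
      simp
    have hinv : U * diagonal (fun i => (((t i + s)⁻¹ : ℝ) : ℂ)) * star U *
        ∑ x, ((l x + s : ℝ) : ℂ) • M x = 1 := by
      rw [hshift]
      calc _ = U * diagonal (fun i => (((t i + s)⁻¹ : ℝ) : ℂ)) * (star U * U) *
            diagonal (fun i => ((t i + s : ℝ) : ℂ)) * star U := by
              simp only [Matrix.mul_assoc]
        _ = 1 := by
          rw [hUU, mul_one, Matrix.mul_assoc U, diagonal_mul_diagonal]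
          have : (fun i => (((t i + s)⁻¹ : ℝ) : ℂ) * ((t i + s : ℝ) : ℂ)) = fun _ => 1 := by
            funext i
            rw [Complex.ofReal_inv, inv_mul_cancel₀ (hts i)]
          rw [this, diagonal_one, mul_one, hUU']
    have h := trace_mul_re_nonneg hρ (posSemidef_sum_inv_smul_sub hM hM1 hls hB hinv)
    rw [mul_sub, trace_sub, Complex.sub_re, trace_mul_conj_diagonal_re, Matrix.mul_sum, trace_sum,
      Complex.re_sum] at h
    refine (sub_nonneg.1 h).trans_eq (Finset.sum_congr rfl fun x _ => ?_)
    rw [mul_smul_comm, trace_smul, smul_eq_mul, ← Complex.ofReal_inv, Complex.re_ofReal_mul,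
      mul_comm]

lemma sum_le_objective {ι κ : Type*} [Fintype ι] [DecidableEq ι] [Fintype κ]
    {ρ σ : Matrix ι ι ℂ} (hρ : ρ.PosSemidef)
    {M : κ → Matrix ι ι ℂ} (hM : ∀ x, (M x).PosSemidef) (hM1 : ∑ x, M x = 1)
    {l : κ → ℝ} (hl : ∀ x, 0 < l x) :
    ∑ x, ((ρ * M x).trace.re * Real.log (l x) + (ρ * M x).trace.re -
        (σ * M x).trace.re * l x) ≤
      (ρ * matFun Real.log (∑ x, (l x : ℂ) • M x)).trace.re + ρ.trace.re -
        (σ * ∑ x, (l x : ℂ) • M x).trace.re := by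
  have h1 : ∑ x, (ρ * M x).trace.re = ρ.trace.re := by
    rw [← Complex.re_sum, ← trace_sum, ← Matrix.mul_sum, hM1, mul_one]
  have h2 : (σ * ∑ x, (l x : ℂ) • M x).trace.re = ∑ x, (σ * M x).trace.re * l x := by
    rw [Matrix.mul_sum, trace_sum, Complex.re_sum]
    refine Finset.sum_congr rfl fun x _ => ?_
    rw [mul_smul_comm, trace_smul, smul_eq_mul, Complex.re_ofReal_mul, mul_comm]
  rw [Finset.sum_sub_distrib, Finset.sum_add_distrib, h1, h2]
  linarith [sum_trace_mul_log_le hρ hM hM1 hl]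

lemma EReal.coe_sum_real {κ : Type*} (s : Finset κ) (f : κ → ℝ) :
    ((∑ x ∈ s, f x : ℝ) : EReal) = ∑ x ∈ s, (f x : EReal) :=
  map_sum (⟨⟨Real.toEReal, EReal.coe_zero⟩, EReal.coe_add⟩ : ℝ →+ EReal) f s

lemma coe_le_klQ {p q l : ℝ} (hp : 0 ≤ p) (hq : 0 ≤ q) (hl : 0 < l) :
    ((p * Real.log l + p - q * l : ℝ) : EReal) ≤ klQ p q := by
  unfold klQ
  split_ifs with h1 h2
  · subst h1
    have : 0 ≤ q * l := by positivity
    exact_mod_cast (by linarith : 0 * Real.log l + 0 - q * l ≤ 0)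
  · exact le_top
  · have hp' : 0 < p := lt_of_le_of_ne hp (Ne.symm h1)
    have hq' : 0 < q := lt_of_le_of_ne hq (Ne.symm h2)
    refine EReal.coe_le_coe_iff.2 ?_
    have h := Real.log_le_sub_one_of_pos (show 0 < l / (p / q) by positivity)
    rw [Real.log_div hl.ne' (by positivity)] at h
    have h' := mul_le_mul_of_nonneg_left h hp
    have e : p * (l / (p / q) - 1) = q * l - p := by field_simp
    rw [e] at h'
    linarith

lemma sum_klQ_le {κ : Type*} [Fintype κ] {p q : κ → ℝ} (hp : ∀ x, 0 ≤ p x)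
    (hq : ∀ x, 0 ≤ q x) {S : EReal}
    (hS : ∀ l : κ → ℝ, (∀ x, 0 < l x) →
      ((∑ x, (p x * Real.log (l x) + p x - q x * l x) : ℝ) : EReal) ≤ S) :
    ∑ x, klQ (p x) (q x) ≤ S := by
  classical
  by_cases h : ∃ x, p x ≠ 0 ∧ q x = 0
  · obtain ⟨x, hpx, hqx⟩ := h
    have hpx' : 0 < p x := lt_of_le_of_ne (hp x) (Ne.symm hpx)
    suffices S = ⊤ from this ▸ le_top
    refine EReal.eq_top_iff_forall_lt S |>.2 fun y => ?_
    set c := ∑ z ∈ Finset.univ.erase x, (p z - q z) with hc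
    refine lt_of_lt_of_le ?_
      (hS (Function.update 1 x (Real.exp ((y - c) / p x))) fun z => ?_)
    · rw [← Finset.add_sum_erase _ _ (Finset.mem_univ x)]
      have h2 : ∑ z ∈ Finset.univ.erase x,
          (p z * Real.log (Function.update (1 : κ → ℝ) x (Real.exp ((y - c) / p x)) z) + p z -
            q z * Function.update (1 : κ → ℝ) x (Real.exp ((y - c) / p x)) z) = c := by
        refine Finset.sum_congr rfl fun z hz => ?_
        simp [Function.update_of_ne (Finset.ne_of_mem_erase hz)]
      rw [h2, Function.update_self, Real.log_exp, mul_div_cancel₀ _ hpx, hqx]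
      exact_mod_cast (by linarith : y < y - c + p x - 0 * Real.exp ((y - c) / p x) + c)
    · rcases eq_or_ne z x with rfl | hz
      · simp [Real.exp_pos]
      · simp [Function.update_of_ne hz]
  · push Not at h
    have hval : ∀ x, klQ (p x) (q x) = ((p x * Real.log (p x / q x) : ℝ) : EReal) := by
      intro x
      unfold klQ
      split_ifs with h1 h2
      · simp [h1]
      · exact absurd h2 (h x h1)
      · rfl
    simp only [hval]
    rw [← EReal.coe_sum_real]
    set Q := ∑ x, if p x = 0 then q x else 0 with hQ
    have hlower : ∀ ε : ℝ, 0 < ε →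
        ((∑ x, p x * Real.log (p x / q x) - Q * ε : ℝ) : EReal) ≤ S := by
      intro ε hε
      refine le_trans (le_of_eq ?_) (hS (fun x => if p x = 0 then ε else p x / q x) ?_)
      · rw [EReal.coe_eq_coe_iff, hQ, Finset.sum_mul, ← Finset.sum_sub_distrib]
        refine Finset.sum_congr rfl fun x _ => ?_
        by_cases h1 : p x = 0
        · simp [h1]
        · simp [h1, mul_div_cancel₀ _ (h x h1)]
      · intro x
        split_ifs with h1
        · exact hε
        · exact div_pos (lt_of_le_of_ne (hp x) (Ne.symm h1))
            (lt_of_le_of_ne (hq x) (Ne.symm (h x h1)))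
    have hlim : Filter.Tendsto
        (fun ε : ℝ => ((∑ x, p x * Real.log (p x / q x) - Q * ε : ℝ) : EReal))
        (nhdsWithin 0 (Set.Ioi 0))
        (nhds ((∑ x, p x * Real.log (p x / q x) : ℝ) : EReal)) := by
      refine continuous_coe_real_ereal.continuousAt.tendsto.comp ?_
      have hc : Continuous fun ε : ℝ => ∑ x, p x * Real.log (p x / q x) - Q * ε := by fun_prop
      simpa using (hc.tendsto 0).mono_left nhdsWithin_le_nhds
    exact le_of_tendsto hlim (by filter_upwards [self_mem_nhdsWithin] with ε hε using hlower ε hε)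

lemma objective_le_measKL {ι : Type*} [Fintype ι] [DecidableEq ι] {ρ σ ω : Matrix ι ι ℂ}
    (hρ : ρ.PosSemidef) (hσ : σ.PosSemidef) (hω : ω.PosDef) :
    (((ρ * matFun Real.log ω).trace.re + ρ.trace.re - (σ * ω).trace.re : ℝ) : EReal) ≤
      measKL ρ σ := by
  have hpos := hω.eigenvalues_pos
  have hspec := hω.1.eq_conj_diagonal
  rw [matFun, dif_pos hω.1, trace_mul_conj_diagonal_re]
  have hUU' : (hω.1.eigenvectorUnitary : Matrix ι ι ℂ) * star hω.1.eigenvectorUnitary.1 = 1 :=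
    Unitary.coe_mul_star_self _
  generalize (hω.1.eigenvectorUnitary : Matrix ι ι ℂ) = U at *
  generalize hω.1.eigenvalues = t at *
  set P : ι → Matrix ι ι ℂ := fun i =>
    U * diagonal (fun j => ((Pi.single i 1 : ι → ℝ) j : ℂ)) * star U with hP
  have hPpos : ∀ i, (P i).PosSemidef := fun i =>
    (PosSemidef.diagonal fun j => by
      by_cases hj : j = i <;> simp [hj]).mul_mul_conjTranspose_same U
  have hPsum : ∑ i, P i = 1 := by
    simp only [hP]
    rw [← Finset.sum_mul, ← Finset.mul_sum]
    have : ∑ i, diagonal (fun j => ((Pi.single i 1 : ι → ℝ) j : ℂ)) = 1 := by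
      ext j k
      rw [Matrix.sum_apply]
      by_cases hjk : j = k
      · subst hjk
        simp [Pi.single_apply, apply_ite Complex.ofReal]
      · simp [hjk]
    rw [this, mul_one, hUU']
  have hPtr : ∀ (τ : Matrix ι ι ℂ) i, (τ * P i).trace.re = ((star U * τ * U) i i).re := by
    intro τ i
    simp [hP, trace_mul_conj_diagonal_re, Pi.single_apply]
  have hσω : (σ * ω).trace.re = ∑ i, (σ * P i).trace.re * t i := by
    rw [hspec, trace_mul_conj_diagonal_re]
    simp only [hPtr]
  have hρtr : ρ.trace.re = ∑ i, (ρ * P i).trace.re := by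
    rw [← Complex.re_sum, ← trace_sum, ← Matrix.mul_sum, hPsum, mul_one]
  simp only [← hPtr]
  rw [hσω, hρtr, ← Finset.sum_add_distrib, ← Finset.sum_sub_distrib, EReal.coe_sum_real]
  have e := (Fintype.equivFin ι).symm
  calc _ ≤ ∑ i, klQ (ρ * P i).trace.re (σ * P i).trace.re :=
        Finset.sum_le_sum fun i _ => coe_le_klQ (trace_mul_re_nonneg hρ (hPpos i))
          (trace_mul_re_nonneg hσ (hPpos i)) (hpos i)
    _ = ∑ x, klQ (ρ * P (e x)).trace.re (σ * P (e x)).trace.re :=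
        (e.sum_comp fun i => klQ (ρ * P i).trace.re (σ * P i).trace.re).symm
    _ ≤ measKL ρ σ := by
        refine le_iSup_of_le (Fintype.card ι) (le_iSup_of_le (fun x => P (e x)) ?_)
        exact le_iSup_of_le ⟨fun x => hPpos _, (e.sum_comp P).trans hPsum⟩ le_rfl

/-- Variational formula for the measured relative entropy:
`D_M(ρ‖σ) = sup_{ω ≻ 0} tr[ρ log ω] + tr[ρ] - tr[σ ω]`. -/
theorem measKL_variational {ι : Type*} [Fintype ι] [DecidableEq ι]
    (ρ σ : Matrix ι ι ℂ) (hρ : ρ.PosSemidef) (hσ : σ.PosSemidef)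
    (hρtr : ρ.trace = 1) :
    measKL ρ σ =
      ⨆ (ω : Matrix ι ι ℂ) (_ : ω.PosDef),
        (((ρ * matFun Real.log ω).trace.re + ρ.trace.re
          - (σ * ω).trace.re : ℝ) : EReal) := by
  refine le_antisymm ?_ ?_
  · refine iSup_le fun m => iSup_le fun M => iSup_le fun hM => ?_
    refine sum_klQ_le (fun x => trace_mul_re_nonneg hρ (hM.1 x))
      (fun x => trace_mul_re_nonneg hσ (hM.1 x)) fun l hl => ?_
    refine le_trans ?_ (le_iSup₂ _ (posDef_sum_smul hM.1 hM.2 hl))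
    exact EReal.coe_le_coe_iff.2 (sum_le_objective hρ hM.1 hM.2 hl)
  · exact iSup₂_le fun ω hω => objective_le_measKL hρ hσ hω

end
end

section
/- Fix a Hermitian operator γ_{AR} on the tensor product A ⊗ R of finite-dimensional Hilbert spaces and a positive semidefinite ρ_A on A. Then inf over positive semidefinite ρ_{AR} with tr_R ρ_{AR} = ρ_A of tr[ρ_{AR} γ_{AR}] equals sup over Hermitian Λ_A with Λ_A ⊗ I_R ≤ γ_{AR} of tr[ρ_A Λ_A]. -/
open Matrix
open scoped ComplexOrder Kronecker

noncomputable section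

/-- Partial trace over the second tensor factor. -/
def ptraceR {ιA ιR : Type*} [Fintype ιR]
    (M : Matrix (ιA × ιR) (ιA × ιR) ℂ) : Matrix ιA ιA ℂ :=
  fun i j => ∑ k : ιR, M (i, k) (j, k)

section PartialTrace

variable {ιA ιR : Type*} [Fintype ιR]

theorem ptraceR_zero : ptraceR (0 : Matrix (ιA × ιR) (ιA × ιR) ℂ) = 0 := by
  ext; simp [ptraceR]

theorem ptraceR_add (M N : Matrix (ιA × ιR) (ιA × ιR) ℂ) :
    ptraceR (M + N) = ptraceR M + ptraceR N := by
  ext; simp [ptraceR, Finset.sum_add_distrib]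

theorem ptraceR_smul (c : ℝ) (M : Matrix (ιA × ιR) (ιA × ιR) ℂ) :
    ptraceR (c • M) = c • ptraceR M := by
  ext; simp [ptraceR, Finset.mul_sum]

theorem continuous_ptraceR :
    Continuous (ptraceR : Matrix (ιA × ιR) (ιA × ιR) ℂ → Matrix ιA ιA ℂ) := by
  refine continuous_matrix fun i j => ?_
  unfold ptraceR
  fun_prop

theorem Matrix.IsHermitian.ptraceR {M : Matrix (ιA × ιR) (ιA × ιR) ℂ} (hM : M.IsHermitian) :
    (ptraceR M).IsHermitian := by
  ext i j
  simp only [_root_.ptraceR, conjTranspose_apply, star_sum]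
  exact Finset.sum_congr rfl fun k _ => hM.apply _ _

variable [Fintype ιA]

theorem trace_ptraceR (M : Matrix (ιA × ιR) (ιA × ιR) ℂ) : (ptraceR M).trace = M.trace := by
  simp [trace, ptraceR, Fintype.sum_prod_type]

theorem trace_ptraceR_mul [DecidableEq ιR] (M : Matrix (ιA × ιR) (ιA × ιR) ℂ)
    (Λ : Matrix ιA ιA ℂ) :
    (ptraceR M * Λ).trace = (M * Λ ⊗ₖ (1 : Matrix ιR ιR ℂ)).trace := by
  simp only [trace, diag_apply, mul_apply, ptraceR, Fintype.sum_prod_type, kroneckerMap_apply,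
    one_apply, mul_ite, mul_one, mul_zero, Finset.sum_ite_eq', Finset.mem_univ, if_true,
    Finset.sum_mul]
  exact Finset.sum_congr rfl fun i _ => Finset.sum_comm

end PartialTrace

section PosSemidef

variable {n : Type*} [Fintype n]

theorem Matrix.PosSemidef.exists_conjTranspose_mul_self {A : Matrix n n ℂ} (hA : A.PosSemidef) :
    ∃ B : Matrix n n ℂ, A = Bᴴ * B := by
  classical
  open scoped MatrixOrder in
  exact CStarAlgebra.nonneg_iff_eq_star_mul_self.mp hA.nonneg

theorem Matrix.PosSemidef.re_trace_mul_nonneg {A B : Matrix n n ℂ} (hA : A.PosSemidef)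
    (hB : B.PosSemidef) : 0 ≤ (A * B).trace.re := by
  obtain ⟨C, rfl⟩ := hA.exists_conjTranspose_mul_self
  rw [Matrix.mul_assoc, trace_mul_comm]
  exact (Complex.nonneg_iff.mp (hB.mul_mul_conjTranspose_same C).trace_nonneg).1

theorem Matrix.PosSemidef.norm_apply_le_re_trace {A : Matrix n n ℂ} (hA : A.PosSemidef)
    (i j : n) : ‖A i j‖ ≤ A.trace.re := by
  have hdiag : ∀ k, 0 ≤ (A k k).re := fun k => (Complex.nonneg_iff.mp hA.diag_nonneg).1
  have htr : ∀ k, (A k k).re ≤ A.trace.re := fun k => by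
    rw [trace, Complex.re_sum]
    exact Finset.single_le_sum (f := fun k => (A k k).re) (fun k _ => hdiag k) (Finset.mem_univ k)
  obtain ⟨B, hB⟩ := hA.exists_conjTranspose_mul_self
  have hBdiag : ∀ k, (A k k).re = ∑ l, ‖B l k‖ ^ 2 := fun k => by
    simp only [hB, mul_apply, conjTranspose_apply, Complex.re_sum]
    refine Finset.sum_congr rfl fun l _ => ?_
    rw [Complex.star_def, ← Complex.normSq_eq_conj_mul_self, Complex.ofReal_re,
      Complex.normSq_eq_norm_sq]
  have hle : ‖A i j‖ ≤ ((A i i).re + (A j j).re) / 2 := by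
    rw [hBdiag, hBdiag, ← Finset.sum_add_distrib, Finset.sum_div, hB, mul_apply]
    refine (norm_sum_le _ _).trans (Finset.sum_le_sum fun l _ => ?_)
    rw [norm_mul, conjTranspose_apply, norm_star]
    nlinarith [sq_nonneg (‖B l i‖ - ‖B l j‖)]
  linarith [htr i, htr j]

theorem Matrix.isClosed_setOf_posSemidef : IsClosed {A : Matrix n n ℂ | A.PosSemidef} := by
  simp only [posSemidef_iff_dotProduct_mulVec, Set.ofPred_and, Set.ofPred_forall]
  refine IsClosed.inter ?_ (isClosed_iInter fun x => ?_)
  · exact isClosed_eq (by fun_prop) continuous_id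
  · exact isClosed_le continuous_const (by fun_prop)

theorem Matrix.isCompact_setOf_posSemidef_re_trace_le (b : ℝ) :
    IsCompact {A : Matrix n n ℂ | A.PosSemidef ∧ A.trace.re ≤ b} := by
  have hc : Continuous fun A : Matrix n n ℂ => A.trace.re :=
    Complex.continuous_re.comp continuous_id.matrix_trace
  refine IsCompact.of_isClosed_subset
    (isCompact_univ_pi fun _ => isCompact_univ_pi fun _ => isCompact_closedBall (0 : ℂ) b)
    (isClosed_setOf_posSemidef.inter (isClosed_le hc continuous_const)) ?_
  rintro A ⟨hA, hb⟩ i - j -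
  simpa using (hA.norm_apply_le_re_trace i j).trans hb

theorem Matrix.IsHermitian.posSemidef_of_re_trace_mul_nonneg {A : Matrix n n ℂ}
    (hA : A.IsHermitian) (h : ∀ B : Matrix n n ℂ, B.PosSemidef → 0 ≤ (B * A).trace.re) :
    A.PosSemidef := by
  refine .of_dotProduct_mulVec_nonneg hA fun x => ?_
  rw [Complex.nonneg_iff]
  constructor
  · have := h _ (posSemidef_vecMulVec_self_star x)
    rwa [vecMulVec_mul, trace_vecMulVec, dotProduct_comm, ← dotProduct_mulVec] at this
  · exact (hA.im_star_dotProduct_mulVec_self x).symm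

theorem Matrix.IsHermitian.exists_posSemidef_add_smul_one [DecidableEq n] {A : Matrix n n ℂ}
    (hA : A.IsHermitian) : ∃ c : ℝ, (A + c • (1 : Matrix n n ℂ)).PosSemidef := by
  open scoped MatrixOrder Matrix.Norms.L2Operator in
  refine ⟨‖A‖, ?_⟩
  open scoped MatrixOrder Matrix.Norms.L2Operator in
  have := IsSelfAdjoint.neg_algebraMap_norm_le_self (a := A) hA
  rwa [Matrix.le_iff, sub_neg_eq_add, Algebra.algebraMap_eq_smul_one] at this

end PosSemidef

section TraceRepresentation

variable {n : Type*} [Fintype n] [DecidableEq n]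

/-- Every real-linear functional on complex matrices is represented on Hermitian matrices by
a Hermitian matrix via the trace pairing. -/
theorem Matrix.exists_isHermitian_re_trace_mul (f : Matrix n n ℂ →ₗ[ℝ] ℝ) :
    ∃ H : Matrix n n ℂ, H.IsHermitian ∧
      ∀ X : Matrix n n ℂ, X.IsHermitian → f X = (X * H).trace.re := by
  let M : Matrix n n ℂ := of fun j i => ⟨f (single i j 1), -f (single i j Complex.I)⟩
  have hM : ∀ X, f X = (X * M).trace.re := fun X => by
    have hs : ∀ i j, single i j (X i j) =
        (X i j).re • single i j (1 : ℂ) + (X i j).im • single i j Complex.I := fun i j => by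
      rw [smul_single, smul_single, ← single_add]
      congr 1
      apply Complex.ext <;> simp
    conv_lhs => rw [matrix_eq_sum_single X]
    simp only [map_sum, hs, map_add, map_smul, trace, diag_apply, mul_apply, Complex.re_sum,
      Complex.mul_re, smul_eq_mul, M, of_apply]
    refine Finset.sum_congr rfl fun i _ => Finset.sum_congr rfl fun j _ => ?_
    ring
  refine ⟨(2⁻¹ : ℝ) • (M + Mᴴ), ?_, fun X hX => ?_⟩
  · simp [IsHermitian, conjTranspose_smul, add_comm]
  · have hstar : (X * Mᴴ).trace.re = (X * M).trace.re := by
      conv_lhs => rw [← hX.eq, ← conjTranspose_mul, trace_conjTranspose, trace_mul_comm]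
      simp
    rw [hM, Matrix.mul_smul, trace_smul, Matrix.mul_add, trace_add, Complex.smul_re, Complex.add_re,
      hstar, smul_eq_mul]
    ring

end TraceRepresentation

section Duality

variable {ιA ιR : Type*} [Fintype ιA] [Fintype ιR]

theorem isClosed_setOf_exists_ptraceR_eq (γ : Matrix (ιA × ιR) (ιA × ιR) ℂ) :
    IsClosed {p : Matrix ιA ιA ℂ × ℝ | ∃ ρ : Matrix (ιA × ιR) (ιA × ιR) ℂ,
      ρ.PosSemidef ∧ ptraceR ρ = p.1 ∧ (ρ * γ).trace.re ≤ p.2} := by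
  have : SequentialSpace (Matrix ιA ιA ℂ × ℝ) :=
    inferInstanceAs (SequentialSpace ((ιA → ιA → ℂ) × ℝ))
  have : FirstCountableTopology (Matrix (ιA × ιR) (ιA × ιR) ℂ) :=
    inferInstanceAs (FirstCountableTopology (ιA × ιR → ιA × ιR → ℂ))
  refine isSeqClosed_iff_isClosed.mp fun p q hp hpq => ?_
  choose ρ hρ hρ₁ hρ₂ using hp
  have hp₁ := (continuous_fst.tendsto q).comp hpq
  have hp₂ := (continuous_snd.tendsto q).comp hpq
  have htr : Filter.Tendsto (fun k => (ρ k).trace.re) Filter.atTop (nhds q.1.trace.re) := by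
    have hc : Continuous fun X : Matrix ιA ιA ℂ => X.trace.re :=
      Complex.continuous_re.comp continuous_id.matrix_trace
    refine ((hc.tendsto q.1).comp hp₁).congr fun k => ?_
    simp [← hρ₁, trace_ptraceR]
  obtain ⟨b, hb⟩ := htr.bddAbove_range
  obtain ⟨σ, hσ, φ, hφ, hlim⟩ := (isCompact_setOf_posSemidef_re_trace_le b).tendsto_subseq
    (x := ρ) fun k => ⟨hρ k, hb ⟨k, rfl⟩⟩
  refine ⟨σ, hσ.1, ?_, ?_⟩
  · refine tendsto_nhds_unique ((continuous_ptraceR.tendsto σ).comp hlim) ?_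
    refine (hp₁.comp hφ.tendsto_atTop).congr fun k => ?_
    simp [hρ₁]
  · have hc : Continuous fun X : Matrix (ιA × ιR) (ιA × ιR) ℂ => (X * γ).trace.re :=
      Complex.continuous_re.comp (continuous_id.matrix_mul continuous_const).matrix_trace
    exact le_of_tendsto_of_tendsto' ((hc.tendsto σ).comp hlim) (hp₂.comp hφ.tendsto_atTop)
      fun k => hρ₂ _

/-- The closed convex cone of pairs `(X, t)` such that some positive semidefinite `ρ` has
partial trace `X` and `tr[ρ γ] ≤ t`. -/
def ptraceCone (γ : Matrix (ιA × ιR) (ιA × ιR) ℂ) : ProperCone ℝ (Matrix ιA ιA ℂ × ℝ) where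
  carrier := {p | ∃ ρ : Matrix (ιA × ιR) (ιA × ιR) ℂ,
      ρ.PosSemidef ∧ ptraceR ρ = p.1 ∧ (ρ * γ).trace.re ≤ p.2}
  add_mem' := by
    rintro p q ⟨ρ, hρ, hρ₁, hρ₂⟩ ⟨σ, hσ, hσ₁, hσ₂⟩
    refine ⟨ρ + σ, hρ.add hσ, by simp [ptraceR_add, hρ₁, hσ₁], ?_⟩
    simpa [Matrix.add_mul] using add_le_add hρ₂ hσ₂
  zero_mem' := ⟨0, .zero, by simp [ptraceR_zero], by simp⟩
  smul_mem' := by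
    rintro ⟨c, hc⟩ p ⟨ρ, hρ, hρ₁, hρ₂⟩
    refine ⟨c • ρ, hρ.smul hc, by simp [ptraceR_smul, hρ₁], ?_⟩
    simpa [smul_mul] using mul_le_mul_of_nonneg_left hρ₂ hc
  isClosed' := isClosed_setOf_exists_ptraceR_eq γ

variable [DecidableEq ιR]

theorem re_trace_mul_le_of_ptraceR_eq {γ ρ : Matrix (ιA × ιR) (ιA × ιR) ℂ}
    {Λ : Matrix ιA ιA ℂ} (hρ : ρ.PosSemidef)
    (hΛ : (γ - Λ ⊗ₖ (1 : Matrix ιR ιR ℂ)).PosSemidef) :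
    (ptraceR ρ * Λ).trace.re ≤ (ρ * γ).trace.re := by
  have := hρ.re_trace_mul_nonneg hΛ
  rw [Matrix.mul_sub, trace_sub, Complex.sub_re, ← trace_ptraceR_mul] at this
  linarith

/-- Any upper bound of the dual values is attained or beaten by a feasible primal point. -/
theorem exists_ptraceR_eq_re_trace_mul_le [DecidableEq ιA] {γ : Matrix (ιA × ιR) (ιA × ιR) ℂ}
    (hγ : γ.IsHermitian) {ρA : Matrix ιA ιA ℂ} (hρA : ρA.IsHermitian) {r : ℝ}
    (hr : ∀ Λ : Matrix ιA ιA ℂ, Λ.IsHermitian →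
      (γ - Λ ⊗ₖ (1 : Matrix ιR ιR ℂ)).PosSemidef → (ρA * Λ).trace.re ≤ r) :
    ∃ ρ : Matrix (ιA × ιR) (ιA × ιR) ℂ,
      ρ.PosSemidef ∧ ptraceR ρ = ρA ∧ (ρ * γ).trace.re ≤ r := by
  by_contra hcon
  have : LocallyConvexSpace ℝ (Matrix ιA ιA ℂ) :=
    inferInstanceAs (LocallyConvexSpace ℝ (ιA → ιA → ℂ))
  obtain ⟨f, hf, hfneg⟩ :=
    (ptraceCone γ).hyperplane_separation_point (x₀ := (ρA, r)) hcon
  obtain ⟨H, hH, hfH⟩ :=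
    exists_isHermitian_re_trace_mul (f.toLinearMap ∘ₗ LinearMap.inl ℝ (Matrix ιA ιA ℂ) ℝ)
  set c : ℝ := f (0, 1) with hc
  have hfeq : ∀ X : Matrix ιA ιA ℂ, X.IsHermitian → ∀ t, f (X, t) = (X * H).trace.re + t * c := by
    intro X hX t
    have hsplit : (X, t) = (X, 0) + t • ((0 : Matrix ιA ιA ℂ), (1 : ℝ)) := by simp
    rw [hsplit, map_add, map_smul, ← hfH X hX, smul_eq_mul]
    simp [hc]
  have hc0 : 0 ≤ c := hf (0, 1) ⟨0, .zero, by simp [ptraceR_zero], by simp⟩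
  have hpos : ∀ ρ : Matrix (ιA × ιR) (ιA × ιR) ℂ, ρ.PosSemidef →
      0 ≤ (ptraceR ρ * H).trace.re + (ρ * γ).trace.re * c := fun ρ hρ => by
    rw [← hfeq _ hρ.1.ptraceR]
    exact hf _ ⟨ρ, hρ, rfl, le_rfl⟩
  rw [hfeq _ hρA] at hfneg
  obtain ⟨b, hb⟩ := hγ.exists_posSemidef_add_smul_one
  -- Perturb by a feasible point so that the coefficient of `γ` becomes positive.
  obtain ⟨ε, hε, hεneg⟩ : ∃ ε : ℝ, 0 < ε ∧
      (ρA * H).trace.re + r * c + ε * (r + b * ρA.trace.re) < 0 := by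
    have hlim : Filter.Tendsto
        (fun ε : ℝ => (ρA * H).trace.re + r * c + ε * (r + b * ρA.trace.re))
        (nhdsWithin 0 (Set.Ioi 0)) (nhds ((ρA * H).trace.re + r * c + 0 * (r + b * ρA.trace.re))) :=
      (Continuous.tendsto (by fun_prop) 0).mono_left nhdsWithin_le_nhds
    rw [zero_mul, add_zero] at hlim
    obtain ⟨ε, h₁, h₂⟩ := ((hlim.eventually_lt_const hfneg).and self_mem_nhdsWithin).exists
    exact ⟨ε, h₂, h₁⟩
  have hcε : 0 < c + ε := by linarith
  set Λ : Matrix ιA ιA ℂ := -((c + ε)⁻¹ • (H + (ε * b) • (1 : Matrix ιA ιA ℂ))) with hΛdef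
  have hΛtr : ∀ X : Matrix ιA ιA ℂ, (X * Λ).trace.re =
      -((c + ε)⁻¹ * ((X * H).trace.re + ε * b * X.trace.re)) := fun X => by
    simp only [hΛdef, Matrix.mul_neg, Matrix.mul_smul, Matrix.mul_add, Matrix.mul_one, trace_neg,
      trace_add, trace_smul, Complex.neg_re, Complex.add_re, Complex.smul_re, smul_eq_mul]
  have hΛ : Λ.IsHermitian := by
    simp [hΛdef, IsHermitian, conjTranspose_smul, hH.eq]
  have hΛ1 : (Λ ⊗ₖ (1 : Matrix ιR ιR ℂ)).IsHermitian := by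
    rw [IsHermitian, conjTranspose_kronecker, hΛ.eq, conjTranspose_one]
  have hfeas : (γ - Λ ⊗ₖ (1 : Matrix ιR ιR ℂ)).PosSemidef := by
    refine (hγ.sub hΛ1).posSemidef_of_re_trace_mul_nonneg fun ρ hρ => ?_
    have h₁ := hpos ρ hρ
    have h₂ := hρ.re_trace_mul_nonneg hb
    rw [Matrix.mul_add, trace_add, Matrix.mul_smul, Matrix.mul_one, trace_smul, Complex.add_re,
      Complex.smul_re, smul_eq_mul] at h₂
    rw [Matrix.mul_sub, trace_sub, Complex.sub_re, ← trace_ptraceR_mul, hΛtr, trace_ptraceR,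
      sub_neg_eq_add]
    have : (ρ * γ).trace.re = (c + ε)⁻¹ * ((c + ε) * (ρ * γ).trace.re) := by
      field_simp
    rw [this, ← mul_add]
    refine mul_nonneg (inv_nonneg.mpr hcε.le) ?_
    nlinarith [mul_nonneg hε.le h₂]
  have hle := hr Λ hΛ hfeas
  rw [hΛtr, ← mul_neg, inv_mul_le_iff₀ hcε] at hle
  linarith

end Duality

/-- SDP duality: for Hermitian `γ_{AR}` and positive semidefinite `ρ_A`,
`inf { tr[ρ_{AR} γ_{AR}] : ρ_{AR} ≽ 0, tr_R ρ_{AR} = ρ_A }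
  = sup { tr[ρ_A Λ_A] : Λ_A Hermitian, Λ_A ⊗ I_R ≤ γ_{AR} }`. -/
theorem sdp_duality_inf {ιA ιR : Type*} [Fintype ιA] [DecidableEq ιA]
    [Fintype ιR] [DecidableEq ιR]
    (γ : Matrix (ιA × ιR) (ιA × ιR) ℂ) (hγ : γ.IsHermitian)
    (ρA : Matrix ιA ιA ℂ) (hρA : ρA.PosSemidef) :
    (⨅ (ρAR : Matrix (ιA × ιR) (ιA × ιR) ℂ)
        (_ : ρAR.PosSemidef ∧ ptraceR ρAR = ρA),
        (((ρAR * γ).trace.re : ℝ) : EReal)) =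
    (⨆ (Λ : Matrix ιA ιA ℂ)
        (_ : Λ.IsHermitian ∧ (γ - Λ ⊗ₖ (1 : Matrix ιR ιR ℂ)).PosSemidef),
        (((ρA * Λ).trace.re : ℝ) : EReal)) := by
  refine le_antisymm (EReal.le_of_forall_lt_iff_le.mp fun r hr => ?_) ?_
  · obtain ⟨ρ, hρ, hρ₁, hρ₂⟩ := exists_ptraceR_eq_re_trace_mul_le (r := r) hγ hρA.1
      fun Λ hΛ hfeas => EReal.coe_le_coe_iff.mp <|
        (le_iSup₂_of_le Λ ⟨hΛ, hfeas⟩ le_rfl).trans hr.le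
    exact iInf₂_le_of_le ρ ⟨hρ, hρ₁⟩ (EReal.coe_le_coe_iff.mpr hρ₂)
  · refine le_iInf₂ fun ρ hρ => iSup₂_le fun Λ hΛ => EReal.coe_le_coe_iff.mpr ?_
    rw [← hρ.2]
    exact re_trace_mul_le_of_ptraceR_eq hρ.1 hΛ.2

end
end

section
/- Let ρ_A be a density operator on A and σ_{AR} positive semidefinite on A ⊗ R, with α ∈ [0, 1/2]. Then inf over positive semidefinite ρ_{AR} with tr_R ρ_{AR} = ρ_A of D_{M,α}(ρ_{AR}‖σ_{AR}) = D_{M,α}(ρ_A‖σ_A), where σ_A = tr_R σ_{AR}, and the infimum is attained. -/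
open Matrix
open scoped ComplexOrder

noncomputable section

/-- Single Rényi term `p^α q^{1-α}` with the standard conventions. -/
def renyiQ (α p q : ℝ) : EReal :=
  if p = 0 then 0
  else if q = 0 then (if α < 1 then 0 else ⊤)
  else ((p ^ α * q ^ (1 - α) : ℝ) : EReal)

/-- Logarithm on `EReal` (with `log x = ⊥` for `x ≤ 0`). -/
def erealLog (x : EReal) : EReal :=
  if x ≤ 0 then ⊥ else if x = ⊤ then ⊤ else ((Real.log x.toReal : ℝ) : EReal)

/-- Classical Rényi divergence of order `α` of two finitely supported
(sub)probability vectors; for `α = 1` it is the Kullback-Leibler divergence. -/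
def classRenyi (α : ℝ) {m : ℕ} (p q : Fin m → ℝ) : EReal :=
  if α = 1 then ∑ x, klQ (p x) (q x)
  else (((α - 1)⁻¹ : ℝ) : EReal) * erealLog (∑ x, renyiQ α (p x) (q x))

/-- The measured Rényi divergence of order `α`: supremum over POVMs of the
classical Rényi divergence of the induced distributions. -/
def measRenyi (α : ℝ) {ι : Type*} [Fintype ι] [DecidableEq ι]
    (ρ σ : Matrix ι ι ℂ) : EReal :=
  ⨆ (m : ℕ) (M : Fin m → Matrix ι ι ℂ)
    (_ : (∀ x, (M x).PosSemidef) ∧ ∑ x, M x = 1),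
      classRenyi α (fun x => (ρ * M x).trace.re) (fun x => (σ * M x).trace.re)

open scoped Kronecker

/-- The real linear functional `τ ↦ Re tr(ρ τ)`. -/
def traceForm {n : Type*} [Fintype n] (ρ : Matrix n n ℂ) : Matrix n n ℂ →ₗ[ℝ] ℝ where
  toFun τ := (ρ * τ).trace.re
  map_add' := by simp [Matrix.mul_add]
  map_smul' := by simp

/-- Positive semidefinite matrices summing to the identity, over an arbitrary finite index. -/
def IsPOVM {n J : Type*} [DecidableEq n] [Fintype J] (M : J → Matrix n n ℂ) : Prop :=
  (∀ x, (M x).PosSemidef) ∧ ∑ x, M x = 1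

/-- Real-valued version of `renyiQ` for orders below one. -/
def renyiTerm (α p q : ℝ) : ℝ := if p = 0 ∨ q = 0 then 0 else p ^ α * q ^ (1 - α)

lemma traceForm_apply {n : Type*} [Fintype n] (ρ τ : Matrix n n ℂ) : traceForm ρ τ = (ρ * τ).trace.re := rfl

lemma posSemidef_real_smul {n : Type*} {τ : Matrix n n ℂ} (hτ : τ.PosSemidef) {c : ℝ}
    (hc : 0 ≤ c) : (c • τ).PosSemidef := hτ.smul hc

lemma isHermitian_sum_smul {n J : Type*} [Fintype J] {P : J → Matrix n n ℂ} (hP : ∀ i, (P i).PosSemidef) (a : J → ℝ) :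
    (∑ i, a i • P i).IsHermitian := by
  simp only [Matrix.IsHermitian, conjTranspose_sum, conjTranspose_smul, star_trivial,
    (hP _).isHermitian.eq]

lemma posSemidef_of_traceForm_nonneg {n : Type*} [Fintype n] {ρ : Matrix n n ℂ} (hρ : ρ.IsHermitian)
    (h : ∀ τ : Matrix n n ℂ, τ.PosSemidef → 0 ≤ traceForm ρ τ) : ρ.PosSemidef := by
  refine Matrix.PosSemidef.of_dotProduct_mulVec_nonneg hρ fun v => ?_
  have h1 := h _ (posSemidef_vecMulVec_self_star v)
  rw [traceForm_apply, Matrix.mul_vecMulVec, Matrix.trace_vecMulVec, dotProduct_comm] at h1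
  exact Complex.le_def.mpr ⟨h1, (hρ.im_star_dotProduct_mulVec_self v).symm⟩

section MatrixLemmas

variable {n J : Type*} [Fintype n] [DecidableEq n] [Fintype J]

open scoped MatrixOrder Matrix.Norms.L2Operator in
lemma Matrix.PosSemidef.exists_eq_conjTranspose_mul_self {τ : Matrix n n ℂ} (hτ : τ.PosSemidef) :
    ∃ B : Matrix n n ℂ, τ = Bᴴ * B :=
  CStarAlgebra.nonneg_iff_eq_star_mul_self.mp hτ.nonneg

lemma traceForm_nonneg {ρ τ : Matrix n n ℂ} (hρ : ρ.PosSemidef) (hτ : τ.PosSemidef) :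
    0 ≤ traceForm ρ τ := by
  obtain ⟨B, rfl⟩ := hτ.exists_eq_conjTranspose_mul_self
  have h := (hρ.mul_mul_conjTranspose_same B).trace_nonneg
  rw [traceForm_apply, ← Matrix.mul_assoc, Matrix.trace_mul_comm, ← Matrix.mul_assoc]
  exact (Complex.le_def.mp h).1

/-- Spectral decomposition of a Hermitian matrix into rank-one projections. -/
lemma Matrix.IsHermitian.exists_spectral_projections {H : Matrix n n ℂ} (hH : H.IsHermitian) :
    ∃ P : n → Matrix n n ℂ, IsPOVM P ∧ (∀ i, P i * P i = P i) ∧ (∀ i j, i ≠ j → P i * P j = 0) ∧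
      H = ∑ i, hH.eigenvalues i • P i := by
  set U : Matrix n n ℂ := (hH.eigenvectorUnitary : Matrix n n ℂ) with hU
  have hU1 : Uᴴ * U = 1 := Unitary.coe_star_mul_self hH.eigenvectorUnitary
  have hU2 : U * Uᴴ = 1 := Unitary.coe_mul_star_self hH.eigenvectorUnitary
  have hmul : ∀ A B : Matrix n n ℂ, U * A * Uᴴ * (U * B * Uᴴ) = U * (A * B) * Uᴴ := by
    intro A B
    calc U * A * Uᴴ * (U * B * Uᴴ) = U * A * (Uᴴ * U) * B * Uᴴ := by
          simp only [Matrix.mul_assoc]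
      _ = _ := by rw [hU1]; simp only [Matrix.mul_assoc, Matrix.mul_one]
  refine ⟨fun i => U * diagonal (Pi.single i 1) * Uᴴ, ⟨fun i => ?_, ?_⟩, fun i => ?_,
    fun i j hij => ?_, ?_⟩
  · refine Matrix.PosSemidef.mul_mul_conjTranspose_same (Matrix.PosSemidef.diagonal ?_) U
    intro j
    by_cases h : j = i
    · subst h; simp
    · simp [h]
  · rw [← Finset.sum_mul, ← Finset.mul_sum]
    have : ∑ i, diagonal (Pi.single i (1 : ℂ)) = (1 : Matrix n n ℂ) := by
      ext a b
      simp [Matrix.sum_apply, diagonal_apply, Matrix.one_apply, Pi.single_apply]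
    rw [this, Matrix.mul_one, hU2]
  · rw [hmul, diagonal_mul_diagonal]
    congr 3
    ext j
    by_cases h : j = i
    · subst h; simp
    · simp [h]
  · rw [hmul, diagonal_mul_diagonal]
    have : (fun k => (Pi.single i (1 : ℂ) : n → ℂ) k * (Pi.single j (1 : ℂ) : n → ℂ) k) = 0 := by
      ext k
      by_cases h : k = i
      · subst h; simp [hij]
      · simp [h]
    rw [this]
    simp
  · conv_lhs => rw [hH.spectral_theorem, Unitary.conjStarAlgAut_apply]
    have : diagonal (RCLike.ofReal ∘ hH.eigenvalues)
        = ∑ i, hH.eigenvalues i • diagonal (Pi.single i (1 : ℂ)) := by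
      ext a b
      simp [Matrix.sum_apply, diagonal_apply, Pi.single_apply, Function.comp]
    rw [this, Finset.mul_sum, Finset.sum_mul]
    refine Finset.sum_congr rfl fun i _ => ?_
    rw [Matrix.mul_smul, Matrix.smul_mul]
    rfl

/-- Operator Jensen inequality for the inverse, tested against a positive semidefinite matrix. -/
lemma traceForm_inverse_le {M : J → Matrix n n ℂ} (hM : IsPOVM M) {u : J → ℝ} (hu : ∀ x, 0 < u x)
    {σ Y Z : Matrix n n ℂ} (hσ : σ.PosSemidef) (hZ : Z.IsHermitian) (hY : ∑ x, u x • M x = Y)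
    (hZY : Z * Y = 1) : traceForm σ Z ≤ ∑ x, (u x)⁻¹ * traceForm σ (M x) := by
  have key : ∑ x, (u x)⁻¹ • ((1 - u x • Z)ᴴ * M x * (1 - u x • Z))
      = ∑ x, (u x)⁻¹ • M x - Z := by
    have h1 : ∀ x, (u x)⁻¹ • ((1 - u x • Z)ᴴ * M x * (1 - u x • Z))
        = (u x)⁻¹ • M x - M x * Z - Z * M x + Z * (u x • M x) * Z := by
      intro x
      have hx := (hu x).ne'
      rw [conjTranspose_sub, conjTranspose_smul, hZ.eq]
      simp only [conjTranspose_one, star_trivial, Matrix.sub_mul, Matrix.mul_sub, Matrix.one_mul,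
        Matrix.mul_one, Matrix.smul_mul, Matrix.mul_smul, smul_sub, smul_smul]
      rw [inv_mul_cancel₀ hx, one_smul, ← mul_assoc, inv_mul_cancel₀ hx, one_mul, one_smul]
      abel
    simp_rw [h1]
    rw [Finset.sum_add_distrib, Finset.sum_sub_distrib, Finset.sum_sub_distrib, ← Finset.sum_mul,
      ← Finset.mul_sum, ← Finset.sum_mul, ← Finset.mul_sum, hM.2, hY, hZY]
    simp
  have hpos : (∑ x, (u x)⁻¹ • M x - Z).PosSemidef := by
    rw [← key]
    exact posSemidef_sum _ fun x _ => posSemidef_real_smul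
      ((hM.1 x).conjTranspose_mul_mul_same _) (inv_nonneg.mpr (hu x).le)
  have := traceForm_nonneg hσ hpos
  rw [map_sub, map_sum] at this
  simp only [map_smul, smul_eq_mul] at this
  linarith

/-- Spectral decomposition of a Hermitian matrix, indexed by an initial segment of `ℕ`. -/
lemma Matrix.IsHermitian.exists_spectral_fin {H : Matrix n n ℂ} (hH : H.IsHermitian) :
    ∃ (m : ℕ) (P : Fin m → Matrix n n ℂ) (y : Fin m → ℝ), IsPOVM P ∧ (∀ i, P i * P i = P i) ∧
      (∀ i j, i ≠ j → P i * P j = 0) ∧ (∀ i, ∃ k, y i = hH.eigenvalues k) ∧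
      H = ∑ i, y i • P i := by
  obtain ⟨P, hP, hP1, hP2, hP3⟩ := hH.exists_spectral_projections
  let e := (Fintype.equivFin n).symm
  refine ⟨Fintype.card n, P ∘ e, hH.eigenvalues ∘ e, ⟨fun i => hP.1 _, ?_⟩, fun i => hP1 _,
    fun i j hij => hP2 _ _ (e.injective.ne hij), fun i => ⟨_, rfl⟩, ?_⟩
  · exact (Equiv.sum_comp e P).trans hP.2
  · exact hP3.trans (Equiv.sum_comp e fun i => hH.eigenvalues i • P i).symm

/-- Multiplication rule for linear combinations of orthogonal projections. -/
lemma sum_smul_mul_sum_smul_of_orthogonal {P : J → Matrix n n ℂ} (hP1 : ∀ i, P i * P i = P i)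
    (hP2 : ∀ i j, i ≠ j → P i * P j = 0) (a b : J → ℝ) :
    (∑ i, a i • P i) * (∑ i, b i • P i) = ∑ i, (a i * b i) • P i := by
  rw [Finset.sum_mul_sum]
  refine Finset.sum_congr rfl fun i _ => ?_
  rw [Finset.sum_eq_single i (fun j _ hj => by simp [hP2 i j hj.symm]) (by simp)]
  rw [Matrix.smul_mul, Matrix.mul_smul, hP1, smul_smul]

/-- Positive semidefinite matrices that are orthogonal for the trace form multiply to zero. -/
lemma mul_eq_zero_of_traceForm_eq_zero {A B : Matrix n n ℂ} (hA : A.PosSemidef)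
    (hB : B.PosSemidef) (h : traceForm A B = 0) : A * B = 0 := by
  obtain ⟨C, rfl⟩ := hA.exists_eq_conjTranspose_mul_self
  obtain ⟨D, rfl⟩ := hB.exists_eq_conjTranspose_mul_self
  have e : (Cᴴ * C * (Dᴴ * D)).trace = ((C * Dᴴ)ᴴ * (C * Dᴴ)).trace := by
    rw [conjTranspose_mul, conjTranspose_conjTranspose, ← Matrix.mul_assoc, Matrix.trace_mul_comm]
    simp only [Matrix.mul_assoc]
  rw [traceForm_apply, e] at h
  have hn := (Matrix.posSemidef_conjTranspose_mul_self (C * Dᴴ)).trace_nonneg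
  have h0 : ((C * Dᴴ)ᴴ * (C * Dᴴ)).trace = 0 :=
    Complex.ext h (Complex.le_def.mp hn).2.symm
  rw [Matrix.trace_conjTranspose_mul_self_eq_zero_iff] at h0
  calc Cᴴ * C * (Dᴴ * D) = Cᴴ * (C * Dᴴ) * D := by simp only [Matrix.mul_assoc]
    _ = 0 := by rw [h0]; simp

/-- Every real linear functional is a trace form on Hermitian matrices. -/
lemma exists_traceForm_eq (f : Matrix n n ℂ →ₗ[ℝ] ℝ) :
    ∃ ρ : Matrix n n ℂ, ρ.IsHermitian ∧ ∀ τ : Matrix n n ℂ, τ.IsHermitian →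
      traceForm ρ τ = f τ := by
  let B : Matrix n n ℂ := fun j i => ⟨f (single i j 1), -f (single i j Complex.I)⟩
  have hB : ∀ τ, traceForm B τ = f τ := by
    intro τ
    have hτ : τ = ∑ i, ∑ j, ((τ i j).re • single i j (1 : ℂ)
        + (τ i j).im • single i j Complex.I) := by
      conv_lhs => rw [matrix_eq_sum_single τ]
      refine Finset.sum_congr rfl fun i _ => Finset.sum_congr rfl fun j _ => ?_
      rw [smul_single, smul_single, ← single_add]
      congr 1
      apply Complex.ext <;> simp
    conv_rhs => rw [hτ]
    simp only [map_sum, map_add, map_smul, smul_eq_mul, traceForm_apply, Matrix.trace,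
      Matrix.diag_apply, Matrix.mul_apply, Complex.re_sum, Complex.mul_re]
    rw [Finset.sum_comm]
    refine Finset.sum_congr rfl fun i _ => Finset.sum_congr rfl fun j _ => ?_
    simp only [B]
    ring
  refine ⟨(1 / 2 : ℝ) • (B + Bᴴ), ?_, fun τ hτ => ?_⟩
  · simp [Matrix.IsHermitian, conjTranspose_smul, conjTranspose_add, add_comm]
  · have h2 : traceForm Bᴴ τ = traceForm B τ := by
      rw [traceForm_apply, traceForm_apply, ← Complex.conj_re (B * τ).trace, ← Complex.star_def,
        ← Matrix.trace_conjTranspose, conjTranspose_mul, hτ.eq, Matrix.trace_mul_comm]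
    have h3 : traceForm ((1 / 2 : ℝ) • (B + Bᴴ)) τ
        = (1 / 2) * (traceForm B τ + traceForm Bᴴ τ) := by
      simp [traceForm_apply, Matrix.add_mul, mul_add]
    rw [h3, h2, hB]
    ring

end MatrixLemmas

lemma sum_kronecker_one {ιA ιR J : Type*} [DecidableEq ιR] [Fintype J] (X : J → Matrix ιA ιA ℂ) :
    (∑ i, X i) ⊗ₖ (1 : Matrix ιR ιR ℂ) = ∑ i, X i ⊗ₖ (1 : Matrix ιR ιR ℂ) := by
  ext a b
  simp [Matrix.sum_apply, Finset.sum_mul]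

lemma posSemidef_kronecker_uniform {ιA ιR : Type*} [Fintype ιA] [Fintype ιR] [DecidableEq ιR] {ρ : Matrix ιA ιA ℂ} (hρ : ρ.PosSemidef) :
    (ρ ⊗ₖ ((Fintype.card ιR : ℝ)⁻¹ • (1 : Matrix ιR ιR ℂ))).PosSemidef :=
  hρ.kronecker (posSemidef_real_smul Matrix.PosSemidef.one (by positivity))

lemma isHermitian_ptraceR {ιA ιR : Type*} [Fintype ιR] {ρ : Matrix (ιA × ιR) (ιA × ιR) ℂ} (hρ : ρ.IsHermitian) :
    (ptraceR ρ).IsHermitian := by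
  ext i j
  simp only [conjTranspose_apply, ptraceR, star_sum]
  exact Finset.sum_congr rfl fun k _ => hρ.apply _ _

lemma traceForm_kronecker_one {ιA ιR : Type*} [Fintype ιA] [Fintype ιR] [DecidableEq ιR]
    (σ : Matrix (ιA × ιR) (ιA × ιR) ℂ) (X : Matrix ιA ιA ℂ) :
    traceForm σ (X ⊗ₖ (1 : Matrix ιR ιR ℂ)) = traceForm (ptraceR σ) X := by
  simp only [traceForm_apply]
  congr 1
  simp only [Matrix.trace, Matrix.diag_apply, Matrix.mul_apply, Fintype.sum_prod_type,
    kroneckerMap_apply, Matrix.one_apply, ptraceR, Finset.sum_mul]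
  refine Finset.sum_congr rfl fun i _ => ?_
  rw [Finset.sum_comm]
  exact Finset.sum_congr rfl fun a _ => Finset.sum_congr rfl fun k _ => by simp

lemma ptraceR_kronecker_uniform {ιA ιR : Type*} [Fintype ιR] [DecidableEq ιR] [Nonempty ιR] (ρ : Matrix ιA ιA ℂ) :
    ptraceR (ρ ⊗ₖ ((Fintype.card ιR : ℝ)⁻¹ • (1 : Matrix ιR ιR ℂ))) = ρ := by
  ext i j
  simp [ptraceR, mul_left_comm]

section PartialTrace

variable {ιA ιR J : Type*} [Fintype ιA] [DecidableEq ιA] [Fintype ιR] [DecidableEq ιR] [Fintype J]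

lemma IsPOVM.kronecker_one {M : J → Matrix ιA ιA ℂ} (hM : IsPOVM M) :
    IsPOVM fun x => M x ⊗ₖ (1 : Matrix ιR ιR ℂ) :=
  ⟨fun x => (hM.1 x).kronecker Matrix.PosSemidef.one, by
    rw [← sum_kronecker_one, hM.2, Matrix.one_kronecker_one]⟩

lemma posSemidef_ptraceR {σ : Matrix (ιA × ιR) (ιA × ιR) ℂ} (hσ : σ.PosSemidef) :
    (ptraceR σ).PosSemidef :=
  posSemidef_of_traceForm_nonneg (isHermitian_ptraceR hσ.isHermitian) fun τ hτ => by
    rw [← traceForm_kronecker_one]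
    exact traceForm_nonneg hσ (hτ.kronecker Matrix.PosSemidef.one)

end PartialTrace

section ScalarLemmas

open MeasureTheory Set in
/-- Stieltjes-type transfer: domination of resolvents implies domination of negative powers. -/
lemma sum_rpow_neg_le_of_resolvent {I J : Type*} [Fintype I] [Fintype J] {s : ℝ} (hs : 0 < s)
    (hs1 : s ≤ 1) {b y : I → ℝ} {a t : J → ℝ} (hy : ∀ i, 0 < y i) (ht : ∀ x, 0 < t x)
    (h : ∀ l : ℝ, 0 ≤ l → ∑ i, (l + y i)⁻¹ * b i ≤ ∑ x, (l + t x)⁻¹ * a x) :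
    ∑ i, y i ^ (-s) * b i ≤ ∑ x, t x ^ (-s) * a x := by
  rcases hs1.eq_or_lt with rfl | hs1
  · simpa [Real.rpow_neg_one] using h 0 le_rfl
  have hp : 1 - s ∈ Ioo (0 : ℝ) 1 := ⟨by linarith, by linarith⟩
  set C := ∫ l in Ioi 0, Real.rpowIntegrand₀₁ (1 - s) l 1 with hC
  have hCpos : 0 < C := Real.integral_rpowIntegrand₀₁_one_pos hp
  have hint : ∀ z : ℝ, 0 < z → ∀ c : ℝ,
      IntegrableOn (fun l => Real.rpowIntegrand₀₁ (1 - s) l z * (z⁻¹ * c)) (Ioi 0) :=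
    fun z hz c => (Real.integrableOn_rpowIntegrand₀₁_Ioi hp hz.le).mul_const _
  have hval : ∀ z : ℝ, 0 < z → ∀ c : ℝ,
      ∫ l in Ioi 0, Real.rpowIntegrand₀₁ (1 - s) l z * (z⁻¹ * c) = C * (z ^ (-s) * c) := by
    intro z hz c
    rw [integral_mul_const, Real.integral_rpowIntegrand₀₁_eq_rpow_mul_const hp hz.le, ← hC,
      show (1 - s) = 1 + -s by ring, Real.rpow_add hz, Real.rpow_one]
    field_simp
  have hform : ∀ l : ℝ, 0 < l → ∀ z : ℝ, 0 < z → ∀ c : ℝ,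
      Real.rpowIntegrand₀₁ (1 - s) l z * (z⁻¹ * c) = l ^ (-s) * ((l + z)⁻¹ * c) := by
    intro l hl z hz c
    rw [Real.rpowIntegrand₀₁_eq_pow_div hp hl.le hz.le, show 1 - s - 1 = -s by ring]
    field_simp
  have hmain : ∫ l in Ioi 0, ∑ i, Real.rpowIntegrand₀₁ (1 - s) l (y i) * ((y i)⁻¹ * b i)
      ≤ ∫ l in Ioi 0, ∑ x, Real.rpowIntegrand₀₁ (1 - s) l (t x) * ((t x)⁻¹ * a x) := by
    refine setIntegral_mono_on (integrable_finsetSum _ fun i _ => hint _ (hy i) _)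
      (integrable_finsetSum _ fun x _ => hint _ (ht x) _) measurableSet_Ioi fun l hl => ?_
    rw [Finset.sum_congr rfl fun i _ => hform l hl _ (hy i) (b i),
      Finset.sum_congr rfl fun x _ => hform l hl _ (ht x) (a x), ← Finset.mul_sum, ← Finset.mul_sum]
    exact mul_le_mul_of_nonneg_left (h l (le_of_lt hl)) (Real.rpow_nonneg (le_of_lt hl) _)
  rw [integral_finsetSum _ fun i _ => hint _ (hy i) _,
    integral_finsetSum _ fun x _ => hint _ (ht x) _,
    Finset.sum_congr rfl fun i _ => hval _ (hy i) (b i),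
    Finset.sum_congr rfl fun x _ => hval _ (ht x) (a x), ← Finset.mul_sum, ← Finset.mul_sum] at hmain
  exact le_of_mul_le_mul_left hmain hCpos

/-- Weighted AM-GM bound behind the variational formula. -/
lemma renyiTerm_le {α p q t : ℝ} (hα : 0 < α) (hα1 : α < 1) (hp : 0 ≤ p) (hq : 0 ≤ q)
    (ht : 0 < t) :
    renyiTerm α p q ≤ α * (t * p) + (1 - α) * (t ^ (-(α / (1 - α))) * q) := by
  have h1 : 0 < 1 - α := by linarith
  have hts : 0 < t ^ (-(α / (1 - α))) := Real.rpow_pos_of_pos ht _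
  unfold renyiTerm
  split_ifs with h
  · positivity
  · refine le_of_eq_of_le ?_ (Real.geom_mean_le_arith_mean2_weighted hα.le h1.le
      (mul_nonneg ht.le hp) (mul_nonneg hts.le hq) (by ring))
    rw [Real.mul_rpow ht.le hp, Real.mul_rpow hts.le hq, ← Real.rpow_mul ht.le,
      show -(α / (1 - α)) * (1 - α) = -α by field_simp, Real.rpow_neg ht.le]
    have := (Real.rpow_pos_of_pos ht α).ne'
    field_simp

/-- The weighted AM-GM bound is tight up to an arbitrarily small error. -/
lemma exists_le_renyiTerm_add {α p q ε : ℝ} (hα : 0 < α) (hα1 : α < 1) (hp : 0 ≤ p) (hq : 0 ≤ q)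
    (hε : 0 < ε) :
    ∃ t : ℝ, 0 < t ∧
      α * (t * p) + (1 - α) * (t ^ (-(α / (1 - α))) * q) ≤ renyiTerm α p q + ε := by
  have h1 : 0 < 1 - α := by linarith
  have hs : 0 < α / (1 - α) := div_pos hα h1
  unfold renyiTerm
  split_ifs with h
  · rcases eq_or_ne p 0 with rfl | hp0
    · have hlim := ((tendsto_rpow_neg_atTop hs).mul_const q).const_mul (1 - α)
      simp only [zero_mul, mul_zero] at hlim
      obtain ⟨t, ht, ht0⟩ := ((hlim.eventually (gt_mem_nhds hε)).and
        (Filter.eventually_gt_atTop 0)).exists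
      exact ⟨t, ht0, by simpa using ht.le⟩
    · obtain rfl : q = 0 := h.resolve_left hp0
      have hp' : 0 < p := lt_of_le_of_ne hp (Ne.symm hp0)
      refine ⟨ε / (α * p), by positivity, le_of_eq ?_⟩
      field_simp
      ring
  · push Not at h
    have hp' : 0 < p := lt_of_le_of_ne hp (Ne.symm h.1)
    have hq' : 0 < q := lt_of_le_of_ne hq (Ne.symm h.2)
    refine ⟨(q / p) ^ (1 - α), by positivity, ?_⟩
    have e1 : (q / p) ^ (1 - α) * p = p ^ α * q ^ (1 - α) := by
      rw [Real.div_rpow hq hp, Real.rpow_sub hp', Real.rpow_one]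
      have := (Real.rpow_pos_of_pos hp' α).ne'
      field_simp
    have e2 : ((q / p) ^ (1 - α)) ^ (-(α / (1 - α))) * q = p ^ α * q ^ (1 - α) := by
      rw [← Real.rpow_mul (by positivity), show (1 - α) * -(α / (1 - α)) = -α by field_simp,
        Real.rpow_neg (by positivity), Real.div_rpow hq hp, Real.rpow_sub hq', Real.rpow_one]
      have := (Real.rpow_pos_of_pos hp' α).ne'
      have := (Real.rpow_pos_of_pos hq' α).ne'
      field_simp
    rw [e1, e2]
    linarith

end ScalarLemmas

section MainLemmas

variable {ιA ιR : Type*} [Fintype ιA] [DecidableEq ιA] [Fintype ιR] [DecidableEq ιR]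

/-- A POVM average with positive weights is bounded below by a positive multiple of the identity. -/
lemma IsPOVM.posDef_sum_smul {n J : Type*} [Fintype n] [DecidableEq n] [Fintype J]
    {M : J → Matrix n n ℂ} (hM : IsPOVM M) {t : J → ℝ} (ht : ∀ x, 0 < t x) :
    (∑ x, t x • M x).PosDef := by
  obtain ⟨c, hc, hct⟩ : ∃ c : ℝ, 0 < c ∧ ∀ x, c ≤ t x := by
    rcases isEmpty_or_nonempty J with hJ | hJ
    · exact ⟨1, one_pos, fun x => hJ.elim x⟩
    · obtain ⟨x, hx⟩ := Finite.exists_min t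
      exact ⟨t x, ht x, hx⟩
  have h : ∑ x, t x • M x = c • (1 : Matrix n n ℂ) + ∑ x, (t x - c) • M x := by
    rw [← hM.2, Finset.smul_sum, ← Finset.sum_add_distrib]
    exact Finset.sum_congr rfl fun x _ => by rw [← add_smul]; congr 1; ring
  rw [h]
  refine Matrix.PosDef.add_posSemidef (Matrix.PosDef.one.smul hc) ?_
  exact posSemidef_sum _ fun x _ => posSemidef_real_smul (hM.1 x) (sub_nonneg.mpr (hct x))

/-- Operator Jensen inequality for `t ↦ t ^ (-s)` for a POVM average of the form `X ⊗ 1`. -/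
lemma exists_spectral_rpow_neg_le [Nonempty ιR] {J : Type*} [Fintype J] {s : ℝ} (hs : 0 < s)
    (hs1 : s ≤ 1) {σ : Matrix (ιA × ιR) (ιA × ιR) ℂ} (hσ : σ.PosSemidef)
    {M : J → Matrix (ιA × ιR) (ιA × ιR) ℂ} (hM : IsPOVM M) {t : J → ℝ} (ht : ∀ x, 0 < t x)
    {X : Matrix ιA ιA ℂ} (hX : ∑ x, t x • M x = X ⊗ₖ (1 : Matrix ιR ιR ℂ)) :
    ∃ (m : ℕ) (P : Fin m → Matrix ιA ιA ℂ) (y : Fin m → ℝ), IsPOVM P ∧ (∀ i, 0 < y i) ∧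
      X = ∑ i, y i • P i ∧
      ∑ i, y i ^ (-s) * traceForm (ptraceR σ) (P i) ≤ ∑ x, t x ^ (-s) * traceForm σ (M x) := by
  have hXpos : X.PosDef := by
    obtain ⟨k⟩ := ‹Nonempty ιR›
    have h := (hM.posDef_sum_smul ht).submatrix (e := fun i : ιA => (i, k))
      (fun i j hij => (Prod.ext_iff.mp hij).1)
    rw [hX] at h
    convert h using 1
    ext i j
    simp
  obtain ⟨m, P, y, hP, hP1, hP2, hy, hXP⟩ := hXpos.isHermitian.exists_spectral_fin
  have hypos : ∀ i, 0 < y i := fun i => by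
    obtain ⟨k, hk⟩ := hy i
    rw [hk]
    exact hXpos.eigenvalues_pos k
  refine ⟨m, P, y, hP, hypos, hXP, sum_rpow_neg_le_of_resolvent hs hs1 hypos ht fun l hl => ?_⟩
  have hY : ∑ x, (l + t x) • M x = (∑ i, (l + y i) • P i) ⊗ₖ (1 : Matrix ιR ιR ℂ) := by
    simp_rw [add_smul]
    rw [Finset.sum_add_distrib, Finset.sum_add_distrib, ← Finset.smul_sum, ← Finset.smul_sum,
      hM.2, hP.2, ← hXP, hX, Matrix.add_kronecker, Matrix.smul_kronecker, Matrix.one_kronecker_one]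
  have hZY : (∑ i, (l + y i)⁻¹ • P i) ⊗ₖ (1 : Matrix ιR ιR ℂ)
      * (∑ i, (l + y i) • P i) ⊗ₖ (1 : Matrix ιR ιR ℂ) = 1 := by
    rw [← Matrix.mul_kronecker_mul, sum_smul_mul_sum_smul_of_orthogonal hP1 hP2, Matrix.mul_one]
    have : ∀ i, (l + y i)⁻¹ * (l + y i) = 1 :=
      fun i => inv_mul_cancel₀ (add_pos_of_nonneg_of_pos hl (hypos i)).ne'
    simp only [this, one_smul, hP.2, Matrix.one_kronecker_one]
  have hZ : ((∑ i, (l + y i)⁻¹ • P i) ⊗ₖ (1 : Matrix ιR ιR ℂ)).IsHermitian := by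
    rw [Matrix.IsHermitian, conjTranspose_kronecker, conjTranspose_one,
      (isHermitian_sum_smul hP.1 _).eq]
  have h := traceForm_inverse_le hM (fun x => add_pos_of_nonneg_of_pos hl (ht x)) hσ hZ hY hZY
  rw [traceForm_kronecker_one, map_sum] at h
  simpa only [map_smul, smul_eq_mul] using h

/-- The cone generated by the pairs `(∑ t x • M x, w)` with `M` a POVM, `t` positive and
`c * ∑ t x ^ (-s) * tr (σ M x) - Q ≤ w`. -/
def povmCone {n : Type*} [Fintype n] [DecidableEq n] (s c Q : ℝ) (σ : Matrix n n ℂ) :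
    PointedCone ℝ (Matrix n n ℂ × ℝ) where
  carrier := {z | ∃ (J : Type) (_ : Fintype J) (M : J → Matrix n n ℂ) (t : J → ℝ) (l : ℝ),
    0 ≤ l ∧ (l = 0 → z = 0) ∧ (∀ x, (M x).PosSemidef) ∧ ∑ x, M x = l • (1 : Matrix n n ℂ) ∧
    (∀ x, 0 < t x) ∧ z.1 = ∑ x, t x • M x ∧
    c * ∑ x, t x ^ (-s) * traceForm σ (M x) - l * Q ≤ z.2}
  zero_mem' := ⟨Empty, inferInstance, fun _ => 0, fun _ => 1, 0, by simp⟩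
  add_mem' := by
    rintro z z' ⟨J, _, M, t, l, hl, hl0, hM, hM1, ht, hz, hw⟩
      ⟨J', _, M', t', l', hl', hl0', hM', hM1', ht', hz', hw'⟩
    refine ⟨J ⊕ J', inferInstance, Sum.elim M M', Sum.elim t t', l + l', add_nonneg hl hl',
      fun h => ?_, ?_, ?_, ?_, ?_, ?_⟩
    · rw [hl0 (by linarith), hl0' (by linarith), add_zero]
    · rintro (x | x)
      exacts [hM x, hM' x]
    · simp [Fintype.sum_sum_type, hM1, hM1', add_smul]
    · rintro (x | x)
      exacts [ht x, ht' x]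
    · simp [Fintype.sum_sum_type, hz, hz']
    · simp only [Fintype.sum_sum_type, Sum.elim_inl, Sum.elim_inr, Prod.snd_add]
      linarith
  smul_mem' := by
    rintro ⟨a, ha⟩ z ⟨J, _, M, t, l, hl, hl0, hM, hM1, ht, hz, hw⟩
    refine ⟨J, inferInstance, fun x => a • M x, t, a * l, mul_nonneg ha hl,
      fun h => ?_, fun x => posSemidef_real_smul (hM x) ha, ?_, ht, ?_, ?_⟩
    · change a • z = 0
      rcases mul_eq_zero.mp h with h | h
      · rw [h, zero_smul]
      · rw [hl0 h, smul_zero]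
    · rw [← Finset.smul_sum, hM1, smul_smul]
    · change a • z.1 = _
      rw [hz, Finset.smul_sum]
      exact Finset.sum_congr rfl fun x _ => smul_comm _ _ _
    · change _ ≤ a * z.2
      have : ∑ x, t x ^ (-s) * traceForm σ (a • M x) = a * ∑ x, t x ^ (-s) * traceForm σ (M x) := by
        rw [Finset.mul_sum]
        exact Finset.sum_congr rfl fun x _ => by rw [map_smul, smul_eq_mul]; ring
      rw [this]
      calc _ = a * (c * ∑ x, t x ^ (-s) * traceForm σ (M x) - l * Q) := by ring
        _ ≤ _ := mul_le_mul_of_nonneg_left hw ha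

lemma mem_povmCone_of_isPOVM {n : Type*} [Fintype n] [DecidableEq n] {s c Q : ℝ}
    {σ : Matrix n n ℂ} {J : Type} [Fintype J] {M : J → Matrix n n ℂ} (hM : IsPOVM M) {t : J → ℝ}
    (ht : ∀ x, 0 < t x) {w : ℝ} (hw : c * ∑ x, t x ^ (-s) * traceForm σ (M x) - Q ≤ w) :
    (∑ x, t x • M x, w) ∈ povmCone s c Q σ :=
  ⟨J, inferInstance, M, t, 1, zero_le_one, by simp, hM.1, by rw [hM.2, one_smul], ht, rfl,
    by simpa using hw⟩

lemma eq_zero_or_exists_of_mem_povmCone {n : Type*} [Fintype n] [DecidableEq n] {s c Q : ℝ}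
    {σ : Matrix n n ℂ} {z : Matrix n n ℂ × ℝ} (hz : z ∈ povmCone s c Q σ) :
    z = 0 ∨ ∃ (l : ℝ) (J : Type) (_ : Fintype J) (M : J → Matrix n n ℂ) (t : J → ℝ),
      0 < l ∧ IsPOVM M ∧ (∀ x, 0 < t x) ∧ z.1 = l • ∑ x, t x • M x ∧
      l * (c * ∑ x, t x ^ (-s) * traceForm σ (M x) - Q) ≤ z.2 := by
  obtain ⟨J, _, M, t, l, hl, hl0, hM, hM1, ht, hz, hw⟩ := hz
  rcases hl.eq_or_lt with rfl | hl
  · exact Or.inl (hl0 rfl)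
  refine Or.inr ⟨l, J, inferInstance, fun x => l⁻¹ • M x, t, hl,
    ⟨fun x => posSemidef_real_smul (hM x) (inv_nonneg.mpr hl.le), ?_⟩, ht, ?_, ?_⟩
  · rw [← Finset.smul_sum, hM1, smul_smul, inv_mul_cancel₀ hl.ne', one_smul]
  · rw [hz, Finset.smul_sum]
    refine Finset.sum_congr rfl fun x _ => ?_
    rw [smul_comm (t x), smul_smul, mul_inv_cancel₀ hl.ne', one_smul]
  · refine le_of_eq_of_le ?_ hw
    have : ∑ x, t x ^ (-s) * traceForm σ (l⁻¹ • M x)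
        = l⁻¹ * ∑ x, t x ^ (-s) * traceForm σ (M x) := by
      rw [Finset.mul_sum]
      exact Finset.sum_congr rfl fun x _ => by rw [map_smul, smul_eq_mul]; ring
    rw [this]
    field_simp

/-- Existence of the optimal extension for positive orders, by conic Hahn-Banach extension. -/
lemma exists_extension_variational [Nonempty ιR] {α Q : ℝ} (hα0 : 0 < α) (hα : α ≤ 1 / 2)
    {ρA : Matrix ιA ιA ℂ} (hρA : ρA.PosSemidef)
    {σ : Matrix (ιA × ιR) (ιA × ιR) ℂ} (hσ : σ.PosSemidef)
    (hQ : ∀ (m : ℕ) (M : Fin m → Matrix ιA ιA ℂ), IsPOVM M →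
      Q ≤ ∑ x, renyiTerm α (traceForm ρA (M x)) (traceForm (ptraceR σ) (M x))) :
    ∃ ρ : Matrix (ιA × ιR) (ιA × ιR) ℂ, ρ.IsHermitian ∧ ptraceR ρ = ρA ∧
      ∀ (m : ℕ) (M : Fin m → Matrix (ιA × ιR) (ιA × ιR) ℂ) (t : Fin m → ℝ), IsPOVM M →
        (∀ x, 0 < t x) → Q ≤ α * traceForm ρ (∑ x, t x • M x)
          + (1 - α) * ∑ x, t x ^ (-(α / (1 - α))) * traceForm σ (M x) := by
  have hσA := posSemidef_ptraceR hσ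
  have h1 : 0 < 1 - α := by linarith
  have hs : 0 < α / (1 - α) := div_pos hα0 h1
  have hs1 : α / (1 - α) ≤ 1 := by rw [div_le_one h1]; linarith
  let ρ₀ : Matrix (ιA × ιR) (ιA × ιR) ℂ := ρA ⊗ₖ ((Fintype.card ιR : ℝ)⁻¹ • (1 : Matrix ιR ιR ℂ))
  have hρ₀ : ptraceR ρ₀ = ρA := ptraceR_kronecker_uniform ρA
  let L : Matrix (ιA × ιR) (ιA × ιR) ℂ × ℝ →ₗ[ℝ] ℝ :=
    (α • traceForm ρ₀).comp (LinearMap.fst ℝ _ ℝ) + LinearMap.snd ℝ _ ℝ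
  have hL : ∀ z, L z = α * traceForm ρ₀ z.1 + z.2 := fun z => rfl
  let p : Submodule ℝ (Matrix (ιA × ιR) (ιA × ιR) ℂ × ℝ) :=
    { carrier := {z | ∃ X : Matrix ιA ιA ℂ, z.1 + z.1ᴴ = X ⊗ₖ (1 : Matrix ιR ιR ℂ)}
      zero_mem' := ⟨0, by simp⟩
      add_mem' := by
        rintro z z' ⟨X, hX⟩ ⟨X', hX'⟩
        refine ⟨X + X', ?_⟩
        rw [Matrix.add_kronecker, ← hX, ← hX', Prod.fst_add, conjTranspose_add]
        abel
      smul_mem' := by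
        rintro c z ⟨X, hX⟩
        refine ⟨c • X, ?_⟩
        rw [Matrix.smul_kronecker, ← hX, Prod.smul_fst, conjTranspose_smul, star_trivial, smul_add] }
  obtain ⟨g, hgL, hgK⟩ := riesz_extension (povmCone (α / (1 - α)) (1 - α) Q σ) (L.toPMap p)
    (by
      rintro ⟨z, X, hX⟩ hz
      change 0 ≤ L z
      rcases eq_zero_or_exists_of_mem_povmCone hz with rfl | ⟨l, J, _, M, t, hl, hM, ht, hz1, hz2⟩
      · simp
      have hsum : ∑ x, t x • M x = ((2 * l)⁻¹ • X) ⊗ₖ (1 : Matrix ιR ιR ℂ) := by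
        rw [Matrix.smul_kronecker, ← hX, hz1, conjTranspose_smul, star_trivial,
          (isHermitian_sum_smul hM.1 t).eq, ← two_smul ℝ (l • ∑ x, t x • M x), smul_smul, smul_smul,
          mul_assoc, inv_mul_cancel₀ (by positivity), one_smul]
      obtain ⟨m, P, y, hP, hy, hXP, hle⟩ := exists_spectral_rpow_neg_le hs hs1 hσ hM ht hsum
      have hval : traceForm ρ₀ z.1 = l * ∑ i, y i * traceForm ρA (P i) := by
        rw [hz1, map_smul, hsum, traceForm_kronecker_one, hρ₀, hXP, map_sum]
        simp only [map_smul, smul_eq_mul]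
      have hQP : Q ≤ α * ∑ i, y i * traceForm ρA (P i)
          + (1 - α) * ∑ i, y i ^ (-(α / (1 - α))) * traceForm (ptraceR σ) (P i) := by
        refine (hQ m P hP).trans ?_
        rw [Finset.mul_sum, Finset.mul_sum, ← Finset.sum_add_distrib]
        exact Finset.sum_le_sum fun i _ => renyiTerm_le hα0 (by linarith)
          (traceForm_nonneg hρA (hP.1 i)) (traceForm_nonneg hσA (hP.1 i)) (hy i)
      rw [hL, hval]
      have h2 := mul_le_mul_of_nonneg_left hle h1.le
      have h3 := mul_le_mul_of_nonneg_left (a := l) (hQP.trans (add_le_add_right h2 _)) hl.le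
      linarith)
    (by
      rintro ⟨τ, w⟩
      have hH : ((1 / 2 : ℝ) • (τ + τᴴ)).IsHermitian := by
        simp [Matrix.IsHermitian, conjTranspose_smul, conjTranspose_add, add_comm]
      obtain ⟨m, P, y, hP, -, -, -, hτP⟩ := hH.exists_spectral_fin
      let c : ℝ := 1 + ∑ i, |y i|
      have hc : ∀ i, 0 < y i + c := fun i => by
        have h4 : |y i| ≤ ∑ j, |y j| :=
          Finset.single_le_sum (f := fun j => |y j|) (fun j _ => abs_nonneg _) (Finset.mem_univ i)
        have h5 := neg_abs_le (y i)
        simp only [c]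
        linarith
      let w' : ℝ := (1 - α) * ∑ i, (y i + c) ^ (-(α / (1 - α))) * traceForm σ (P i) - Q
      refine ⟨⟨(c • 1 + (1 / 2 : ℝ) • (τᴴ - τ), w' - w), (2 * c) • 1, ?_⟩, ?_⟩
      · rw [Matrix.smul_kronecker, Matrix.one_kronecker_one]
        simp only [conjTranspose_add, conjTranspose_smul, conjTranspose_sub, conjTranspose_one,
          conjTranspose_conjTranspose, star_trivial]
        module
      · have hmem := mem_povmCone_of_isPOVM (Q := Q) (s := α / (1 - α)) (c := 1 - α) (σ := σ) hP hc
          (le_refl w')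
        convert hmem using 1
        refine Prod.ext ?_ (by simp)
        simp_rw [add_smul]
        rw [Finset.sum_add_distrib, ← hτP, ← Finset.smul_sum, hP.2]
        simp only [Prod.fst_add]
        module)
  obtain ⟨ρ, hρ, hρg⟩ := exists_traceForm_eq (α⁻¹ • g.comp (LinearMap.inl ℝ _ ℝ))
  have hρg' : ∀ τ : Matrix (ιA × ιR) (ιA × ιR) ℂ, τ.IsHermitian →
      α * traceForm ρ τ = g (τ, 0) := by
    intro τ hτ
    rw [hρg τ hτ]
    simp [hα0.ne']
  have hgp : ∀ z ∈ p, g z = L z := fun z hz => hgL ⟨z, hz⟩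
  refine ⟨ρ, hρ, ?_, fun m M t hM ht => ?_⟩
  · have hD : (ptraceR ρ - ρA).IsHermitian := (isHermitian_ptraceR hρ).sub hρA.isHermitian
    have hX : ∀ X : Matrix ιA ιA ℂ, X.IsHermitian → traceForm (ptraceR ρ) X = traceForm ρA X := by
      intro X hX
      have hXh : (X ⊗ₖ (1 : Matrix ιR ιR ℂ)).IsHermitian := by
        rw [Matrix.IsHermitian, conjTranspose_kronecker, conjTranspose_one, hX.eq]
      have h6 := hρg' _ hXh
      rw [hgp _ ⟨X + X, by rw [hXh.eq, Matrix.add_kronecker]⟩, hL, add_zero,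
        traceForm_kronecker_one, traceForm_kronecker_one, hρ₀] at h6
      exact mul_left_cancel₀ hα0.ne' h6
    have h7 : traceForm (ptraceR ρ - ρA) (ptraceR ρ - ρA) = 0 := by
      have h8 : ∀ X, traceForm (ptraceR ρ - ρA) X = traceForm (ptraceR ρ) X - traceForm ρA X := by
        intro X
        simp [traceForm_apply, Matrix.sub_mul]
      rw [h8, hX _ hD, sub_self]
    rw [traceForm_apply] at h7
    nth_rw 1 [← hD.eq] at h7
    have h9 := (Matrix.posSemidef_conjTranspose_mul_self (ptraceR ρ - ρA)).trace_nonneg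
    have h10 := Matrix.trace_conjTranspose_mul_self_eq_zero_iff.mp
      (Complex.ext h7 (Complex.le_def.mp h9).2.symm)
    exact sub_eq_zero.mp h10
  · rw [hρg' _ (isHermitian_sum_smul hM.1 t)]
    set w := (1 - α) * ∑ x, t x ^ (-(α / (1 - α))) * traceForm σ (M x) - Q with hw
    have h11 := hgK _ (mem_povmCone_of_isPOVM (Q := Q) (s := α / (1 - α)) (c := 1 - α) (σ := σ)
      hM ht (le_refl _))
    have h12 : g ((0 : Matrix (ιA × ιR) (ιA × ιR) ℂ), w) = w := by
      rw [hgp _ ⟨0, by simp⟩, hL]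
      simp
    have h13 : ((∑ x, t x • M x, w) : Matrix (ιA × ιR) (ιA × ιR) ℂ × ℝ)
        = (∑ x, t x • M x, 0) + (0, w) := by simp
    rw [← hw, h13, map_add, h12, hw] at h11
    linarith

/-- A Hermitian matrix satisfying the variational lower bound is positive semidefinite. -/
lemma posSemidef_of_variational {n : Type*} [Fintype n] [DecidableEq n] {α s Q : ℝ} (hα0 : 0 < α)
    (hα1 : α < 1) (hs : 0 < s) (hQ : 0 ≤ Q) {ρ σ : Matrix n n ℂ} (hρ : ρ.IsHermitian)
    (hσ : σ.PosSemidef)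
    (h : ∀ (m : ℕ) (M : Fin m → Matrix n n ℂ) (t : Fin m → ℝ), IsPOVM M → (∀ x, 0 < t x) →
      Q ≤ α * traceForm ρ (∑ x, t x • M x) + (1 - α) * ∑ x, t x ^ (-s) * traceForm σ (M x)) :
    ρ.PosSemidef := by
  have h1 : 0 < 1 - α := by linarith
  have hpos : ∀ (m : ℕ) (M : Fin m → Matrix n n ℂ) (t : Fin m → ℝ), IsPOVM M → (∀ x, 0 < t x) →
      0 ≤ traceForm ρ (∑ x, t x • M x) := by
    intro m M t hM ht
    by_contra! hneg
    set f := traceForm ρ (∑ x, t x • M x) with hf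
    set K := (1 - α) * ∑ x, t x ^ (-s) * traceForm σ (M x) with hK
    have hK0 : 0 ≤ K := mul_nonneg h1.le (Finset.sum_nonneg fun x _ =>
      mul_nonneg (Real.rpow_nonneg (ht x).le _) (traceForm_nonneg hσ (hM.1 x)))
    have haf : 0 < α * -f := mul_pos hα0 (neg_pos.mpr hneg)
    have hKf : 0 ≤ K / (α * -f) := by positivity
    let l : ℝ := 1 + K / (α * -f)
    have hl : 1 ≤ l := by simp only [l]; linarith
    have hl0 : 0 < l := by linarith
    have h2 := h m M (fun x => l * t x) hM fun x => mul_pos hl0 (ht x)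
    have h3 : traceForm ρ (∑ x, (l * t x) • M x) = l * f := by
      simp_rw [mul_smul]
      rw [← Finset.smul_sum, map_smul, smul_eq_mul]
    have h4 : (1 - α) * ∑ x, (l * t x) ^ (-s) * traceForm σ (M x) ≤ K := by
      refine mul_le_mul_of_nonneg_left (Finset.sum_le_sum fun x _ => ?_) h1.le
      refine mul_le_mul_of_nonneg_right ?_ (traceForm_nonneg hσ (hM.1 x))
      exact Real.rpow_le_rpow_of_nonpos (ht x) (le_mul_of_one_le_left (ht x).le hl) (by linarith)
    have h5 : l * (α * -f) = α * -f + K := by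
      simp only [l]
      rw [add_mul, one_mul, div_mul_cancel₀ _ haf.ne']
    rw [h3] at h2
    nlinarith
  refine posSemidef_of_traceForm_nonneg hρ fun τ hτ => ?_
  obtain ⟨m, P, y, hP, -, -, hy, hτP⟩ := hτ.isHermitian.exists_spectral_fin
  have hy0 : ∀ i, 0 ≤ y i := fun i => by
    obtain ⟨k, hk⟩ := hy i
    rw [hk]
    exact hτ.eigenvalues_nonneg k
  have hε : ∀ ε : ℝ, 0 < ε → 0 ≤ traceForm ρ τ + ε * traceForm ρ 1 := by
    intro ε hε
    have h2 := hpos m P (fun i => y i + ε) hP fun i => add_pos_of_nonneg_of_pos (hy0 i) hε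
    simp_rw [add_smul] at h2
    rwa [Finset.sum_add_distrib, ← hτP, ← Finset.smul_sum, hP.2, map_add, map_smul,
      smul_eq_mul] at h2
  have hlim : Filter.Tendsto (fun ε : ℝ => traceForm ρ τ + ε * traceForm ρ 1)
      (nhdsWithin 0 (Set.Ioi 0)) (nhds (traceForm ρ τ + 0 * traceForm ρ 1)) :=
    tendsto_nhdsWithin_of_tendsto_nhds (Continuous.tendsto (by fun_prop) 0)
  rw [zero_mul, add_zero] at hlim
  exact ge_of_tendsto hlim (Filter.eventually_of_mem self_mem_nhdsWithin hε)

/-- The variational lower bound implies the lower bound for every POVM. -/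
lemma le_sum_renyiTerm_of_variational {n : Type*} [Fintype n] [DecidableEq n] {α Q : ℝ}
    (hα0 : 0 < α) (hα1 : α < 1) {ρ σ : Matrix n n ℂ} (hρ : ρ.PosSemidef) (hσ : σ.PosSemidef)
    {m : ℕ} {M : Fin m → Matrix n n ℂ} (hM : IsPOVM M)
    (h : ∀ t : Fin m → ℝ, (∀ x, 0 < t x) → Q ≤ α * traceForm ρ (∑ x, t x • M x)
      + (1 - α) * ∑ x, t x ^ (-(α / (1 - α))) * traceForm σ (M x)) :
    Q ≤ ∑ x, renyiTerm α (traceForm ρ (M x)) (traceForm σ (M x)) := by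
  refine le_of_forall_pos_le_add fun ε hε => ?_
  have hε' : 0 < ε / (m + 1) := by positivity
  choose t ht hle using fun x => exists_le_renyiTerm_add hα0 hα1 (traceForm_nonneg hρ (hM.1 x))
    (traceForm_nonneg hσ (hM.1 x)) hε'
  refine (h t ht).trans ?_
  rw [map_sum, Finset.mul_sum, Finset.mul_sum, ← Finset.sum_add_distrib]
  simp only [map_smul, smul_eq_mul]
  refine (Finset.sum_le_sum fun x _ => hle x).trans ?_
  rw [Finset.sum_add_distrib]
  gcongr
  rw [Finset.sum_const, Finset.card_univ, Fintype.card_fin, nsmul_eq_mul, mul_div_assoc',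
    div_le_iff₀ (by positivity)]
  nlinarith

lemma renyiTerm_zero_left (p q : ℝ) : renyiTerm 0 p q = if p = 0 then 0 else q := by
  unfold renyiTerm
  by_cases hp : p = 0 <;> by_cases hq : q = 0 <;> simp [hp, hq]

/-- For order zero, the extension by the maximally mixed state is optimal. -/
lemma le_sum_renyiTerm_zero_kronecker_uniform [Nonempty ιR] {Q : ℝ} {ρA : Matrix ιA ιA ℂ}
    (hρA : ρA.PosSemidef) {σ : Matrix (ιA × ιR) (ιA × ιR) ℂ} (hσ : σ.PosSemidef)
    (hQ : ∀ (m : ℕ) (M : Fin m → Matrix ιA ιA ℂ), IsPOVM M →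
      Q ≤ ∑ x, renyiTerm 0 (traceForm ρA (M x)) (traceForm (ptraceR σ) (M x)))
    {J : Type*} [Fintype J] {M : J → Matrix (ιA × ιR) (ιA × ιR) ℂ} (hM : IsPOVM M) :
    Q ≤ ∑ x, renyiTerm 0
      (traceForm (ρA ⊗ₖ ((Fintype.card ιR : ℝ)⁻¹ • (1 : Matrix ιR ιR ℂ))) (M x))
      (traceForm σ (M x)) := by
  set ρ := ρA ⊗ₖ ((Fintype.card ιR : ℝ)⁻¹ • (1 : Matrix ιR ιR ℂ)) with hρdef
  have hρ : ρ.PosSemidef := posSemidef_kronecker_uniform hρA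
  have hσA := posSemidef_ptraceR hσ
  obtain ⟨m, P, y, hP, hP1, hP2, -, hρP⟩ := hρA.isHermitian.exists_spectral_fin
  let S : Matrix ιA ιA ℂ := ∑ i, ((y i)⁻¹ * y i) • P i
  have hS : (∑ i, (y i)⁻¹ • P i) * ρA = S := by
    rw [hρP, sum_smul_mul_sum_smul_of_orthogonal hP1 hP2]
  have hSS : S * S = S := by
    simp only [S]
    rw [sum_smul_mul_sum_smul_of_orthogonal hP1 hP2]
    refine Finset.sum_congr rfl fun i _ => ?_
    congr 1
    by_cases h : y i = 0
    · simp [h]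
    · simp [inv_mul_cancel₀ h]
  let T : Matrix (ιA × ιR) (ιA × ιR) ℂ := S ⊗ₖ (1 : Matrix ιR ιR ℂ)
  have hTT : T * T = T := by
    simp only [T]
    rw [← Matrix.mul_kronecker_mul, hSS, Matrix.mul_one]
  have hTh : Tᴴ = T := by
    simp only [T]
    rw [conjTranspose_kronecker, conjTranspose_one, (isHermitian_sum_smul hP.1 _).eq]
  have hT : (∑ i, (y i)⁻¹ • P i) ⊗ₖ ((Fintype.card ιR : ℝ) • (1 : Matrix ιR ιR ℂ)) * ρ = T := by
    rw [hρdef, ← Matrix.mul_kronecker_mul, hS, Matrix.smul_mul, Matrix.one_mul, smul_smul,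
      mul_inv_cancel₀ (by positivity), one_smul]
  classical
  let N := ∑ x, if traceForm ρ (M x) = 0 then 0 else M x
  have hN : N.PosSemidef := posSemidef_sum _ fun x _ => by
    split_ifs
    exacts [Matrix.PosSemidef.zero, hM.1 x]
  have hTN : T * N = T := by
    have h1 : ∀ x, T * (if traceForm ρ (M x) = 0 then 0 else M x) = T * M x := by
      intro x
      split_ifs with h
      · rw [Matrix.mul_zero, ← hT, Matrix.mul_assoc, mul_eq_zero_of_traceForm_eq_zero hρ (hM.1 x) h,
          Matrix.mul_zero]
      · rfl
    simp only [N]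
    rw [Finset.mul_sum, Finset.sum_congr rfl fun x _ => h1 x, ← Finset.mul_sum, hM.2,
      Matrix.mul_one]
  have hNT : N * T = T := by
    have h := congrArg conjTranspose hTN
    rwa [conjTranspose_mul, hTh, hN.isHermitian.eq] at h
  have hpos : (N - T).PosSemidef := by
    have h := hN.conjTranspose_mul_mul_same (1 - T)
    rw [conjTranspose_sub, hTh, conjTranspose_one, Matrix.sub_mul, Matrix.one_mul, hTN,
      Matrix.mul_sub, Matrix.mul_one, Matrix.sub_mul, hNT, hTT, sub_self, sub_zero] at h
    exact h
  have hle := traceForm_nonneg hσ hpos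
  rw [map_sub, sub_nonneg] at hle
  refine (hQ m P hP).trans (le_trans ?_ (hle.trans (le_of_eq ?_)))
  · simp only [T, S]
    rw [traceForm_kronecker_one, map_sum]
    refine Finset.sum_le_sum fun i _ => ?_
    rw [renyiTerm_zero_left, map_smul, smul_eq_mul]
    have hq := traceForm_nonneg hσA (hP.1 i)
    by_cases hy : y i = 0
    · have h0 : ρA * P i = 0 := by
        rw [hρP, Finset.sum_mul]
        refine Finset.sum_eq_zero fun j _ => ?_
        by_cases hj : j = i
        · rw [hj, hy, zero_smul, Matrix.zero_mul]
        · rw [Matrix.smul_mul, hP2 j i hj, smul_zero]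
      simp [traceForm_apply ρA, h0, hy]
    · rw [inv_mul_cancel₀ hy, one_mul]
      split_ifs
      exacts [hq, le_rfl]
  · simp only [N]
    rw [map_sum]
    refine Finset.sum_congr rfl fun x _ => ?_
    rw [renyiTerm_zero_left]
    split_ifs
    exacts [map_zero _, rfl]

/-- Any lower bound on the classical Rényi sums of `ρA` against `tr_R σ` is a lower bound for a
suitable extension of `ρA` against `σ`. -/
lemma exists_extension_le_sum_renyiTerm [Nonempty ιR] {α Q : ℝ} (hα0 : 0 ≤ α) (hα : α ≤ 1 / 2)
    (hQ0 : 0 ≤ Q) {ρA : Matrix ιA ιA ℂ} (hρA : ρA.PosSemidef)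
    {σ : Matrix (ιA × ιR) (ιA × ιR) ℂ} (hσ : σ.PosSemidef)
    (hQ : ∀ (m : ℕ) (M : Fin m → Matrix ιA ιA ℂ), IsPOVM M →
      Q ≤ ∑ x, renyiTerm α (traceForm ρA (M x)) (traceForm (ptraceR σ) (M x))) :
    ∃ ρ : Matrix (ιA × ιR) (ιA × ιR) ℂ, (ρ.PosSemidef ∧ ptraceR ρ = ρA) ∧
      ∀ (m : ℕ) (M : Fin m → Matrix (ιA × ιR) (ιA × ιR) ℂ), IsPOVM M →
        Q ≤ ∑ x, renyiTerm α (traceForm ρ (M x)) (traceForm σ (M x)) := by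
  rcases hα0.eq_or_lt with rfl | hα0
  · exact ⟨_, ⟨posSemidef_kronecker_uniform hρA, ptraceR_kronecker_uniform ρA⟩,
      fun m M hM => le_sum_renyiTerm_zero_kronecker_uniform hρA hσ hQ hM⟩
  · have hα1 : α < 1 := by linarith
    obtain ⟨ρ, hρ, hρA', hvar⟩ := exists_extension_variational hα0 hα hρA hσ hQ
    have hρ' := posSemidef_of_variational hα0 hα1 (div_pos hα0 (by linarith)) hQ0 hρ hσ hvar
    exact ⟨ρ, ⟨hρ', hρA'⟩, fun m M hM =>
      le_sum_renyiTerm_of_variational hα0 hα1 hρ' hσ hM fun t ht => hvar m M t hM ht⟩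

end MainLemmas

section MeasuredDivergence

lemma renyiQ_eq_coe {α p q : ℝ} (hα : α < 1) : renyiQ α p q = (renyiTerm α p q : EReal) := by
  unfold renyiQ renyiTerm
  by_cases hp : p = 0 <;> by_cases hq : q = 0 <;> simp [hp, hq, hα]

/-- The classical Rényi divergence below order one as a function of the Rényi sum. -/
lemma classRenyi_eq {α : ℝ} (hα : α < 1) {m : ℕ} (p q : Fin m → ℝ) :
    classRenyi α p q = (((α - 1)⁻¹ : ℝ) : EReal)
      * erealLog ((∑ x, renyiTerm α (p x) (q x) : ℝ) : EReal) := by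
  unfold classRenyi
  rw [if_neg hα.ne, Finset.sum_congr rfl fun x _ => renyiQ_eq_coe hα]
  congr 2
  exact (map_sum (⟨⟨((↑) : ℝ → EReal), EReal.coe_zero⟩, EReal.coe_add⟩ : ℝ →+ EReal) _ _).symm

lemma erealLog_coe_of_pos {r : ℝ} (hr : 0 < r) : erealLog (r : EReal) = (Real.log r : EReal) := by
  unfold erealLog
  rw [if_neg (by simpa using hr), if_neg (EReal.coe_ne_top r), EReal.toReal_coe]

lemma erealLog_coe_of_nonpos {r : ℝ} (hr : r ≤ 0) : erealLog (r : EReal) = ⊥ := by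
  unfold erealLog
  rw [if_pos (by simpa using hr)]

/-- A real upper bound on the scaled logarithm of `r` is a positive lower bound on `r`. -/
lemma inv_mul_erealLog_le_coe_iff {α c r : ℝ} (hα : α < 1) :
    (((α - 1)⁻¹ : ℝ) : EReal) * erealLog (r : EReal) ≤ (c : EReal)
      ↔ Real.exp ((α - 1) * c) ≤ r := by
  have h1 : α - 1 < 0 := by linarith
  rcases le_or_gt r 0 with hr | hr
  · rw [erealLog_coe_of_nonpos hr, EReal.coe_mul_bot_of_neg (inv_lt_zero.mpr h1)]
    simp only [top_le_iff, EReal.coe_ne_top, false_iff, not_le]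
    exact hr.trans_lt (Real.exp_pos _)
  · rw [erealLog_coe_of_pos hr, ← EReal.coe_mul, EReal.coe_le_coe_iff, ← Real.le_log_iff_exp_le hr,
      ← div_eq_inv_mul, div_le_iff_of_neg' h1]

lemma inv_mul_erealLog_ne_bot {α r : ℝ} (hα : α < 1) :
    (((α - 1)⁻¹ : ℝ) : EReal) * erealLog (r : EReal) ≠ ⊥ := by
  have h1 : α - 1 < 0 := by linarith
  rcases le_or_gt r 0 with hr | hr
  · rw [erealLog_coe_of_nonpos hr, EReal.coe_mul_bot_of_neg (inv_lt_zero.mpr h1)]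
    exact top_ne_bot
  · rw [erealLog_coe_of_pos hr, ← EReal.coe_mul]
    exact EReal.coe_ne_bot _

lemma measRenyi_le_iff {n : Type*} [Fintype n] [DecidableEq n] {α : ℝ} (hα : α < 1)
    {ρ σ : Matrix n n ℂ} {c : EReal} :
    measRenyi α ρ σ ≤ c ↔ ∀ (m : ℕ) (M : Fin m → Matrix n n ℂ), IsPOVM M →
      (((α - 1)⁻¹ : ℝ) : EReal)
        * erealLog ((∑ x, renyiTerm α (traceForm ρ (M x)) (traceForm σ (M x)) : ℝ) : EReal) ≤ c := by
  simp only [measRenyi, iSup_le_iff, classRenyi_eq hα]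
  rfl

lemma measRenyi_ne_bot {n : Type*} [Fintype n] [DecidableEq n] {α : ℝ} (hα : α < 1)
    (ρ σ : Matrix n n ℂ) : measRenyi α ρ σ ≠ ⊥ := by
  intro h
  have h1 := (measRenyi_le_iff hα).mp h.le 1 (fun _ => 1) ⟨fun _ => Matrix.PosSemidef.one, by simp⟩
  exact inv_mul_erealLog_ne_bot hα (le_bot_iff.mp h1)

variable {ιA ιR : Type*} [Fintype ιA] [DecidableEq ιA] [Fintype ιR] [DecidableEq ιR]

/-- Monotonicity of the measured Rényi divergence under the partial trace. -/
lemma measRenyi_ptraceR_le {α : ℝ} (hα : α < 1) (ρ σ : Matrix (ιA × ιR) (ιA × ιR) ℂ) :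
    measRenyi α (ptraceR ρ) (ptraceR σ) ≤ measRenyi α ρ σ := by
  refine (measRenyi_le_iff hα).mpr fun m M hM => ?_
  have h := (measRenyi_le_iff hα).mp (le_refl (measRenyi α ρ σ)) m _ hM.kronecker_one
  simpa only [traceForm_kronecker_one] using h

lemma exists_extension_measRenyi_le [Nonempty ιR] {α : ℝ} (hα0 : 0 ≤ α) (hα : α ≤ 1 / 2)
    {ρA : Matrix ιA ιA ℂ} (hρA : ρA.PosSemidef)
    {σ : Matrix (ιA × ιR) (ιA × ιR) ℂ} (hσ : σ.PosSemidef) :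
    ∃ ρ : Matrix (ιA × ιR) (ιA × ιR) ℂ, (ρ.PosSemidef ∧ ptraceR ρ = ρA) ∧
      measRenyi α ρ σ ≤ measRenyi α ρA (ptraceR σ) := by
  have hα1 : α < 1 := by linarith
  have hle := le_refl (measRenyi α ρA (ptraceR σ))
  rw [measRenyi_le_iff hα1] at hle
  have hbot := measRenyi_ne_bot hα1 ρA (ptraceR σ)
  generalize measRenyi α ρA (ptraceR σ) = c at hle hbot
  induction c with
  | bot => exact absurd rfl hbot
  | top => exact ⟨_, ⟨posSemidef_kronecker_uniform hρA, ptraceR_kronecker_uniform ρA⟩, le_top⟩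
  | coe c =>
    simp only [inv_mul_erealLog_le_coe_iff hα1] at hle
    obtain ⟨ρ, hρ, h⟩ :=
      exists_extension_le_sum_renyiTerm hα0 hα (Real.exp_pos _).le hρA hσ hle
    refine ⟨ρ, hρ, (measRenyi_le_iff hα1).mpr fun m M hM => ?_⟩
    rw [inv_mul_erealLog_le_coe_iff hα1]
    exact h m M hM

end MeasuredDivergence

/-- Uhlmann's theorem for measured Rényi divergences, `α ∈ [0, 1/2]`:
the infimum over extensions `ρ_{AR}` of `ρ_A` of `D_{M,α}(ρ_{AR}‖σ_{AR})`
equals `D_{M,α}(ρ_A‖σ_A)`, and the infimum is attained. -/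
theorem uhlmann_measured_renyi_first {ιA ιR : Type*} [Fintype ιA] [DecidableEq ιA]
    [Fintype ιR] [DecidableEq ιR] [Nonempty ιR]
    (α : ℝ) (hα0 : 0 ≤ α) (hα : α ≤ 1 / 2)
    (ρA : Matrix ιA ιA ℂ) (hρA : ρA.PosSemidef) (hρtr : ρA.trace = 1)
    (σAR : Matrix (ιA × ιR) (ιA × ιR) ℂ) (hσ : σAR.PosSemidef) :
    (⨅ (ρAR : Matrix (ιA × ιR) (ιA × ιR) ℂ)
        (_ : ρAR.PosSemidef ∧ ptraceR ρAR = ρA),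
        measRenyi α ρAR σAR) = measRenyi α ρA (ptraceR σAR) ∧
    ∃ ρAR : Matrix (ιA × ιR) (ιA × ιR) ℂ,
      (ρAR.PosSemidef ∧ ptraceR ρAR = ρA) ∧
      measRenyi α ρAR σAR = measRenyi α ρA (ptraceR σAR) := by
  obtain ⟨ρ, hρ, hle⟩ := exists_extension_measRenyi_le hα0 hα hρA hσ
  have hge : ∀ ρAR : Matrix (ιA × ιR) (ιA × ιR) ℂ, ρAR.PosSemidef ∧ ptraceR ρAR = ρA →
      measRenyi α ρA (ptraceR σAR) ≤ measRenyi α ρAR σAR := by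
    rintro ρAR ⟨-, rfl⟩
    exact measRenyi_ptraceR_le (by linarith) ρAR σAR
  exact ⟨le_antisymm ((iInf₂_le ρ hρ).trans hle) (le_iInf₂ hge), ρ, hρ, le_antisymm hle (hge ρ hρ)⟩

end
end

section
/- Let ρ_{AR} be a density operator on A ⊗ R and σ_A positive semidefinite on A, with α ∈ [1/2, ∞). Then inf over positive semidefinite σ_{AR} with tr_R σ_{AR} = σ_A of D_{M,α}(ρ_{AR}‖σ_{AR}) = D_{M,α}(ρ_A‖σ_A), where ρ_A = tr_R ρ_{AR}, and the infimum is attained. -/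
open Matrix
open scoped ComplexOrder

noncomputable section

namespace MeasuredRenyi

open MeasureTheory Set Filter Topology
open scoped Kronecker

/-- The deformed logarithm `(w ^ s - 1) / s`, equal to `log w` at `s = 0`. -/
def deformedLog (s w : ℝ) : ℝ := if s = 0 then Real.log w else (w ^ s - 1) / s

/-- The first divided difference of `deformedLog s`, with its derivative on the diagonal. -/
def divDiff (s a b : ℝ) : ℝ :=
  if a = b then a ^ (s - 1) else (deformedLog s a - deformedLog s b) / (a - b)

lemma hasDerivAt_deformedLog (s : ℝ) {a : ℝ} (ha : 0 < a) :
    HasDerivAt (deformedLog s) (a ^ (s - 1)) a := by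
  rcases eq_or_ne s 0 with rfl | hs
  · have : deformedLog 0 = Real.log := by ext; simp [deformedLog]
    rw [this, zero_sub, Real.rpow_neg_one]
    exact Real.hasDerivAt_log ha.ne'
  · have : deformedLog s = fun w => (w ^ s - 1) / s := by ext; simp [deformedLog, hs]
    rw [this]
    have h := ((Real.hasDerivAt_rpow_const (p := s) (Or.inl ha.ne')).sub_const 1).div_const s
    exact h.congr_deriv (by field_simp)

lemma deformedLog_sub (s a b : ℝ) :
    deformedLog s a - deformedLog s b = (a - b) * divDiff s a b := by
  unfold divDiff
  split_ifs with h
  · simp [h]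
  · field_simp [sub_ne_zero.2 h]

lemma tendsto_divDiff (s : ℝ) {a : ℝ} (ha : 0 < a) :
    Tendsto (fun b => divDiff s a b) (𝓝[≠] a) (𝓝 (divDiff s a a)) := by
  have h := hasDerivAt_iff_tendsto_slope.1 (hasDerivAt_deformedLog s ha)
  have e : divDiff s a a = a ^ (s - 1) := by simp [divDiff]
  rw [e]
  refine h.congr' ?_
  filter_upwards [self_mem_nhdsWithin] with b hb
  have hb' : a ≠ b := fun h => hb h.symm
  rw [slope_def_field, divDiff, if_neg hb', ← neg_sub, ← neg_sub a b, neg_div_neg_eq]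

/-- Off the diagonal, the divided differences of a power are integrals of a positive kernel. -/
lemma exists_divDiff_eq_integral_of_ne {s : ℝ} (hs : s ∈ Ioo (-1) 1) (hs0 : s ≠ 0) :
    ∃ (μ : Measure ℝ) (k : ℝ → ℝ), (∀ t, 0 < t → 0 ≤ k t) ∧
      ∀ a b, 0 < a → 0 < b → a ≠ b →
        IntegrableOn (fun t => k t / ((a + t) * (b + t))) (Ioi 0) μ ∧
        divDiff s a b = ∫ t in Ioi 0, k t / ((a + t) * (b + t)) ∂μ := by
  rcases lt_or_gt_of_ne hs0 with hneg | hpos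
  · obtain ⟨μ, hμ⟩ := Real.exists_measure_rpow_eq_integral_rpowIntegrand₀₁
      (p := s + 1) ⟨by linarith [hs.1], by linarith⟩
    refine ⟨μ, fun t => t ^ (s + 1) / t / (-s), fun t ht => ?_, fun a b ha hb hab => ?_⟩
    · have : 0 < -s := by linarith
      positivity
    have hfun : EqOn (fun t => t ^ (s + 1) / t / (-s) / ((a + t) * (b + t)))
        (fun t => (Real.rpowIntegrand₀₁ (s + 1) t a / a - Real.rpowIntegrand₀₁ (s + 1) t b / b)
          * (s * (a - b))⁻¹) (Ioi 0) := by
      intro t (ht : 0 < t)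
      have h1 : a - b ≠ 0 := sub_ne_zero.2 hab
      have h2 : a + t ≠ 0 := by positivity
      have h3 : b + t ≠ 0 := by positivity
      have h4 : t + a ≠ 0 := by positivity
      have h5 : t + b ≠ 0 := by positivity
      simp only [Real.rpowIntegrand₀₁]
      generalize t ^ (s + 1) = z
      field_simp
      ring
    obtain ⟨ia, ea⟩ := hμ a ha.le
    obtain ⟨ib, eb⟩ := hμ b hb.le
    refine ⟨?_, ?_⟩
    · rw [integrableOn_congr_fun hfun measurableSet_Ioi]
      exact ((ia.div_const a).sub (ib.div_const b)).mul_const _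
    · rw [setIntegral_congr_fun measurableSet_Ioi hfun, integral_mul_const,
        integral_sub (ia.div_const a) (ib.div_const b), integral_div, integral_div, ← ea, ← eb,
        divDiff, if_neg hab, deformedLog, deformedLog, if_neg hs0, if_neg hs0,
        Real.rpow_add_one ha.ne', Real.rpow_add_one hb.ne']
      have h1 : a - b ≠ 0 := sub_ne_zero.2 hab
      field_simp
      ring
  · obtain ⟨μ, hμ⟩ := Real.exists_measure_rpow_eq_integral_rpowIntegrand₀₁
      (p := s) ⟨hpos, hs.2⟩
    refine ⟨μ, fun t => t ^ s / s, fun t ht => by positivity, fun a b ha hb hab => ?_⟩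
    have hfun : EqOn (fun t => t ^ s / s / ((a + t) * (b + t)))
        (fun t => (Real.rpowIntegrand₀₁ s t a - Real.rpowIntegrand₀₁ s t b)
          * (s * (a - b))⁻¹) (Ioi 0) := by
      intro t (ht : 0 < t)
      have h1 : a - b ≠ 0 := sub_ne_zero.2 hab
      have h2 : a + t ≠ 0 := by positivity
      have h3 : b + t ≠ 0 := by positivity
      have h4 : t + a ≠ 0 := by positivity
      have h5 : t + b ≠ 0 := by positivity
      simp only [Real.rpowIntegrand₀₁]
      generalize t ^ s = z
      field_simp
      ring
    obtain ⟨ia, ea⟩ := hμ a ha.le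
    obtain ⟨ib, eb⟩ := hμ b hb.le
    refine ⟨?_, ?_⟩
    · rw [integrableOn_congr_fun hfun measurableSet_Ioi]
      exact (ia.sub ib).mul_const _
    · rw [setIntegral_congr_fun measurableSet_Ioi hfun, integral_mul_const,
        integral_sub ia ib, ← ea, ← eb,
        divDiff, if_neg hab, deformedLog, deformedLog, if_neg hs0, if_neg hs0]
      have h1 : a - b ≠ 0 := sub_ne_zero.2 hab
      field_simp
      ring

/-- The divided differences of a power are integrals of a positive kernel. -/
lemma exists_divDiff_eq_integral {s : ℝ} (hs : s ∈ Ioo (-1) 1) (hs0 : s ≠ 0) :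
    ∃ (μ : Measure ℝ) (k : ℝ → ℝ), (∀ t, 0 < t → 0 ≤ k t) ∧
      ∀ a b, 0 < a → 0 < b →
        IntegrableOn (fun t => k t / ((a + t) * (b + t))) (Ioi 0) μ ∧
        divDiff s a b = ∫ t in Ioi 0, k t / ((a + t) * (b + t)) ∂μ := by
  obtain ⟨μ, k, hk, h⟩ := exists_divDiff_eq_integral_of_ne hs hs0
  refine ⟨μ, k, hk, fun a b ha hb => ?_⟩
  rcases ne_or_eq a b with hab | rfl
  · exact h a b ha hb hab
  have hdom : ∀ b t, a / 2 < b → 0 < t →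
      ‖k t / ((a + t) * (b + t))‖ ≤ k t / ((a + t) * (a / 2 + t)) := by
    intro b t hb ht
    have hb0 : 0 < b := by linarith
    have := hk t ht
    rw [Real.norm_of_nonneg (by positivity)]
    gcongr
  have hI : IntegrableOn (fun t => k t / ((a + t) * (a / 2 + t))) (Ioi 0) μ :=
    (h a (a / 2) ha (by positivity) (by linarith)).1
  have hlim : ∀ᵐ t ∂μ.restrict (Ioi 0), Tendsto (fun b => k t / ((a + t) * (b + t))) (𝓝[≠] a)
      (𝓝 (k t / ((a + t) * (a + t)))) := by
    refine ae_restrict_of_forall_mem measurableSet_Ioi fun t (ht : 0 < t) => ?_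
    have : ContinuousAt (fun b => k t / ((a + t) * (b + t))) a := by
      fun_prop (disch := positivity)
    exact this.tendsto.mono_left nhdsWithin_le_nhds
  have hev : ∀ᶠ b in 𝓝[≠] a, a / 2 < b ∧ a ≠ b := by
    filter_upwards [self_mem_nhdsWithin,
      nhdsWithin_le_nhds (Ioi_mem_nhds (show a / 2 < a by linarith))] with b h1 h2
    exact ⟨h2, fun h => h1 h.symm⟩
  have hmeas : ∀ᶠ b in 𝓝[≠] a, AEStronglyMeasurable (fun t => k t / ((a + t) * (b + t)))
      (μ.restrict (Ioi 0)) := by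
    filter_upwards [hev] with b hb
    exact (h a b ha (by linarith) hb.2).1.aestronglyMeasurable
  refine ⟨?_, ?_⟩
  · refine Integrable.mono' hI (aestronglyMeasurable_of_tendsto_ae (𝓝[≠] a) (f := fun b t =>
      if a / 2 < b ∧ a ≠ b then k t / ((a + t) * (b + t)) else 0) (fun b => ?_) ?_)
      (ae_restrict_of_forall_mem measurableSet_Ioi fun t ht => hdom a t (by linarith) ht)
    · split_ifs with hb
      · exact (h a b ha (by linarith) hb.2).1.aestronglyMeasurable
      · exact aestronglyMeasurable_const
    · filter_upwards [hlim] with t ht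
      refine ht.congr' ?_
      filter_upwards [hev] with b hb
      rw [if_pos hb]
  · refine tendsto_nhds_unique (tendsto_divDiff s ha) ?_
    refine (tendsto_integral_filter_of_dominated_convergence _ hmeas ?_ hI hlim).congr' ?_
    · filter_upwards [hev] with b hb
      exact ae_restrict_of_forall_mem measurableSet_Ioi fun t ht => hdom b t hb.1 ht
    · filter_upwards [hev] with b hb
      exact (h a b ha (by linarith) hb.2).2.symm

lemma isClosed_posSemidef {ι 𝕜 : Type*} [Fintype ι] [RCLike 𝕜] :
    IsClosed {M : Matrix ι ι 𝕜 | M.PosSemidef} := by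
  simp only [Matrix.posSemidef_iff_dotProduct_mulVec, Matrix.IsHermitian, ofPred_and, ofPred_forall]
  refine IsClosed.inter (isClosed_eq (by fun_prop) (by fun_prop))
    (isClosed_iInter fun x => ?_)
  exact isClosed_le continuous_const (by fun_prop)

lemma continuous_deformedLog_exponent {a : ℝ} (ha : 0 < a) :
    Continuous (fun s => deformedLog s a) := by
  refine continuous_iff_continuousAt.2 fun s => ?_
  rcases eq_or_ne s 0 with rfl | hs
  · have h : HasDerivAt (fun s : ℝ => a ^ s) (Real.log a) 0 := by
      simpa using (Real.hasStrictDerivAt_const_rpow ha 0).hasDerivAt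
    rw [continuousAt_iff_punctured_nhds]
    have h0 : deformedLog 0 a = Real.log a := by simp [deformedLog]
    rw [h0]
    refine (hasDerivAt_iff_tendsto_slope.1 h).congr' ?_
    filter_upwards [self_mem_nhdsWithin] with s hs
    have hs' : s ≠ 0 := hs
    simp [slope_def_field, deformedLog, hs']
  · have hc : ContinuousAt (fun s : ℝ => (a ^ s - 1) / s) s := by
      have : ContinuousAt (fun s : ℝ => a ^ s) s :=
        (Real.continuous_const_rpow ha.ne').continuousAt
      fun_prop (disch := assumption)
    refine hc.congr ?_
    filter_upwards [isOpen_ne.mem_nhds hs] with x hx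
    simp only [deformedLog, if_neg hx]

lemma continuous_divDiff_exponent {a b : ℝ} (ha : 0 < a) (hb : 0 < b) :
    Continuous (fun s => divDiff s a b) := by
  unfold divDiff
  split_ifs with h
  · exact (Real.continuous_const_rpow ha.ne').comp (by fun_prop)
  · exact ((continuous_deformedLog_exponent ha).sub
      (continuous_deformedLog_exponent hb)).div_const _

/-- A property closed in the exponent that holds on `(-1, 1)` away from `0` holds on `[-1, 1)`. -/
lemma mem_of_isClosed_of_exponent {S : Set ℝ} (hS : IsClosed S)
    (h : ∀ s ∈ Ioo (-1 : ℝ) 1, s ≠ 0 → s ∈ S) {s : ℝ} (hs : s ∈ Ico (-1 : ℝ) 1) : s ∈ S := by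
  refine hS.mem_of_frequently_of_tendsto (f := id) (b := 𝓝[>] s) ?_
    (tendsto_id.mono_left nhdsWithin_le_nhds)
  refine Eventually.frequently ?_
  have h1 : ∀ᶠ x in 𝓝[>] s, x < 1 := nhdsWithin_le_nhds (Iio_mem_nhds hs.2)
  have h2 : ∀ᶠ x in 𝓝[>] s, x ≠ 0 := by
    rcases eq_or_ne s 0 with rfl | h0
    · filter_upwards [self_mem_nhdsWithin] with x hx using ne_of_gt hx
    · exact nhdsWithin_le_nhds (isOpen_ne.mem_nhds h0)
  filter_upwards [self_mem_nhdsWithin, h1, h2] with x hx hx1 hx2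
  exact h x ⟨lt_of_le_of_lt hs.1 hx, hx1⟩ hx2

open scoped MatrixOrder in
lemma posSemidef_map_ofReal {ι : Type*} [Fintype ι] [DecidableEq ι] {A : Matrix ι ι ℝ}
    (hA : A.PosSemidef) : (A.map ((↑) : ℝ → ℂ)).PosSemidef := by
  obtain ⟨B, rfl⟩ := CStarAlgebra.nonneg_iff_eq_star_mul_self.mp hA.nonneg
  have : (star B * B).map ((↑) : ℝ → ℂ) = (B.map ((↑) : ℝ → ℂ))ᴴ * B.map ((↑) : ℝ → ℂ) := by
    ext i j
    simp [Matrix.mul_apply, star_eq_conjTranspose]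
  rw [this]
  exact Matrix.posSemidef_conjTranspose_mul_self _

/-- A matrix of integrals of products `u i t * u j t` is positive semidefinite. -/
lemma posSemidef_integral {ι X : Type*} [Fintype ι] [MeasurableSpace X] (μ : Measure X)
    (g : X → ℝ) (u : ι → X → ℝ) (hg : ∀ᵐ t ∂μ, 0 ≤ g t)
    (hI : ∀ i j, Integrable (fun t => g t * (u i t * u j t)) μ) :
    (Matrix.of fun i j => ∫ t, g t * (u i t * u j t) ∂μ).PosSemidef := by
  refine Matrix.PosSemidef.of_dotProduct_mulVec_nonneg ?_ fun x => ?_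
  · ext i j
    simp [mul_comm (u i _)]
  · have : star x ⬝ᵥ (Matrix.of fun i j => ∫ t, g t * (u i t * u j t) ∂μ) *ᵥ x =
        ∫ t, g t * (∑ i, x i * u i t) ^ 2 ∂μ := by
      simp only [dotProduct, mulVec, Matrix.of_apply, Pi.star_apply, star_trivial, sq,
        Finset.sum_mul_sum]
      simp only [Finset.mul_sum]
      rw [integral_finsetSum]
      · refine Finset.sum_congr rfl fun i _ => ?_
        rw [integral_finsetSum]
        · refine Finset.sum_congr rfl fun j _ => ?_
          rw [← integral_mul_const, ← integral_const_mul]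
          refine integral_congr_ae (Eventually.of_forall fun t => ?_)
          ring
        · intro j _
          refine ((hI i j).const_mul (x i * x j)).congr (.of_forall fun t => ?_)
          ring
      · intro i _
        refine integrable_finsetSum _ fun j _ => ?_
        refine ((hI i j).const_mul (x i * x j)).congr (.of_forall fun t => ?_)
        ring
    rw [this]
    refine integral_nonneg_of_ae ?_
    filter_upwards [hg] with t ht
    exact mul_nonneg ht (sq_nonneg _)

/-- The Loewner matrix of `deformedLog s` is positive semidefinite. -/
lemma posSemidef_divDiff {ι : Type*} [Fintype ι] {s : ℝ} (hs : s ∈ Ico (-1 : ℝ) 1)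
    (l : ι → ℝ) (hl : ∀ i, 0 < l i) :
    (Matrix.of fun i j => divDiff s (l i) (l j)).PosSemidef := by
  refine mem_of_isClosed_of_exponent
    (S := {s | (Matrix.of fun i j => divDiff s (l i) (l j)).PosSemidef}) ?_ ?_ hs
  · refine isClosed_posSemidef.preimage (continuous_matrix fun i j => ?_)
    exact continuous_divDiff_exponent (hl i) (hl j)
  · intro s hs hs0
    obtain ⟨μ, k, hk, h⟩ := exists_divDiff_eq_integral hs hs0
    have := posSemidef_integral (μ.restrict (Ioi 0)) k (fun i t => (l i + t)⁻¹)
      (ae_restrict_of_forall_mem measurableSet_Ioi hk) (fun i j => by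
        simpa only [← mul_inv, div_eq_mul_inv, IntegrableOn] using (h _ _ (hl i) (hl j)).1)
    refine (congrArg Matrix.PosSemidef ?_).mpr this
    ext i j
    rw [Matrix.of_apply, Matrix.of_apply, (h _ _ (hl i) (hl j)).2]
    simp only [← mul_inv, div_eq_mul_inv]

/-- The tangent defects of `deformedLog s` at the points `l i` form a positive semidefinite
matrix, which expresses operator concavity. -/
lemma posSemidef_tangentDefect {ι : Type*} [Fintype ι] {s : ℝ} (hs : s ∈ Ico (-1 : ℝ) 1)
    (l : ι → ℝ) (hl : ∀ i, 0 < l i) {w : ℝ} (hw : 0 < w) :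
    (Matrix.of fun i j => deformedLog s (l i) - deformedLog s w +
      (w - l i) * divDiff s (l i) (l j)).PosSemidef := by
  refine mem_of_isClosed_of_exponent
    (S := {s | (Matrix.of fun i j => deformedLog s (l i) - deformedLog s w +
      (w - l i) * divDiff s (l i) (l j)).PosSemidef}) ?_ ?_ hs
  · refine isClosed_posSemidef.preimage (continuous_matrix fun i j => ?_)
    exact ((continuous_deformedLog_exponent (hl i)).sub (continuous_deformedLog_exponent hw)).add
      (continuous_const.mul (continuous_divDiff_exponent (hl i) (hl j)))
  · intro s hs hs0
    obtain ⟨μ, k, hk, h⟩ := exists_divDiff_eq_integral hs hs0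
    have key : ∀ i j, EqOn
        (fun t => k t * (w + t)⁻¹ * ((w - l i) / (l i + t) * ((w - l j) / (l j + t))))
        (fun t => (w - l i) * (k t / ((l i + t) * (l j + t)) - k t / ((l i + t) * (w + t))))
        (Ioi 0) := by
      intro i j t (ht : 0 < t)
      have h1 : l i + t ≠ 0 := (add_pos (hl i) ht).ne'
      have h2 : l j + t ≠ 0 := (add_pos (hl j) ht).ne'
      have h3 : w + t ≠ 0 := (add_pos hw ht).ne'
      simp only
      field_simp
      ring
    have := posSemidef_integral (μ.restrict (Ioi 0)) (fun t => k t * (w + t)⁻¹)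
      (fun i t => (w - l i) / (l i + t))
      (ae_restrict_of_forall_mem measurableSet_Ioi fun t (ht : 0 < t) => by
        have := hk t ht
        positivity)
      (fun i j => by
        refine (integrableOn_congr_fun (key i j) measurableSet_Ioi).2 ?_
        exact ((h _ _ (hl i) (hl j)).1.sub (h _ _ (hl i) hw).1).const_mul _)
    refine (congrArg Matrix.PosSemidef ?_).mpr this
    ext i j
    rw [Matrix.of_apply, Matrix.of_apply, setIntegral_congr_fun measurableSet_Ioi (key i j),
      integral_const_mul,
      integral_sub (h _ _ (hl i) (hl j)).1 (h _ _ (hl i) hw).1, ← (h _ _ (hl i) (hl j)).2,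
      ← (h _ _ (hl i) hw).2, deformedLog_sub]
    ring

/-- Concavity of the deformed logarithm. -/
lemma deformedLog_le_tangent {s : ℝ} (hs : s ∈ Ico (-1 : ℝ) 1) {a w : ℝ} (ha : 0 < a)
    (hw : 0 < w) : deformedLog s w ≤ deformedLog s a + (w - a) * a ^ (s - 1) := by
  have h := (posSemidef_tangentDefect (ι := Unit) hs (fun _ => a) (fun _ => ha) hw).diag_nonneg
    (i := ())
  simp only [Matrix.of_apply, divDiff, if_true] at h
  linarith

lemma exponent_mem {α : ℝ} (hα : 1 / 2 ≤ α) : 1 - 1 / α ∈ Ico (-1 : ℝ) 1 := by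
  have h0 : 0 < α := by linarith
  have h1 : 1 / α ≤ 2 := by rw [div_le_iff₀ h0]; linarith
  have h2 : 0 < 1 / α := by positivity
  exact ⟨by linarith, by linarith⟩

/-- The value of `sup_w (p * deformedLog (1 - 1 / α) w - q * w)`. -/
def youngSup (α p q : ℝ) : ℝ :=
  if α = 1 then p * Real.log (p / q) - p else (p ^ α * q ^ (1 - α) - α * p) / (α - 1)

lemma youngSup_eq {α : ℝ} (hα : 1 / 2 ≤ α) {p q : ℝ} (hp : 0 < p) (hq : 0 < q) :
    youngSup α p q = p * deformedLog (1 - 1 / α) ((p / q) ^ α) - q * (p / q) ^ α := by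
  have h0 : 0 < α := by linarith
  have hpq : 0 < p / q := by positivity
  unfold youngSup deformedLog
  split_ifs with h1 h2 h2
  · subst h1
    simp
    field_simp
  · subst h1
    simp at h2
  · exfalso
    apply h1
    field_simp at h2
    linarith
  · have e1 : ((p / q) ^ α) ^ (1 - 1 / α) = (p / q) ^ α * (q / p) := by
      rw [← Real.rpow_mul hpq.le]
      have : α * (1 - 1 / α) = α - 1 := by field_simp
      rw [this, Real.rpow_sub_one hpq.ne']
      field_simp
    have e2 : p ^ α * q ^ (1 - α) = (p / q) ^ α * q := by
      rw [Real.div_rpow hp.le hq.le, Real.rpow_sub hq, Real.rpow_one]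
      ring
    have h3 : α - 1 ≠ 0 := sub_ne_zero.2 h1
    rw [e1, e2]
    field_simp
    ring

lemma le_youngSup_of_pos {α : ℝ} (hα : 1 / 2 ≤ α) {p q w : ℝ} (hp : 0 < p) (hq : 0 < q)
    (hw : 0 < w) : p * deformedLog (1 - 1 / α) w - q * w ≤ youngSup α p q := by
  have h0 : 0 < α := by linarith
  have hpq : 0 < p / q := by positivity
  have ht := deformedLog_le_tangent (exponent_mem hα) (Real.rpow_pos_of_pos hpq α) hw
  have e : ((p / q) ^ α) ^ (1 - 1 / α - 1) = q / p := by
    rw [← Real.rpow_mul hpq.le]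
    have : α * (1 - 1 / α - 1) = -1 := by field_simp; ring
    rw [this, Real.rpow_neg_one, inv_div]
  rw [e] at ht
  rw [youngSup_eq hα hp hq]
  have h2 := mul_le_mul_of_nonneg_left ht hp.le
  have h3 : p * (deformedLog (1 - 1 / α) ((p / q) ^ α) + (w - (p / q) ^ α) * (q / p)) =
      p * deformedLog (1 - 1 / α) ((p / q) ^ α) + (w - (p / q) ^ α) * q := by
    field_simp
  linarith

lemma youngSup_zero_left {α : ℝ} (hα : 1 / 2 ≤ α) (q : ℝ) : youngSup α 0 q = 0 := by
  have h0 : α ≠ 0 := by linarith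
  unfold youngSup
  split_ifs <;> simp [Real.zero_rpow h0]

lemma exponent_neg {α : ℝ} (hα : 1 / 2 ≤ α) (h1 : α < 1) : 1 - 1 / α < 0 := by
  have h0 : 0 < α := by linarith
  rw [sub_neg, lt_div_iff₀ h0]
  linarith

lemma youngSup_sub_zero_right {α : ℝ} (hα : 1 / 2 ≤ α) (h1 : α < 1) (p w : ℝ) :
    youngSup α p 0 - p * deformedLog (1 - 1 / α) w = p * w ^ (1 - 1 / α) / (1 / α - 1) := by
  have h0 : 0 < α := by linarith
  have h2 : 1 - α ≠ 0 := by linarith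
  have h3 := (exponent_neg hα h1).ne
  have h4 : α - 1 ≠ 0 := by linarith
  have h5 : 1 / α - 1 ≠ 0 := by intro h; apply h3; linarith
  unfold youngSup deformedLog
  rw [if_neg h1.ne, if_neg h3, Real.zero_rpow h2]
  generalize w ^ (1 - 1 / α) = z
  have h6 : (1 - 1 / α) = -(1 / α - 1) := by ring
  rw [h6]
  have h7 : 1 / α - 1 = (1 - α) / α := by field_simp
  rw [h7]
  field_simp
  ring

lemma le_youngSup {α : ℝ} (hα : 1 / 2 ≤ α) {p q w : ℝ} (hp : 0 ≤ p) (hq : 0 ≤ q)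
    (hgood : p ≠ 0 → q = 0 → α < 1) (hw : 0 < w) :
    p * deformedLog (1 - 1 / α) w - q * w ≤ youngSup α p q := by
  rcases hp.eq_or_lt with rfl | hp
  · rw [youngSup_zero_left hα]
    have := mul_nonneg hq hw.le
    linarith
  rcases hq.eq_or_lt with rfl | hq
  · have h1 := hgood hp.ne' rfl
    have := youngSup_sub_zero_right hα h1 p w
    have h2 := exponent_neg hα h1
    have h3 : 0 ≤ p * w ^ (1 - 1 / α) / (1 / α - 1) :=
      div_nonneg (mul_nonneg hp.le (Real.rpow_nonneg hw.le _)) (by linarith)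
    linarith
  · exact le_youngSup_of_pos hα hp hq hw

lemma exists_youngSup_sub_le {α : ℝ} (hα : 1 / 2 ≤ α) {p q : ℝ} (hp : 0 ≤ p) (hq : 0 ≤ q)
    (hgood : p ≠ 0 → q = 0 → α < 1) {ε : ℝ} (hε : 0 < ε) :
    ∃ w, 0 < w ∧ youngSup α p q - ε ≤ p * deformedLog (1 - 1 / α) w - q * w := by
  rcases hp.eq_or_lt with rfl | hp
  · refine ⟨ε / (q + 1), by positivity, ?_⟩
    rw [youngSup_zero_left hα]
    have : q * (ε / (q + 1)) ≤ ε := by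
      rw [mul_div_assoc', div_le_iff₀ (by positivity)]
      nlinarith
    linarith
  rcases hq.eq_or_lt with rfl | hq
  · have h1 := hgood hp.ne' rfl
    have h2 := exponent_neg hα h1
    have ht : Tendsto (fun w : ℝ => p * w ^ (1 - 1 / α) / (1 / α - 1)) atTop (𝓝 0) := by
      have := tendsto_rpow_neg_atTop (y := 1 / α - 1) (by linarith)
      simpa using (this.const_mul p).div_const (1 / α - 1)
    obtain ⟨w, hw1, hw2⟩ := ((ht.eventually_lt_const hε).and (eventually_gt_atTop 0)).exists
    refine ⟨w, hw2, ?_⟩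
    have := youngSup_sub_zero_right hα h1 p w
    linarith
  · exact ⟨(p / q) ^ α, by positivity, by linarith [youngSup_eq hα hp hq]⟩

lemma tendsto_deformedLog_atTop {s : ℝ} (hs : 0 ≤ s) :
    Tendsto (deformedLog s) atTop atTop := by
  rcases hs.eq_or_lt with rfl | hs
  · have : deformedLog 0 = Real.log := by ext; simp [deformedLog]
    rw [this]
    exact Real.tendsto_log_atTop
  · have : deformedLog s = fun w => (w ^ s - 1) / s := by ext; simp [deformedLog, hs.ne']
    rw [this]
    exact (tendsto_atTop_add_const_right _ (-1) (tendsto_rpow_atTop hs)).atTop_div_const hs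

/-- The increasing reparametrisation that turns a divergence bound into a bound on the
variational objective. -/
def boundTransform (α d : ℝ) : ℝ :=
  if α = 1 then d - 1 else (Real.exp ((α - 1) * d) - α) / (α - 1)

lemma coe_sum_ereal {ι : Type*} (t : Finset ι) (f : ι → ℝ) :
    ((∑ x ∈ t, f x : ℝ) : EReal) = ∑ x ∈ t, (f x : EReal) := by
  classical
  induction t using Finset.induction_on with
  | empty => simp
  | insert a t ha ih => rw [Finset.sum_insert ha, Finset.sum_insert ha, EReal.coe_add, ih]

section Classical

variable {α : ℝ} {m : ℕ} {p q : Fin m → ℝ}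

lemma classRenyi_eq_top (hp : ∀ x, 0 ≤ p x) (hq : ∀ x, 0 ≤ q x)
    {y : Fin m} (hpy : p y ≠ 0) (hqy : q y = 0) (h1 : 1 ≤ α) : classRenyi α p q = ⊤ := by
  unfold classRenyi
  split_ifs with h
  · have hne : ∀ x, klQ (p x) (q x) ≠ ⊥ := by
      intro x
      unfold klQ
      split_ifs
      · simp
      · simp
      · exact EReal.coe_ne_bot _
    have hy : klQ (p y) (q y) = ⊤ := by simp [klQ, hpy, hqy]
    rw [← Finset.add_sum_erase _ _ (Finset.mem_univ y), hy]
    refine EReal.top_add_of_ne_bot ?_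
    refine Finset.sum_induction _ (fun z => z ≠ ⊥) (fun a b ha hb => ?_) (by simp)
      (fun x _ => hne x)
    rw [Ne, EReal.add_eq_bot_iff]
    tauto
  · have hne : ∀ x, 0 ≤ renyiQ α (p x) (q x) := by
      intro x
      unfold renyiQ
      split_ifs
      · simp
      · simp
      · simp
      · exact EReal.coe_nonneg.2
          (mul_nonneg (Real.rpow_nonneg (hp x) _) (Real.rpow_nonneg (hq x) _))
    have hy : renyiQ α (p y) (q y) = ⊤ := by simp [renyiQ, hpy, hqy, h1.not_gt]
    have hsum : ∑ x, renyiQ α (p x) (q x) = ⊤ := by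
      rw [eq_top_iff, ← hy]
      exact Finset.single_le_sum (fun x _ => hne x) (Finset.mem_univ y)
    have h2 : 0 < (α - 1)⁻¹ := inv_pos.2 (sub_pos.2 (lt_of_le_of_ne h1 (Ne.symm h)))
    rw [hsum]
    simp [erealLog, EReal.coe_mul_top_of_pos h2]

lemma classRenyi_one_eq (hgood : ∀ x, p x ≠ 0 → q x ≠ 0) :
    classRenyi 1 p q = ((∑ x, p x * Real.log (p x / q x) : ℝ) : EReal) := by
  unfold classRenyi
  rw [if_pos rfl, coe_sum_ereal]
  refine Finset.sum_congr rfl fun x _ => ?_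
  unfold klQ
  split_ifs with h1 h2
  · simp [h1]
  · exact absurd h2 (hgood x h1)
  · rfl

lemma classRenyi_eq_of_ne_one (hα : 1 / 2 ≤ α) (h1 : α ≠ 1)
    (hgood : ∀ x, p x ≠ 0 → q x = 0 → α < 1) :
    classRenyi α p q = (((α - 1)⁻¹ : ℝ) : EReal) *
      erealLog ((∑ x, p x ^ α * q x ^ (1 - α) : ℝ) : EReal) := by
  unfold classRenyi
  rw [if_neg h1, coe_sum_ereal]
  congr 2
  refine Finset.sum_congr rfl fun x _ => ?_
  have h0 : α ≠ 0 := by linarith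
  have h3 : 1 - α ≠ 0 := sub_ne_zero.2 h1.symm
  unfold renyiQ
  split_ifs with h4 h5 h6
  · simp [h4, Real.zero_rpow h0]
  · simp [h5, Real.zero_rpow h3]
  · exact absurd (hgood x h4 h5) h6
  · rfl

lemma classRenyi_le_iff_sum_youngSup_le (hα : 1 / 2 ≤ α) (hp : ∀ x, 0 ≤ p x)
    (hq : ∀ x, 0 ≤ q x) (hsum : ∑ x, p x = 1) (hgood : ∀ x, p x ≠ 0 → q x = 0 → α < 1) (d : ℝ) :
    classRenyi α p q ≤ d ↔ ∑ x, youngSup α (p x) (q x) ≤ boundTransform α d := by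
  rcases eq_or_ne α 1 with rfl | h1
  · rw [classRenyi_one_eq fun x h h' => lt_irrefl _ (hgood x h h')]
    simp [youngSup, boundTransform, Finset.sum_sub_distrib, hsum]
  rw [classRenyi_eq_of_ne_one hα h1 hgood]
  have hQ : 0 ≤ ∑ x, p x ^ α * q x ^ (1 - α) := Finset.sum_nonneg fun x _ =>
    mul_nonneg (Real.rpow_nonneg (hp x) _) (Real.rpow_nonneg (hq x) _)
  have e : ∑ x, youngSup α (p x) (q x) = (∑ x, p x ^ α * q x ^ (1 - α) - α) / (α - 1) := by
    simp only [youngSup, if_neg h1, ← Finset.sum_div, Finset.sum_sub_distrib, ← Finset.mul_sum,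
      hsum, mul_one]
  rw [e, boundTransform, if_neg h1]
  generalize ∑ x, p x ^ α * q x ^ (1 - α) = Q at hQ
  have hexp := Real.exp_pos ((α - 1) * d)
  rcases lt_or_gt_of_ne h1 with h | h
  · rw [div_le_div_right_of_neg (by linarith), sub_le_sub_iff_right]
    rcases hQ.eq_or_lt with rfl | hQ
    · have : (α - 1)⁻¹ < 0 := inv_neg''.2 (by linarith)
      simp [erealLog, EReal.coe_mul_bot_of_neg this, hexp]
    · have hQ' : ¬ ((Q : EReal) ≤ 0) := by simpa using hQ
      rw [erealLog, if_neg hQ', if_neg (EReal.coe_ne_top _), EReal.toReal_coe, ← EReal.coe_mul,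
        EReal.coe_le_coe_iff, ← Real.le_log_iff_exp_le hQ, mul_comm,
        ← div_eq_mul_inv, div_le_iff_of_neg (by linarith), mul_comm d]
  · rw [div_le_div_iff_of_pos_right (by linarith), sub_le_sub_iff_right]
    rcases hQ.eq_or_lt with rfl | hQ
    · have : 0 < (α - 1)⁻¹ := inv_pos.2 (by linarith)
      simp [erealLog, EReal.coe_mul_bot_of_pos this, hexp.le]
    · have hQ' : ¬ ((Q : EReal) ≤ 0) := by simpa using hQ
      rw [erealLog, if_neg hQ', if_neg (EReal.coe_ne_top _), EReal.toReal_coe, ← EReal.coe_mul,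
        EReal.coe_le_coe_iff, ← Real.log_le_iff_le_exp hQ, inv_mul_le_iff₀ (by linarith)]

/-- Variational characterisation of upper bounds on the classical Rényi divergence. -/
lemma classRenyi_le_iff (hα : 1 / 2 ≤ α) (hp : ∀ x, 0 ≤ p x)
    (hq : ∀ x, 0 ≤ q x) (hsum : ∑ x, p x = 1) (d : ℝ) :
    classRenyi α p q ≤ d ↔ ∀ w : Fin m → ℝ, (∀ x, 0 < w x) →
      ∑ x, (p x * deformedLog (1 - 1 / α) (w x) - q x * w x) ≤ boundTransform α d := by
  by_cases hgood : ∀ x, p x ≠ 0 → q x = 0 → α < 1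
  · rw [classRenyi_le_iff_sum_youngSup_le hα hp hq hsum hgood]
    constructor
    · exact fun h w hw => (Finset.sum_le_sum fun x _ =>
        le_youngSup hα (hp x) (hq x) (hgood x) (hw x)).trans h
    · intro h
      refine le_of_forall_pos_le_add fun ε hε => ?_
      have hδ : 0 < ε / (m + 1) := by positivity
      choose w hw hw' using fun x =>
        exists_youngSup_sub_le hα (hp x) (hq x) (hgood x) hδ
      have h2 := (Finset.sum_le_sum fun x (_ : x ∈ Finset.univ) => hw' x).trans (h w hw)
      rw [Finset.sum_sub_distrib] at h2
      have h3 : ∑ _x : Fin m, ε / (m + 1) ≤ ε := by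
        simp only [Finset.sum_const, Finset.card_univ, Fintype.card_fin, nsmul_eq_mul]
        rw [mul_div_assoc', div_le_iff₀ (by positivity)]
        nlinarith
      linarith
  · push Not at hgood
    obtain ⟨y, hpy, hqy, h1⟩ := hgood
    rw [classRenyi_eq_top hp hq hpy hqy h1]
    refine iff_of_false (by simp) fun h => ?_
    have hs : 0 ≤ 1 - 1 / α := by
      rw [sub_nonneg, div_le_one (by linarith)]
      exact h1
    have hpy' : 0 < p y := lt_of_le_of_ne (hp y) hpy.symm
    set C := ∑ x ∈ Finset.univ.erase y, (p x * deformedLog (1 - 1 / α) 1 - q x * 1)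
    have ht : Tendsto (fun v => p y * deformedLog (1 - 1 / α) v + C) atTop atTop :=
      tendsto_atTop_add_const_right _ _ ((tendsto_deformedLog_atTop hs).const_mul_atTop hpy')
    obtain ⟨v, hv, hv0⟩ :=
      ((ht.eventually_gt_atTop (boundTransform α d)).and (eventually_gt_atTop 0)).exists
    have h2 := h (Function.update (fun _ => 1) y v) (fun x => by
      rcases eq_or_ne x y with rfl | hx
      · simpa using hv0
      · simp [hx])
    rw [← Finset.add_sum_erase _ _ (Finset.mem_univ y)] at h2
    have h3 : ∑ x ∈ Finset.univ.erase y,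
        (p x * deformedLog (1 - 1 / α) (Function.update (fun _ => (1 : ℝ)) y v x) -
          q x * Function.update (fun _ => (1 : ℝ)) y v x) = C :=
      Finset.sum_congr rfl fun x hx => by
        rw [Function.update_of_ne (Finset.ne_of_mem_erase hx)]
    rw [h3, Function.update_self, hqy] at h2
    linarith

lemma classRenyi_ne_bot (hα : 1 / 2 ≤ α) (hp : ∀ x, 0 ≤ p x)
    (hq : ∀ x, 0 ≤ q x) (hsum : ∑ x, p x = 1) : classRenyi α p q ≠ ⊥ := by
  by_cases hgood : ∀ x, p x ≠ 0 → q x = 0 → α < 1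
  · rcases eq_or_ne α 1 with rfl | h1
    · rw [classRenyi_one_eq fun x h h' => lt_irrefl _ (hgood x h h')]
      exact EReal.coe_ne_bot _
    rw [classRenyi_eq_of_ne_one hα h1 hgood]
    rcases lt_or_gt_of_ne h1 with h | h
    · have h2 : (α - 1)⁻¹ < 0 := inv_neg''.2 (by linarith)
      unfold erealLog
      split_ifs with h3 h4
      · simp [EReal.coe_mul_bot_of_neg h2]
      · exact absurd h4 (EReal.coe_ne_top _)
      · rw [← EReal.coe_mul]
        exact EReal.coe_ne_bot _
    · have hQ : 0 < ∑ x, p x ^ α * q x ^ (1 - α) := by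
        have hex : ∃ x, p x ≠ 0 := by
          by_contra! hall
          simp [hall] at hsum
        obtain ⟨y, hy⟩ := hex
        refine Finset.sum_pos' (fun x _ =>
          mul_nonneg (Real.rpow_nonneg (hp x) _) (Real.rpow_nonneg (hq x) _))
          ⟨y, Finset.mem_univ y, ?_⟩
        have hqy : q y ≠ 0 := fun h' => by linarith [hgood y hy h']
        exact mul_pos (Real.rpow_pos_of_pos (lt_of_le_of_ne (hp y) hy.symm) _)
          (Real.rpow_pos_of_pos (lt_of_le_of_ne (hq y) hqy.symm) _)
      generalize ∑ x, p x ^ α * q x ^ (1 - α) = Q at hQ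
      have hQ' : ¬ ((Q : EReal) ≤ 0) := by simpa using hQ
      rw [erealLog, if_neg hQ', if_neg (EReal.coe_ne_top _), ← EReal.coe_mul]
      exact EReal.coe_ne_bot _
  · push Not at hgood
    obtain ⟨y, hpy, hqy, h1⟩ := hgood
    rw [classRenyi_eq_top hp hq hpy hqy h1]
    simp

end Classical

open scoped MatrixOrder in
lemma trace_mul_re_nonneg {ι : Type*} [Fintype ι] [DecidableEq ι] {A B : Matrix ι ι ℂ}
    (hA : A.PosSemidef) (hB : B.PosSemidef) : 0 ≤ (A * B).trace.re := by
  obtain ⟨a, rfl⟩ := CStarAlgebra.nonneg_iff_eq_star_mul_self.mp hA.nonneg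
  have h : (star a * a * B).trace = (a * B * aᴴ).trace := by
    rw [star_eq_conjTranspose, Matrix.mul_assoc, Matrix.trace_mul_comm]
  rw [h]
  exact (Complex.nonneg_iff.1 (hB.mul_mul_conjTranspose_same a).trace_nonneg).1

/-- All variational objectives of measured statistics of `ρ` and `σ` are at most `c`. -/
def ObjectiveBounded (s : ℝ) {ι : Type*} [Fintype ι] [DecidableEq ι]
    (ρ σ : Matrix ι ι ℂ) (c : ℝ) : Prop :=
  ∀ (m : ℕ) (M : Fin m → Matrix ι ι ℂ), ((∀ x, (M x).PosSemidef) ∧ ∑ x, M x = 1) →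
    ∀ w : Fin m → ℝ, (∀ x, 0 < w x) →
      ∑ x, ((ρ * M x).trace.re * deformedLog s (w x) - (σ * M x).trace.re * w x) ≤ c

section Basic

variable {ι : Type*} [Fintype ι] [DecidableEq ι] {ρ σ : Matrix ι ι ℂ}

lemma sum_trace_mul_re {κ : Type*} [Fintype κ] {M : κ → Matrix ι ι ℂ} (hM : ∑ x, M x = 1)
    (A : Matrix ι ι ℂ) : ∑ x, (A * M x).trace.re = A.trace.re := by
  rw [← Complex.re_sum, ← Matrix.trace_sum, ← Finset.mul_sum, hM, Matrix.mul_one]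

lemma measRenyi_le_iff {α : ℝ} (hα : 1 / 2 ≤ α) (hρ : ρ.PosSemidef) (hρtr : ρ.trace = 1)
    (hσ : σ.PosSemidef) (d : ℝ) :
    measRenyi α ρ σ ≤ d ↔ ObjectiveBounded (1 - 1 / α) ρ σ (boundTransform α d) := by
  unfold measRenyi ObjectiveBounded
  simp only [iSup_le_iff]
  refine forall_congr' fun m => forall_congr' fun M => forall_congr' fun hM => ?_
  exact classRenyi_le_iff hα (fun x => trace_mul_re_nonneg hρ (hM.1 x))
    (fun x => trace_mul_re_nonneg hσ (hM.1 x)) (by rw [sum_trace_mul_re hM.2, hρtr]; simp) d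

lemma measRenyi_ne_bot {α : ℝ} (hα : 1 / 2 ≤ α) (hρ : ρ.PosSemidef) (hρtr : ρ.trace = 1)
    (hσ : σ.PosSemidef) : measRenyi α ρ σ ≠ ⊥ := by
  have hM : (∀ _ : Fin 1, (1 : Matrix ι ι ℂ).PosSemidef) ∧
      ∑ _x : Fin 1, (1 : Matrix ι ι ℂ) = 1 := ⟨fun _ => .one, by simp⟩
  have h := classRenyi_ne_bot hα (fun x => trace_mul_re_nonneg hρ (hM.1 x))
    (fun x => trace_mul_re_nonneg hσ (hM.1 x)) (by rw [sum_trace_mul_re hM.2, hρtr]; simp)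
  intro hbot
  refine h (le_bot_iff.1 ?_)
  rw [← hbot]
  exact le_iSup_of_le 1 (le_iSup_of_le (fun _ => 1) (le_iSup_of_le hM le_rfl))

lemma ObjectiveBounded.of_fintype {s c : ℝ} (h : ObjectiveBounded s ρ σ c) {κ : Type*} [Fintype κ]
    (M : κ → Matrix ι ι ℂ) (hM : ∀ x, (M x).PosSemidef) (hM1 : ∑ x, M x = 1)
    (w : κ → ℝ) (hw : ∀ x, 0 < w x) :
    ∑ x, ((ρ * M x).trace.re * deformedLog s (w x) - (σ * M x).trace.re * w x) ≤ c := by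
  let e := (Fintype.equivFin κ).symm
  have := h _ (fun x => M (e x)) ⟨fun x => hM _, by rw [e.sum_comp M, hM1]⟩ (fun x => w (e x))
    (fun x => hw _)
  rwa [e.sum_comp (fun x => (ρ * M x).trace.re * deformedLog s (w x) -
    (σ * M x).trace.re * w x)] at this

/-- The bound specialised to the projective measurement in the basis of columns of `U`. -/
lemma ObjectiveBounded.of_unitary {s c : ℝ} (h : ObjectiveBounded s ρ σ c) {U : Matrix ι ι ℂ}
    (hU : U * Uᴴ = 1) (w : ι → ℝ) (hw : ∀ x, 0 < w x) :
    ∑ i, (((Uᴴ * ρ * U) i i).re * deformedLog s (w i) - ((Uᴴ * σ * U) i i).re * w i) ≤ c := by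
  have hM : ∀ i, (U * Matrix.single i i 1 * Uᴴ).PosSemidef := fun i => by
    refine Matrix.PosSemidef.mul_mul_conjTranspose_same ?_ U
    rw [← Matrix.diagonal_single]
    refine Matrix.PosSemidef.diagonal fun j => ?_
    by_cases hj : j = i
    · subst hj; simp
    · simp [hj]
  have hM1 : ∑ i, U * Matrix.single i i 1 * Uᴴ = 1 := by
    rw [← Finset.sum_mul, ← Finset.mul_sum, Matrix.sum_single_one, Matrix.mul_one, hU]
  have ht : ∀ (A : Matrix ι ι ℂ) i, (A * (U * Matrix.single i i 1 * Uᴴ)).trace =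
      (Uᴴ * A * U) i i := fun A i => by
    rw [← Matrix.mul_assoc, Matrix.trace_mul_comm, ← Matrix.mul_assoc, ← Matrix.mul_assoc,
      Matrix.trace_mul_single]
    simp
  simpa only [ht] using h.of_fintype _ hM hM1 w hw

/-- Adding multiples of the identity to both arguments preserves the bound. -/
lemma ObjectiveBounded.add_smul_one {s c : ℝ} (hs : s ∈ Ico (-1 : ℝ) 1)
    (h : ObjectiveBounded s ρ σ c) {δ : ℝ} (hδ : 0 ≤ δ) :
    ObjectiveBounded s (ρ + (δ : ℂ) • 1) (σ + (δ : ℂ) • 1) c := by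
  intro m M hM w hw
  refine le_trans (Finset.sum_le_sum fun x _ => ?_) (h m M hM w hw)
  have ht : 0 ≤ (M x).trace.re := (Complex.nonneg_iff.1 (hM.1 x).trace_nonneg).1
  have hf : deformedLog s (w x) ≤ w x - 1 := by
    have := deformedLog_le_tangent hs one_pos (hw x)
    have h1 : deformedLog s 1 = 0 := by simp [deformedLog]
    simpa [h1] using this
  have hδt := mul_nonneg hδ ht
  simp only [Matrix.add_mul, Matrix.trace_add, Matrix.smul_mul, Matrix.one_mul, Matrix.trace_smul,
    smul_eq_mul, Complex.add_re, Complex.re_ofReal_mul]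
  nlinarith

/-- Operator Jensen inequality in tangent form at a diagonal operator. -/
lemma objective_le_of_hadamard_divDiff {s : ℝ} (hs : s ∈ Ico (-1 : ℝ) 1) {l : ι → ℝ}
    (hl : ∀ i, 0 < l i) (hρ : ρ.PosSemidef)
    (hσ : ∀ i j, σ i j = (divDiff s (l i) (l j) : ℂ) * ρ i j) :
    ObjectiveBounded s ρ σ (∑ i, ((ρ i i).re * deformedLog s (l i) - (σ i i).re * l i)) := by
  intro m M hM w hw
  set Df : Matrix ι ι ℂ := Matrix.diagonal fun i => (deformedLog s (l i) : ℂ)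
  set Dl : Matrix ι ι ℂ := Matrix.diagonal fun i => (l i : ℂ)
  have key : ∀ x, 0 ≤ ((Df * ρ - Dl * σ) * M x).trace.re -
      ((ρ * M x).trace.re * deformedLog s (w x) - (σ * M x).trace.re * w x) := by
    intro x
    have hN := (posSemidef_map_ofReal (posSemidef_tangentDefect hs l hl (hw x))).hadamard hρ
    have e : ((Matrix.of fun i j => deformedLog s (l i) - deformedLog s (w x) +
      (w x - l i) * divDiff s (l i) (l j)).map ((↑) : ℝ → ℂ)) ⊙ ρ =
        Df * ρ - Dl * σ - ((deformedLog s (w x) : ℂ) • ρ - (w x : ℂ) • σ) := by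
      ext i j
      simp only [Matrix.hadamard_apply, Matrix.map_apply, Matrix.of_apply, Matrix.sub_apply,
        Matrix.smul_apply, Df, Dl, Matrix.diagonal_mul, hσ, smul_eq_mul]
      push_cast
      ring
    have h := trace_mul_re_nonneg hN (hM.1 x)
    rw [e] at h
    simp only [Matrix.sub_mul, Matrix.trace_sub, Matrix.smul_mul, Matrix.trace_smul, smul_eq_mul,
      Complex.sub_re, Complex.re_ofReal_mul] at h
    simp only [Matrix.sub_mul, Matrix.trace_sub, Complex.sub_re]
    linarith
  have h := Finset.sum_nonneg fun x (_ : x ∈ Finset.univ) => key x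
  rw [Finset.sum_sub_distrib, sum_trace_mul_re hM.2, sub_nonneg] at h
  refine h.trans (le_of_eq ?_)
  simp only [Matrix.trace, Matrix.diag, Matrix.sub_apply, Df, Dl, Matrix.diagonal_mul,
    Complex.re_sum, Complex.sub_re, Complex.re_ofReal_mul]
  exact Finset.sum_congr rfl fun i _ => by ring

end Basic

lemma conj_mul_mul_apply {ι : Type*} [Fintype ι] (V P : Matrix ι ι ℂ) (a b : ι) :
    (Vᴴ * P * V) a b = star (V.col a) ⬝ᵥ P *ᵥ V.col b := by
  rw [Matrix.mul_assoc]
  simp [Matrix.mul_apply, dotProduct, mulVec, Matrix.col]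

section Stationarity

variable {ι : Type*} [DecidableEq ι]

/-- The unitary acting on the span of the `i`-th and `j`-th basis vectors as the reflection
with matrix `!![r, conj z; z, -r]`. -/
def planeReflection (i j : ι) (r : ℝ) (z : ℂ) : Matrix ι ι ℂ := Matrix.of fun a b =>
  (if b = i then (r : ℂ) • Pi.single i (1 : ℂ) + z • Pi.single j 1
    else if b = j then star z • Pi.single i 1 - (r : ℂ) • Pi.single j 1
    else Pi.single b 1 : ι → ℂ) a

lemma star_single_one (i : ι) : star (Pi.single i 1 : ι → ℂ) = Pi.single i 1 := by
  rw [← Pi.single_star, star_one]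

lemma planeReflection_col (i j : ι) (r : ℝ) (z : ℂ) (b : ι) :
    (planeReflection i j r z).col b =
      if b = i then (r : ℂ) • Pi.single i (1 : ℂ) + z • Pi.single j 1
      else if b = j then star z • Pi.single i 1 - (r : ℂ) • Pi.single j 1
      else Pi.single b 1 := rfl

variable [Fintype ι] {i j : ι} {P : Matrix ι ι ℂ}

lemma conj_planeReflection_fst (hP : P.IsHermitian) (r : ℝ) (z : ℂ) :
    (((planeReflection i j r z)ᴴ * P * planeReflection i j r z) i i).re =
      r ^ 2 * (P i i).re + Complex.normSq z * (P j j).re + 2 * r * (z * P i j).re := by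
  rw [conj_mul_mul_apply, planeReflection_col, if_pos rfl]
  have h := hP.apply j i
  simp only [star_add, star_smul, star_single_one, mulVec_add, mulVec_smul, dotProduct_add,
    add_dotProduct, smul_dotProduct, dotProduct_smul, mulVec_single_one, single_one_dotProduct,
    ← h, Matrix.col_apply, smul_eq_mul]
  simp [Complex.normSq_apply]
  ring

lemma conj_planeReflection_snd (hij : i ≠ j) (hP : P.IsHermitian) (r : ℝ) (z : ℂ) :
    (((planeReflection i j r z)ᴴ * P * planeReflection i j r z) j j).re =
      Complex.normSq z * (P i i).re + r ^ 2 * (P j j).re - 2 * r * (z * P i j).re := by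
  rw [conj_mul_mul_apply, planeReflection_col, if_neg hij.symm, if_pos rfl]
  have h := hP.apply j i
  simp only [star_sub, star_smul, star_single_one, mulVec_sub, mulVec_smul, dotProduct_sub,
    sub_dotProduct, smul_dotProduct, dotProduct_smul, mulVec_single_one, single_one_dotProduct,
    ← h, Matrix.col_apply, smul_eq_mul]
  simp [Complex.normSq_apply]
  ring

lemma conj_planeReflection_of_ne {b : ι} (hbi : b ≠ i) (hbj : b ≠ j) (r : ℝ) (z : ℂ) :
    ((planeReflection i j r z)ᴴ * P * planeReflection i j r z) b b = P b b := by
  rw [conj_mul_mul_apply, planeReflection_col, if_neg hbi, if_neg hbj, star_single_one]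
  simp

lemma planeReflection_mem (hij : i ≠ j) {r : ℝ} {z : ℂ}
    (hrz : r ^ 2 + Complex.normSq z = 1) :
    (planeReflection i j r z)ᴴ * planeReflection i j r z = 1 := by
  have hz : (r : ℂ) * r + star z * z = 1 := by
    have : star z * z = (Complex.normSq z : ℂ) := by
      rw [Complex.star_def, Complex.normSq_eq_conj_mul_self]
    have h := congrArg ((↑) : ℝ → ℂ) hrz
    push_cast at h
    rw [this]
    linear_combination h
  ext a b
  have h := conj_mul_mul_apply (planeReflection i j r z) 1 a b
  rw [Matrix.mul_one, Matrix.one_mulVec, planeReflection_col, planeReflection_col] at h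
  rw [h, Matrix.one_apply]
  simp only [Complex.star_def] at hz ⊢
  split_ifs <;> subst_vars <;>
    simp_all [star_add, star_sub, star_smul, mul_comm]
  linear_combination hz

/-- The variational objective of the projective measurement in the standard basis. -/
def diagObjective (s : ℝ) (P S : Matrix ι ι ℂ) (w : ι → ℝ) : ℝ :=
  ∑ i, ((P i i).re * deformedLog s (w i) - (S i i).re * w i)

variable {S : Matrix ι ι ℂ} {s : ℝ} {l : ι → ℝ}

lemma rpow_mul_diag_eq_of_isMax (hl : ∀ k, 0 < l k)
    (h : ∀ w : ι → ℝ, (∀ k, 0 < w k) → diagObjective s P S w ≤ diagObjective s P S l) (i : ι) :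
    l i ^ (s - 1) * (P i i).re = (S i i).re := by
  have hle : ∀ v, 0 < v → (P i i).re * deformedLog s v - (S i i).re * v ≤
      (P i i).re * deformedLog s (l i) - (S i i).re * l i := by
    intro v hv
    have h1 := h (Function.update l i v) fun k => by
      rcases eq_or_ne k i with rfl | hk
      · simpa using hv
      · simpa [hk] using hl k
    unfold diagObjective at h1
    rw [← Finset.add_sum_erase _ _ (Finset.mem_univ i),
      ← Finset.add_sum_erase _ _ (Finset.mem_univ i)] at h1
    have h2 : ∑ x ∈ Finset.univ.erase i, ((P x x).re * deformedLog s (Function.update l i v x) -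
        (S x x).re * Function.update l i v x) =
        ∑ x ∈ Finset.univ.erase i, ((P x x).re * deformedLog s (l x) - (S x x).re * l x) :=
      Finset.sum_congr rfl fun x hx => by
        rw [Function.update_of_ne (Finset.ne_of_mem_erase hx)]
    rw [h2, Function.update_self] at h1
    exact le_of_add_le_add_right h1
  have hmax : IsLocalMax (fun v => (P i i).re * deformedLog s v - (S i i).re * v) (l i) := by
    filter_upwards [Ioi_mem_nhds (hl i)] with v hv using hle v hv
  have hd := ((hasDerivAt_deformedLog s (hl i)).const_mul (P i i).re).sub
    ((hasDerivAt_id (l i)).const_mul (S i i).re)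
  have := hmax.hasDerivAt_eq_zero hd
  linarith

/-- The change of the objective under a plane reflection. -/
lemma diagObjective_conj_planeReflection (hij : i ≠ j) (hP : P.IsHermitian) (hS : S.IsHermitian)
    {r : ℝ} {z : ℂ} (hrz : r ^ 2 + Complex.normSq z = 1) :
    diagObjective s ((planeReflection i j r z)ᴴ * P * planeReflection i j r z)
        ((planeReflection i j r z)ᴴ * S * planeReflection i j r z) l =
      diagObjective s P S l +
        Complex.normSq z * ((deformedLog s (l i) - deformedLog s (l j)) * ((P j j).re - (P i i).re)
          - (l i - l j) * ((S j j).re - (S i i).re)) +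
        2 * r * (z * (((deformedLog s (l i) - deformedLog s (l j) : ℝ) : ℂ) * P i j -
          ((l i - l j : ℝ) : ℂ) * S i j)).re := by
  have hj : j ∈ Finset.univ.erase i := by simp [hij.symm]
  have hrz' : r ^ 2 = 1 - Complex.normSq z := by linarith
  have hre : ∀ (a b : ℝ) (x y : ℂ), (z * ((a : ℂ) * x - (b : ℂ) * y)).re =
      a * (z * x).re - b * (z * y).re := fun a b x y => by
    simp
    ring
  unfold diagObjective
  rw [← Finset.add_sum_erase _ _ (Finset.mem_univ i), ← Finset.add_sum_erase _ _ hj,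
    ← Finset.add_sum_erase _ _ (Finset.mem_univ i), ← Finset.add_sum_erase _ _ hj]
  rw [Finset.sum_congr rfl fun x hx => by
    rw [conj_planeReflection_of_ne (P := P) (by simp at hx; tauto) (by simp at hx; tauto),
      conj_planeReflection_of_ne (P := S) (by simp at hx; tauto) (by simp at hx; tauto)]]
  rw [conj_planeReflection_fst hP, conj_planeReflection_fst hS, conj_planeReflection_snd hij hP,
    conj_planeReflection_snd hij hS, hrz', hre]
  ring

lemma eq_zero_of_reflection_bound {C : ℝ} {B : ℂ}
    (h : ∀ (r : ℝ) (z : ℂ), r ^ 2 + Complex.normSq z = 1 →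
      Complex.normSq z * C + 2 * r * (z * B).re ≤ 0) : B = 0 := by
  by_contra hB
  have hn : 0 < Complex.normSq B := Complex.normSq_pos.2 hB
  set n := Complex.normSq B
  have hlim : Tendsto (fun t : ℝ => t * C + 2 * √(1 - t ^ 2 * n)) (𝓝[>] 0) (𝓝 2) := by
    have hc : Continuous fun t : ℝ => t * C + 2 * √(1 - t ^ 2 * n) := by fun_prop
    have := hc.tendsto 0
    simp only [zero_mul, ne_eq, OfNat.ofNat_ne_zero, not_false_eq_true, zero_pow, sub_zero,
      Real.sqrt_one, mul_one, zero_add] at this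
    exact this.mono_left nhdsWithin_le_nhds
  have hsmall : ∀ᶠ t : ℝ in 𝓝[>] 0, 0 < 1 - t ^ 2 * n := by
    have hc : Continuous fun t : ℝ => 1 - t ^ 2 * n := by fun_prop
    exact nhdsWithin_le_nhds (hc.continuousAt.eventually (lt_mem_nhds (by simp)))
  have : (2 : ℝ) ≤ 0 := by
    refine le_of_tendsto hlim ?_
    filter_upwards [hsmall, self_mem_nhdsWithin] with t ht ht0
    have ht0 : 0 < t := ht0
    have h1 : Complex.normSq ((t : ℂ) * star B) = t ^ 2 * n := by
      rw [Complex.normSq_mul, Complex.normSq_ofReal, Complex.star_def, Complex.normSq_conj]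
      ring
    have h2 : ((t : ℂ) * star B * B).re = t * n := by
      rw [mul_assoc, Complex.re_ofReal_mul, Complex.star_def, ← Complex.normSq_eq_conj_mul_self,
        Complex.ofReal_re]
    have h3 := h (√(1 - t ^ 2 * n)) (t * star B) (by rw [Real.sq_sqrt ht.le, h1]; ring)
    rw [h1, h2] at h3
    have h4 : (t * n) * (t * C + 2 * √(1 - t ^ 2 * n)) ≤ 0 := by linarith
    exact nonpos_of_mul_nonpos_right h4 (by positivity)
  linarith

/-- First-order optimality of a projective measurement determines `S` from `P`. -/
lemma eq_divDiff_mul_of_isMax (hl : ∀ k, 0 < l k) (hP : P.IsHermitian) (hS : S.IsHermitian)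
    (h : ∀ V : Matrix ι ι ℂ, Vᴴ * V = 1 → ∀ w : ι → ℝ, (∀ k, 0 < w k) →
      diagObjective s (Vᴴ * P * V) (Vᴴ * S * V) w ≤ diagObjective s P S l) (i j : ι) :
    S i j = (divDiff s (l i) (l j) : ℂ) * P i j := by
  have hdiag := rpow_mul_diag_eq_of_isMax hl fun w hw => by
    simpa using h 1 (by simp) w hw
  rcases eq_or_ne i j with rfl | hij
  · have e : ∀ {A : Matrix ι ι ℂ}, A.IsHermitian → A i i = ((A i i).re : ℂ) := fun hA =>
      (Complex.conj_eq_iff_re.1 (hA.apply i i)).symm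
    rw [e hS, e hP, ← hdiag i]
    simp [divDiff]
  rcases eq_or_ne (l i) (l j) with hlij | hlij
  · have hre : ∀ (r : ℝ) (z : ℂ), r ≠ 0 → r ^ 2 + Complex.normSq z = 1 →
        l i ^ (s - 1) * (z * P i j).re = (z * S i j).re := by
      intro r z hr hrz
      have hmax := rpow_mul_diag_eq_of_isMax
        (P := (planeReflection i j r z)ᴴ * P * planeReflection i j r z)
        (S := (planeReflection i j r z)ᴴ * S * planeReflection i j r z) (s := s) hl
        (fun w hw => by
          rw [diagObjective_conj_planeReflection hij hP hS hrz (l := l)]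
          simpa [hlij] using h _ (planeReflection_mem hij hrz) w hw) i
      rw [conj_planeReflection_fst hP, conj_planeReflection_fst hS] at hmax
      have hi := hdiag i
      have hj := hdiag j
      rw [← hlij] at hj
      have : 2 * r * (l i ^ (s - 1) * (z * P i j).re) = 2 * r * (z * S i j).re := by
        linear_combination hmax - r ^ 2 * hi - Complex.normSq z * hj
      exact mul_left_cancel₀ (by positivity) this
    have h1 := hre (3 / 5) (4 / 5) (by norm_num) (by simp; norm_num)
    have h2 := hre (3 / 5) (4 / 5 * Complex.I) (by norm_num) (by simp; norm_num)
    have hd : divDiff s (l i) (l j) = l i ^ (s - 1) := by simp [divDiff, hlij]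
    rw [hd]
    have c : (4 / 5 : ℂ) = ((4 / 5 : ℝ) : ℂ) := by norm_num
    rw [c, Complex.re_ofReal_mul, Complex.re_ofReal_mul] at h1
    rw [c, mul_assoc, mul_assoc, Complex.re_ofReal_mul, Complex.re_ofReal_mul, Complex.I_mul_re,
      Complex.I_mul_re] at h2
    apply Complex.ext
    · rw [Complex.re_ofReal_mul]; linarith
    · rw [Complex.im_ofReal_mul]; linarith
  · have hB := eq_zero_of_reflection_bound fun r z hrz => by
      have := h _ (planeReflection_mem hij hrz) l hl
      rw [diagObjective_conj_planeReflection hij hP hS hrz, add_assoc] at this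
      exact nonpos_of_add_le_right this
    rw [deformedLog_sub] at hB
    have hne : ((l i - l j : ℝ) : ℂ) ≠ 0 := by exact_mod_cast sub_ne_zero.2 hlij
    refine mul_left_cancel₀ hne ?_
    push_cast at hB ⊢
    linear_combination -hB

end Stationarity

lemma isCompact_of_norm_apply_le {m n : Type*} [Finite m] [Finite n] {K : Set (Matrix m n ℂ)}
    (hK : IsClosed K) {C : ℝ} (h : ∀ M ∈ K, ∀ i j, ‖M i j‖ ≤ C) : IsCompact K := by
  have hc : IsCompact (Set.univ.pi fun _ : m => Set.univ.pi fun _ : n =>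
      Metric.closedBall (0 : ℂ) C) :=
    isCompact_univ_pi fun _ => isCompact_univ_pi fun _ => isCompact_closedBall _ _
  exact IsCompact.of_isClosed_subset (X := m → n → ℂ) hc hK fun M hM i _ j _ => by
    simpa using h M hM i j

open scoped MatrixOrder in
lemma norm_apply_le_trace {ι : Type*} [Fintype ι] [DecidableEq ι] {X : Matrix ι ι ℂ}
    (hX : X.PosSemidef) (i j : ι) : ‖X i j‖ ≤ X.trace.re := by
  obtain ⟨B, rfl⟩ := CStarAlgebra.nonneg_iff_eq_star_mul_self.mp hX.nonneg
  have hd : ∀ i, ((star B * B) i i).re = ∑ k, ‖B k i‖ ^ 2 := fun i => by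
    simp [star_eq_conjTranspose, Matrix.mul_apply, ← Complex.normSq_eq_norm_sq,
      Complex.normSq_apply]
  have ht : ∀ i, ∑ k, ‖B k i‖ ^ 2 ≤ (star B * B).trace.re := fun i => by
    simp only [Matrix.trace, Matrix.diag, Complex.re_sum, hd]
    exact Finset.single_le_sum (f := fun i => ∑ k, ‖B k i‖ ^ 2)
      (fun i _ => Finset.sum_nonneg fun k _ => by positivity) (Finset.mem_univ i)
  have h1 : ‖(star B * B) i j‖ ≤ ∑ k, (‖B k i‖ ^ 2 + ‖B k j‖ ^ 2) / 2 := by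
    rw [Matrix.mul_apply]
    refine (norm_sum_le _ _).trans (Finset.sum_le_sum fun k _ => ?_)
    rw [star_eq_conjTranspose, conjTranspose_apply, norm_mul, norm_star]
    nlinarith [sq_nonneg (‖B k i‖ - ‖B k j‖)]
  rw [← Finset.sum_div, Finset.sum_add_distrib] at h1
  linarith [ht i, ht j]

section Maximizer

variable {ι : Type*} [Fintype ι] [DecidableEq ι] {ρ σ : Matrix ι ι ℂ}

lemma isCompact_unitary : IsCompact {U : Matrix ι ι ℂ | Uᴴ * U = 1} :=
  isCompact_of_norm_apply_le (isClosed_eq (by fun_prop) continuous_const) fun _ hU i j =>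
    entry_norm_bound_of_unitary (Matrix.mem_unitaryGroup_iff'.2 hU) i j

lemma conj_diag_pos (hρ : ρ.PosDef) {U : Matrix ι ι ℂ} (hU : Uᴴ * U = 1) (i : ι) :
    0 < ((Uᴴ * ρ * U) i i).re :=
  (Complex.pos_iff.1 (hρ.conjTranspose_mul_mul_same
    (Matrix.mulVec_injective_of_isUnit (IsUnit.of_mul_eq_one_right _ hU))).diag_pos).1

lemma continuousOn_youngSup (α : ℝ) :
    ContinuousOn (fun x : ℝ × ℝ => youngSup α x.1 x.2) (Ioi 0 ×ˢ Ioi 0) := by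
  intro x hx
  have h1 : x.1 ≠ 0 := (mem_Ioi.1 hx.1).ne'
  have h2 : x.2 ≠ 0 := (mem_Ioi.1 hx.2).ne'
  refine ContinuousAt.continuousWithinAt ?_
  unfold youngSup
  split_ifs
  · exact (continuousAt_fst.mul ((continuousAt_fst.div continuousAt_snd h2).log
      (div_ne_zero h1 h2))).sub continuousAt_fst
  · exact (((continuousAt_fst.rpow_const (Or.inl h1)).mul
      (continuousAt_snd.rpow_const (Or.inl h2))).sub
      (continuousAt_const.mul continuousAt_fst)).div_const _

/-- For positive definite operators the variational objective is maximised by a projective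
measurement. -/
lemma exists_isMax_diagObjective {α : ℝ} (hα : 1 / 2 ≤ α) (hρ : ρ.PosDef) (hσ : σ.PosDef) :
    ∃ U : Matrix ι ι ℂ, Uᴴ * U = 1 ∧ ∃ l : ι → ℝ, (∀ i, 0 < l i) ∧
      ∀ V : Matrix ι ι ℂ, Vᴴ * V = 1 → ∀ w : ι → ℝ, (∀ i, 0 < w i) →
        diagObjective (1 - 1 / α) (Vᴴ * (Uᴴ * ρ * U) * V) (Vᴴ * (Uᴴ * σ * U) * V) w ≤
          diagObjective (1 - 1 / α) (Uᴴ * ρ * U) (Uᴴ * σ * U) l := by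
  have hcont : ContinuousOn (fun U : Matrix ι ι ℂ =>
      ∑ i, youngSup α ((Uᴴ * ρ * U) i i).re ((Uᴴ * σ * U) i i).re) {U | Uᴴ * U = 1} := by
    refine continuousOn_finsetSum _ fun i _ => ?_
    refine (continuousOn_youngSup α).comp (f := fun U : Matrix ι ι ℂ =>
      (((Uᴴ * ρ * U) i i).re, ((Uᴴ * σ * U) i i).re)) ?_ fun U hU =>
        ⟨conj_diag_pos hρ hU i, conj_diag_pos hσ hU i⟩
    exact Continuous.continuousOn (by fun_prop)
  obtain ⟨U, hU, hmax⟩ := isCompact_unitary.exists_isMaxOn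
    ⟨1, by simp⟩ hcont
  have hp := conj_diag_pos hρ hU
  have hq := conj_diag_pos hσ hU
  refine ⟨U, hU, fun i => (((Uᴴ * ρ * U) i i).re / ((Uᴴ * σ * U) i i).re) ^ α,
    fun i => Real.rpow_pos_of_pos (div_pos (hp i) (hq i)) _, fun V hV w hw => ?_⟩
  have hUV : (U * V)ᴴ * (U * V) = 1 := by
    rw [conjTranspose_mul, Matrix.mul_assoc, ← Matrix.mul_assoc Uᴴ, hU, Matrix.one_mul, hV]
  have e : ∀ A : Matrix ι ι ℂ, Vᴴ * (Uᴴ * A * U) * V = (U * V)ᴴ * A * (U * V) := fun A => by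
    simp only [conjTranspose_mul, Matrix.mul_assoc]
  rw [e, e]
  calc _ ≤ ∑ i, youngSup α (((U * V)ᴴ * ρ * (U * V)) i i).re
          (((U * V)ᴴ * σ * (U * V)) i i).re :=
        Finset.sum_le_sum fun i _ =>
          le_youngSup_of_pos hα (conj_diag_pos hρ hUV i) (conj_diag_pos hσ hUV i) (hw i)
    _ ≤ ∑ i, youngSup α ((Uᴴ * ρ * U) i i).re ((Uᴴ * σ * U) i i).re := hmax hUV
    _ = _ := Finset.sum_congr rfl fun i _ => youngSup_eq hα (hp i) (hq i)

lemma ObjectiveBounded.conj {s c : ℝ} {W : Matrix ι ι ℂ} (hW : Wᴴ * W = 1)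
    (h : ObjectiveBounded s (Wᴴ * ρ * W) σ c) : ObjectiveBounded s ρ (W * σ * Wᴴ) c := by
  intro m M hM w hw
  have hW' : W * Wᴴ = 1 := mul_eq_one_comm.1 hW
  have := h m (fun x => Wᴴ * M x * W) ⟨fun x => (hM.1 x).conjTranspose_mul_mul_same W, by
    rw [← Finset.sum_mul, ← Finset.mul_sum, hM.2, Matrix.mul_one, hW]⟩ w hw
  have e1 : ∀ x, (Wᴴ * ρ * W * (Wᴴ * M x * W)).trace = (ρ * M x).trace := fun x => by
    have : Wᴴ * ρ * W * (Wᴴ * M x * W) = Wᴴ * (ρ * (W * Wᴴ) * M x * W) := by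
      simp only [Matrix.mul_assoc]
    rw [this, Matrix.trace_mul_comm, hW', Matrix.mul_one, Matrix.mul_assoc _ W, hW', Matrix.mul_one]
  have e2 : ∀ x, (σ * (Wᴴ * M x * W)).trace = (W * σ * Wᴴ * M x).trace := fun x => by
    rw [← Matrix.mul_assoc, Matrix.trace_mul_comm]
    simp only [Matrix.mul_assoc]
  simpa only [e1, e2] using this

end Maximizer

section PartialTrace

variable {ιA ιR : Type*} [Fintype ιR]

lemma posSemidef_ptraceR {X : Matrix (ιA × ιR) (ιA × ιR) ℂ} (hX : X.PosSemidef) :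
    (ptraceR X).PosSemidef := by
  have : ptraceR X = ∑ k : ιR, X.submatrix (fun i => (i, k)) (fun i => (i, k)) := by
    ext i j
    simp [ptraceR, Matrix.sum_apply]
  rw [this]
  exact Matrix.posSemidef_sum _ fun k _ => hX.submatrix _

lemma continuous_ptraceR :
    Continuous (ptraceR : Matrix (ιA × ιR) (ιA × ιR) ℂ → Matrix ιA ιA ℂ) :=
  continuous_matrix fun i j => continuous_finsetSum _ fun k _ => by fun_prop

lemma trace_ptraceR [Fintype ιA] (X : Matrix (ιA × ιR) (ιA × ιR) ℂ) :
    (ptraceR X).trace = X.trace := by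
  simp [Matrix.trace, ptraceR, Fintype.sum_prod_type]

variable [DecidableEq ιR]

lemma ptraceR_add_smul_one [DecidableEq ιA] (X : Matrix (ιA × ιR) (ιA × ιR) ℂ) (ε : ℝ) :
    ptraceR (X + (ε : ℂ) • 1) = ptraceR X + ((ε * Fintype.card ιR : ℝ) : ℂ) • 1 := by
  ext i j
  by_cases hij : i = j
  · subst hij
    simp [ptraceR, Finset.sum_add_distrib, mul_comm]
  · simp [ptraceR, hij]

variable [Fintype ιA]

lemma ptraceR_kronecker_mul (A : Matrix ιA ιA ℂ) (X : Matrix (ιA × ιR) (ιA × ιR) ℂ) :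
    ptraceR (A ⊗ₖ (1 : Matrix ιR ιR ℂ) * X) = A * ptraceR X := by
  ext i j
  simp only [ptraceR, Matrix.mul_apply, Fintype.sum_prod_type, Matrix.kroneckerMap_apply,
    Matrix.one_apply, mul_ite, mul_one, mul_zero, ite_mul, zero_mul, Finset.sum_ite_eq,
    Finset.mem_univ, if_true, Finset.mul_sum]
  exact Finset.sum_comm

lemma ptraceR_mul_kronecker (X : Matrix (ιA × ιR) (ιA × ιR) ℂ) (A : Matrix ιA ιA ℂ) :
    ptraceR (X * A ⊗ₖ (1 : Matrix ιR ιR ℂ)) = ptraceR X * A := by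
  ext i j
  simp only [ptraceR, Matrix.mul_apply, Fintype.sum_prod_type, Matrix.kroneckerMap_apply,
    Matrix.one_apply, mul_ite, mul_one, mul_zero, Finset.sum_ite_eq',
    Finset.mem_univ, if_true, Finset.sum_mul]
  exact Finset.sum_comm

lemma trace_mul_kronecker_one (X : Matrix (ιA × ιR) (ιA × ιR) ℂ) (A : Matrix ιA ιA ℂ) :
    (X * A ⊗ₖ (1 : Matrix ιR ιR ℂ)).trace = (ptraceR X * A).trace := by
  rw [← trace_ptraceR, ptraceR_mul_kronecker]

lemma exists_posSemidef_ptraceR_eq [Nonempty ιR] {σA : Matrix ιA ιA ℂ} (hσA : σA.PosSemidef) :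
    ∃ σAR : Matrix (ιA × ιR) (ιA × ιR) ℂ, σAR.PosSemidef ∧ ptraceR σAR = σA := by
  refine ⟨σA ⊗ₖ (((Fintype.card ιR : ℂ)⁻¹) • 1),
    hσA.kronecker (Matrix.PosSemidef.one.smul (by positivity)), ?_⟩
  ext i j
  simp [ptraceR]
  field_simp

variable [DecidableEq ιA]

/-- Monotonicity of the measured Rényi divergence under the partial trace. -/
lemma measRenyi_ptraceR_le (α : ℝ) (X Y : Matrix (ιA × ιR) (ιA × ιR) ℂ) :
    measRenyi α (ptraceR X) (ptraceR Y) ≤ measRenyi α X Y := by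
  refine iSup_le fun m => iSup_le fun M => iSup_le fun hM => ?_
  have hM' : (∀ x, (M x ⊗ₖ (1 : Matrix ιR ιR ℂ)).PosSemidef) ∧
      ∑ x, M x ⊗ₖ (1 : Matrix ιR ιR ℂ) = 1 := by
    refine ⟨fun x => (hM.1 x).kronecker .one, ?_⟩
    rw [← Matrix.one_kronecker_one, ← hM.2]
    ext i j
    simp [Matrix.sum_apply, Finset.sum_mul]
  refine le_trans (le_of_eq ?_)
    (le_iSup_of_le m (le_iSup_of_le (fun x => M x ⊗ₖ 1) (le_iSup_of_le hM' le_rfl)))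
  simp only [trace_mul_kronecker_one]

variable {α : ℝ} {ρAR : Matrix (ιA × ιR) (ιA × ιR) ℂ} {σA : Matrix ιA ιA ℂ}

lemma exists_extension_of_posDef (hα : 1 / 2 ≤ α) (hρ : ρAR.PosSemidef)
    (hρA : (ptraceR ρAR).PosDef) (hσA : σA.PosDef) {c : ℝ}
    (h : ObjectiveBounded (1 - 1 / α) (ptraceR ρAR) σA c) :
    ∃ σAR : Matrix (ιA × ιR) (ιA × ιR) ℂ, σAR.PosSemidef ∧ ptraceR σAR = σA ∧
      ObjectiveBounded (1 - 1 / α) ρAR σAR c := by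
  obtain ⟨U, hU, l, hl, hmax⟩ := exists_isMax_diagObjective hα hρA hσA
  have hU' : U * Uᴴ = 1 := mul_eq_one_comm.1 hU
  have hs := exponent_mem hα
  set s := 1 - 1 / α
  set P := Uᴴ * ptraceR ρAR * U with hPdef
  set S := Uᴴ * σA * U with hSdef
  have hPS : ∀ i j, S i j = (divDiff s (l i) (l j) : ℂ) * P i j :=
    eq_divDiff_mul_of_isMax hl (isHermitian_conjTranspose_mul_mul U hρA.1)
      (isHermitian_conjTranspose_mul_mul U hσA.1) hmax
  set W : Matrix (ιA × ιR) (ιA × ιR) ℂ := U ⊗ₖ 1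
  have hWs : Wᴴ = Uᴴ ⊗ₖ 1 := by simp [W, conjTranspose_kronecker]
  have hW : Wᴴ * W = 1 := by
    rw [hWs, ← Matrix.mul_kronecker_mul, hU, Matrix.one_mul, Matrix.one_kronecker_one]
  set ρ' := Wᴴ * ρAR * W
  have hρ' : ρ'.PosSemidef := hρ.conjTranspose_mul_mul_same W
  have hptρ : ptraceR ρ' = P := by
    simp only [ρ', hWs]
    rw [ptraceR_mul_kronecker, ptraceR_kronecker_mul]
  set σ' : Matrix (ιA × ιR) (ιA × ιR) ℂ :=
    (Matrix.of fun i j : ιA × ιR => divDiff s (l i.1) (l j.1)).map ((↑) : ℝ → ℂ) ⊙ ρ'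
  have hσ' : σ'.PosSemidef :=
    (posSemidef_map_ofReal (posSemidef_divDiff hs (fun i : ιA × ιR => l i.1)
      fun i => hl i.1)).hadamard hρ'
  have hptσ : ptraceR σ' = S := by
    ext i j
    rw [hPS, ← hptρ]
    simp [ptraceR, σ', Finset.mul_sum]
  refine ⟨W * σ' * Wᴴ, hσ'.mul_mul_conjTranspose_same W, ?_, ?_⟩
  · rw [hWs, ptraceR_mul_kronecker, ptraceR_kronecker_mul, hptσ, hSdef]
    have : U * (Uᴴ * σA * U) * Uᴴ = (U * Uᴴ) * σA * (U * Uᴴ) := by simp only [Matrix.mul_assoc]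
    rw [this, hU', Matrix.one_mul, Matrix.mul_one]
  · refine ObjectiveBounded.conj hW fun m M hM w hw => ?_
    refine (objective_le_of_hadamard_divDiff hs (fun i : ιA × ιR => hl i.1) hρ'
      (σ := σ') (fun i j => rfl) m M hM w hw).trans (le_trans (le_of_eq ?_)
        (h.of_unitary hU' l hl))
    rw [Fintype.sum_prod_type]
    refine Finset.sum_congr rfl fun i _ => ?_
    dsimp only
    rw [Finset.sum_sub_distrib, ← Finset.sum_mul, ← Finset.sum_mul, ← Complex.re_sum,
      ← Complex.re_sum, ← hPdef, ← hSdef, ← hptρ, ← hptσ]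
    rfl

lemma exists_extension (hα : 1 / 2 ≤ α) (hρ : ρAR.PosSemidef) (hσA : σA.PosSemidef)
    [Nonempty ιR] {c : ℝ} (h : ObjectiveBounded (1 - 1 / α) (ptraceR ρAR) σA c) :
    ∃ σAR : Matrix (ιA × ιR) (ιA × ιR) ℂ, σAR.PosSemidef ∧ ptraceR σAR = σA ∧
      ObjectiveBounded (1 - 1 / α) ρAR σAR c := by
  set n : ℝ := ((Fintype.card ιR : ℕ) : ℝ)
  have hn : 0 < n := Nat.cast_pos.2 Fintype.card_pos
  set C : ℝ := (σA + ((1 * n : ℝ) : ℂ) • 1).trace.re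
  set K : Set (Matrix (ιA × ιR) (ιA × ιR) ℂ) := {X | X.PosSemidef ∧ X.trace.re ≤ C}
  have hK : IsCompact K := by
    refine isCompact_of_norm_apply_le (C := C) ?_ fun X hX i j =>
      (norm_apply_le_trace hX.1 i j).trans hX.2
    have hc : Continuous fun X : Matrix (ιA × ιR) (ιA × ιR) ℂ => X.trace.re := by fun_prop
    exact isClosed_posSemidef.inter (isClosed_le hc continuous_const)
  set T : Set (ℝ × Matrix (ιA × ιR) (ιA × ιR) ℂ) :=
    {x | ptraceR x.2 = σA + ((x.1 * n : ℝ) : ℂ) • 1 ∧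
      ObjectiveBounded (1 - 1 / α) (ρAR + (x.1 : ℂ) • 1) x.2 c}
  have hT : IsClosed T := by
    simp only [T, ObjectiveBounded, ofPred_and, ofPred_forall]
    refine IsClosed.inter (isClosed_eq (continuous_ptraceR.comp continuous_snd) (by fun_prop)) ?_
    refine isClosed_iInter fun m => isClosed_iInter fun M => isClosed_iInter fun _ =>
      isClosed_iInter fun w => isClosed_iInter fun _ => isClosed_le ?_ continuous_const
    fun_prop
  have himage : IsClosed (Prod.fst '' ((Icc (0 : ℝ) 1 ×ˢ K) ∩ T)) :=
    (((isCompact_Icc.prod hK).inter_right hT).image continuous_fst).isClosed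
  have hpos : Ioc (0 : ℝ) 1 ⊆ Prod.fst '' ((Icc (0 : ℝ) 1 ×ˢ K) ∩ T) := by
    intro ε hε
    have hεn : 0 < ε * n := mul_pos hε.1 hn
    have hone : (((ε * n : ℝ) : ℂ) • (1 : Matrix ιA ιA ℂ)).PosDef :=
      Matrix.PosDef.one.smul (by exact_mod_cast hεn)
    have hptρ := ptraceR_add_smul_one ρAR ε
    obtain ⟨X, hX, hXA, hXc⟩ := exists_extension_of_posDef (ρAR := ρAR + (ε : ℂ) • 1)
      (σA := σA + ((ε * n : ℝ) : ℂ) • 1) (c := c) hα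
      (hρ.add (Matrix.PosSemidef.one.smul (by exact_mod_cast hε.1.le)))
      (by rw [hptρ]; exact hone.posSemidef_add (posSemidef_ptraceR hρ))
      (hone.posSemidef_add hσA)
      (by rw [hptρ]; exact h.add_smul_one (exponent_mem hα) hεn.le)
    refine ⟨(ε, X), ⟨⟨⟨hε.1.le, hε.2⟩, hX, ?_⟩, hXA, hXc⟩, rfl⟩
    rw [← trace_ptraceR, hXA]
    simp only [C, Matrix.trace_add, Matrix.trace_smul, Matrix.trace_one, smul_eq_mul,
      Complex.add_re, Complex.re_ofReal_mul, Complex.natCast_re]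
    gcongr
    exact hε.2
  have h0 : (0 : ℝ) ∈ Prod.fst '' ((Icc (0 : ℝ) 1 ×ˢ K) ∩ T) := by
    refine himage.closure_subset_iff.2 hpos ?_
    rw [closure_Ioc (by norm_num)]
    simp
  obtain ⟨⟨ε, X⟩, ⟨⟨-, hX, -⟩, hXA, hXc⟩, rfl : ε = 0⟩ := h0
  exact ⟨X, hX, by simpa using hXA, by simpa using hXc⟩

lemma exists_measRenyi_eq [Nonempty ιR] (hα : 1 / 2 ≤ α) (hρ : ρAR.PosSemidef)
    (hρtr : ρAR.trace = 1) (hσA : σA.PosSemidef) :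
    ∃ σAR : Matrix (ιA × ιR) (ιA × ιR) ℂ, (σAR.PosSemidef ∧ ptraceR σAR = σA) ∧
      measRenyi α ρAR σAR = measRenyi α (ptraceR ρAR) σA := by
  have hρA := posSemidef_ptraceR hρ
  have hρAtr : (ptraceR ρAR).trace = 1 := by rw [trace_ptraceR, hρtr]
  have hbot := measRenyi_ne_bot hα hρA hρAtr hσA
  induction hd : measRenyi α (ptraceR ρAR) σA with
  | bot => exact absurd hd hbot
  | top =>
    obtain ⟨X, hX, rfl⟩ := exists_posSemidef_ptraceR_eq (ιR := ιR) hσA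
    exact ⟨X, ⟨hX, rfl⟩, top_le_iff.1 (hd ▸ measRenyi_ptraceR_le α ρAR X)⟩
  | coe d =>
    obtain ⟨X, hX, rfl, hXc⟩ := exists_extension hα hρ hσA
      ((measRenyi_le_iff hα hρA hρAtr hσA d).1 hd.le)
    exact ⟨X, ⟨hX, rfl⟩, le_antisymm ((measRenyi_le_iff hα hρ hρtr hX d).2 hXc)
      (hd ▸ measRenyi_ptraceR_le α ρAR X)⟩

end PartialTrace

end MeasuredRenyi

/-- Uhlmann's theorem for measured Rényi divergences, `α ∈ [1/2, ∞)`: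
the infimum over extensions `σ_{AR}` of `σ_A` of `D_{M,α}(ρ_{AR}‖σ_{AR})`
equals `D_{M,α}(ρ_A‖σ_A)`, and the infimum is attained. -/
theorem uhlmann_measured_renyi_second {ιA ιR : Type*} [Fintype ιA] [DecidableEq ιA]
    [Fintype ιR] [DecidableEq ιR] [Nonempty ιR]
    (α : ℝ) (hα : 1 / 2 ≤ α)
    (ρAR : Matrix (ιA × ιR) (ιA × ιR) ℂ) (hρ : ρAR.PosSemidef) (hρtr : ρAR.trace = 1)
    (σA : Matrix ιA ιA ℂ) (hσA : σA.PosSemidef) :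
    (⨅ (σAR : Matrix (ιA × ιR) (ιA × ιR) ℂ)
        (_ : σAR.PosSemidef ∧ ptraceR σAR = σA),
        measRenyi α ρAR σAR) = measRenyi α (ptraceR ρAR) σA ∧
    ∃ σAR : Matrix (ιA × ιR) (ιA × ιR) ℂ,
      (σAR.PosSemidef ∧ ptraceR σAR = σA) ∧
      measRenyi α ρAR σAR = measRenyi α (ptraceR ρAR) σA := by
  have hex := MeasuredRenyi.exists_measRenyi_eq hα hρ hρtr hσA
  refine ⟨le_antisymm ?_ (le_iInf₂ fun σAR h => ?_), hex⟩
  · obtain ⟨σAR, h, heq⟩ := hex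
    exact (iInf₂_le σAR h).trans heq.le
  · obtain ⟨-, rfl⟩ := h
    exact MeasuredRenyi.measRenyi_ptraceR_le α ρAR σAR

end
end
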